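/- For every natural number k ≥ 2 there exist an infinite-dimensional separable real Banach space X and a bounded linear operator S : X → X with S^k = 0, S^(k-1) ≠ 0, S strictly singular and not compact, such that for every bounded linear operator T : X → X there is a unique tuple (λ_0, …, λ_{k-1}) ∈ ℝ^k for which T − ∑_{i=0}^{k-1} λ_i S^i is a compact operator (so the Calkin algebra L(X)/K(X) is k-dimensional with basis the classes of Id, S, …, S^{k-1}). -/

import Mathlib

/-- A bounded linear operator is strictly singular if for every infinite-dimensional
subspace `Y` and every `c > 0` there is `y ∈ Y` with `‖S y‖ < c * ‖y‖`. -/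
def StrictlySingular {X : Type*} [NormedAddCommGroup X] [NormedSpace ℝ X]
    (S : X →L[ℝ] X) : Prop :=
  ∀ Y : Submodule ℝ X, ¬FiniteDimensional ℝ Y → ∀ c : ℝ, 0 < c → ∃ y ∈ Y, ‖S y‖ < c * ‖y‖

namespace FewOperators

open Filter Topology

set_option linter.unusedSectionVars false

section

/-! ### Numerical parameters -/

/-- The inverse weights `4, 16, 256, …`. -/
def mm (j : ℕ) : ℕ := 4 ^ 2 ^ j

/-- The rapidly increasing bounds on the number of steps allowed for each weight. -/
def nn : ℕ → ℕ
  | 0 => 512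
  | j + 1 => mm (j + 1) ^ 2 * (2 * nn j) ^ (2 ^ (j + 3) + 1)

theorem mm_sq (j : ℕ) : mm j ^ 2 = mm (j + 1) := by
  rw [mm, mm, ← pow_mul, pow_succ 2 j]

theorem mm_sq_eq (j : ℕ) : mm j ^ 2 = 2 ^ 2 ^ (j + 2) := by
  have : (4 : ℕ) = 2 ^ 2 := by norm_num
  rw [mm, this, ← pow_mul, ← pow_mul]
  congr 1
  ring

theorem four_le_mm (j : ℕ) : 4 ≤ mm j := by
  have : 2 ^ j ≠ 0 := by positivity
  exact Nat.le_self_pow this 4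

theorem mm_mono : Monotone mm := fun i j h =>
  Nat.pow_le_pow_right (by norm_num) (Nat.pow_le_pow_right (by norm_num) h)

theorem mm_sq_le {i j : ℕ} (h : i < j) : mm i ^ 2 ≤ mm j := by
  rw [mm_sq]; exact mm_mono h

theorem lt_mm (j : ℕ) : j < mm j :=
  (Nat.lt_two_pow_self).trans (Nat.lt_pow_self (by norm_num))

theorem mm_sq_le_nn (j : ℕ) : mm j ^ 2 ≤ nn j := by
  cases j with
  | zero => norm_num [mm, nn]
  | succ j =>
    rw [nn]
    apply Nat.le_mul_of_pos_right
    have : 0 < nn j := by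
      induction j with
      | zero => norm_num [nn]
      | succ j ih =>
        rw [nn]
        have := four_le_mm (j + 1)
        positivity
    positivity

theorem one_le_nn (j : ℕ) : 1 ≤ nn j :=
  le_trans (Nat.one_le_pow _ _ (by have := four_le_mm j; omega)) (mm_sq_le_nn j)

theorem nn_pow_le (j : ℕ) : mm (j + 1) ^ 2 * (2 * nn j) ^ (2 ^ (j + 3) + 1) ≤ nn (j + 1) :=
  le_of_eq rfl

theorem mm_mul_nn_le_succ (j : ℕ) : mm j * nn j ≤ nn (j + 1) := by
  refine le_trans ?_ (nn_pow_le j)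
  have h1 : mm j ≤ mm (j + 1) ^ 2 :=
    (mm_mono (Nat.le_succ j)).trans (Nat.le_self_pow (by norm_num) _)
  have h2 : nn j ≤ (2 * nn j) ^ (2 ^ (j + 3) + 1) :=
    le_trans (by omega) (Nat.le_self_pow (by positivity) _)
  exact Nat.mul_le_mul h1 h2

theorem nn_mono : Monotone nn := monotone_nat_of_le_succ fun j =>
  le_trans (Nat.le_mul_of_pos_left _ (by have := four_le_mm j; omega)) (mm_mul_nn_le_succ j)

theorem mm_mul_nn_le {i j : ℕ} (h : i < j) : mm i * nn i ≤ nn j :=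
  (mm_mul_nn_le_succ i).trans (nn_mono h)

theorem exists_growth (j : ℕ) : ∃ M s : ℕ, 1 ≤ M ∧ (∀ i < j, nn i ≤ M) ∧
    mm j ^ 2 ≤ 2 ^ s ∧ mm j ^ 2 * (2 * M) ^ (s + 1) ≤ nn j := by
  cases j with
  | zero => exact ⟨1, 4, le_rfl, by simp, by norm_num [mm], by norm_num [mm, nn]⟩
  | succ j =>
    refine ⟨nn j, 2 ^ (j + 3), one_le_nn j, fun i hi => nn_mono (by omega), ?_, nn_pow_le j⟩
    rw [mm_sq_eq]

theorem exists_pow_growth (j : ℕ) : ∃ s : ℕ, nn j ^ s ≤ nn (j + 1) ∧ mm (j + 1) ^ 2 ≤ 2 ^ s := by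
  refine ⟨2 ^ (j + 3), ?_, by rw [mm_sq_eq]⟩
  refine le_trans ?_ (nn_pow_le j)
  have h0 := one_le_nn j
  calc nn j ^ 2 ^ (j + 3) ≤ (2 * nn j) ^ 2 ^ (j + 3) := Nat.pow_le_pow_left (by omega) _
    _ ≤ (2 * nn j) ^ (2 ^ (j + 3) + 1) := Nat.pow_le_pow_right (by omega) (by omega)
    _ ≤ _ := Nat.le_mul_of_pos_left _ (by have := four_le_mm (j + 1); positivity)

/-! ### Node systems -/

/-- A finitely supported functional with rational coefficients: a list of triples
`(η, i, q)`, standing for the sum of the maps `x ↦ q • N ^ i (x η)`. -/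
abbrev Fn := List (ℕ × ℕ × ℚ)

/-- The sum of the absolute values of the coefficients. -/
def Fn.size (b : Fn) : ℚ := (b.map fun a => |a.2.2|).sum

/-- The combinatorial data of a Bourgain–Delbaen construction of Argyros–Haydon type. -/
structure NodeSystem where
  /-- the predecessor of a node -/
  pre : ℕ → Option ℕ
  /-- the index of the weight of a node -/
  wt : ℕ → ℕ
  /-- the functional attached to a node -/
  fn : ℕ → Fn
  /-- the number of steps leading to a node -/
  age : ℕ → ℕ
  wt_le : ∀ γ, wt γ ≤ γ
  pre_lt : ∀ {γ ξ}, pre γ = some ξ → ξ < γ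
  wt_pre : ∀ {γ ξ}, pre γ = some ξ → wt ξ = wt γ
  age_pre : ∀ {γ ξ}, pre γ = some ξ → age γ = age ξ + 1
  age_none : ∀ {γ}, pre γ = none → age γ = 1
  age_le : ∀ γ, age γ ≤ nn (wt γ)
  fn_lt : ∀ γ, ∀ a ∈ fn γ, a.1 < γ
  fn_size : ∀ γ, (fn γ).size ≤ 1
  special : ∀ γ, Odd (wt γ) → ∃ η, fn γ = [(η, 0, 1)] ∧ nn (wt γ) ^ 2 ≤ mm (wt η) ∧
    ((pre γ = none ∧ 4 ∣ wt η) ∨ ∃ ξ, pre γ = some ξ ∧ wt η = 4 * ξ + 2)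
  exists_even : ∀ (o : Option ℕ) (j : ℕ) (b : Fn) (K : ℕ), Even j → b.size ≤ 1 →
    (∀ ξ, o = some ξ → wt ξ = j ∧ age ξ < nn j) → ∃ γ ≥ K, pre γ = o ∧ wt γ = j ∧ fn γ = b
  exists_odd : ∀ (o : Option ℕ) (j η K : ℕ), Odd j → nn j ^ 2 ≤ mm (wt η) →
    (o = none → 4 ∣ wt η) → (∀ ξ, o = some ξ → wt ξ = j ∧ age ξ < nn j ∧ wt η = 4 * ξ + 2) →
    ∃ γ ≥ K, pre γ = o ∧ wt γ = j ∧ fn γ = [(η, 0, 1)]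

/-- The record of a node used in the recursive construction. -/
structure NodeRec where
  pre : Option ℕ
  wt : ℕ
  fn : Fn
  age : ℕ

/-- A proposed node is admissible at stage `γ`, given the earlier nodes. -/
def Admissible (f : ℕ → NodeRec) (γ : ℕ) (d : Option ℕ × ℕ × Fn) : Prop :=
  d.2.1 ≤ γ ∧ (∀ a ∈ d.2.2, a.1 < γ) ∧ d.2.2.size ≤ 1 ∧
  (∀ ξ, d.1 = some ξ → ξ < γ ∧ (f ξ).wt = d.2.1 ∧ (f ξ).age < nn d.2.1) ∧
  (Odd d.2.1 → ∃ η, d.2.2 = [(η, 0, 1)] ∧ nn d.2.1 ^ 2 ≤ mm (f η).wt ∧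
    ((d.1 = none ∧ 4 ∣ (f η).wt) ∨ ∃ ξ, d.1 = some ξ ∧ (f η).wt = 4 * ξ + 2))

open Classical in
/-- The node at stage `γ` in terms of the earlier ones. -/
noncomputable def nextNode (f : ℕ → NodeRec) (γ : ℕ) (d : Option ℕ × ℕ × Fn) : NodeRec :=
  if Admissible f γ d then ⟨d.1, d.2.1, d.2.2, d.1.elim 1 fun ξ => (f ξ).age + 1⟩
  else ⟨none, 0, [], 1⟩

/-- An enumeration of all potential nodes, each occurring infinitely often. -/
def proposal (γ : ℕ) : Option ℕ × ℕ × Fn :=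
  (Encodable.decode (Nat.unpair γ).2).getD (none, 0, [])

theorem exists_proposal (d : Option ℕ × ℕ × Fn) (K : ℕ) : ∃ γ ≥ K, proposal γ = d :=
  ⟨Nat.pair K (Encodable.encode d), Nat.left_le_pair _ _, by simp [proposal]⟩

/-- The recursively constructed nodes. -/
noncomputable def node (γ : ℕ) : NodeRec :=
  nextNode (fun η => if _h : η < γ then node η else ⟨none, 0, [], 1⟩) γ (proposal γ)
termination_by γ

theorem Admissible.congr {f g : ℕ → NodeRec} {γ : ℕ} {d : Option ℕ × ℕ × Fn}
    (h : ∀ η < γ, f η = g η) (H : Admissible f γ d) : Admissible g γ d := by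
  obtain ⟨h1, h2, h3, h4, h5⟩ := H
  refine ⟨h1, h2, h3, fun ξ hξ => ?_, fun ho => ?_⟩
  · obtain ⟨a, b⟩ := h4 ξ hξ
    rw [← h ξ a]
    exact ⟨a, b⟩
  · obtain ⟨η, e1, e2⟩ := h5 ho
    have : η < γ := h2 (η, 0, 1) (by simp [e1])
    refine ⟨η, e1, ?_⟩
    rwa [← h η this]

theorem node_of_admissible {γ : ℕ} (h : Admissible node γ (proposal γ)) :
    node γ = ⟨(proposal γ).1, (proposal γ).2.1, (proposal γ).2.2,
      (proposal γ).1.elim 1 fun ξ => (node ξ).age + 1⟩ := by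
  rw [node, nextNode, if_pos]
  · congr 1
    rcases hd : (proposal γ).1 with _ | ξ
    · rfl
    · simp [(h.2.2.2.1 ξ hd).1]
  · exact h.congr fun η hη => by simp [hη]

theorem node_cases (γ : ℕ) : (Admissible node γ (proposal γ) ∧ node γ = ⟨(proposal γ).1,
      (proposal γ).2.1, (proposal γ).2.2, (proposal γ).1.elim 1 fun ξ => (node ξ).age + 1⟩) ∨
    node γ = ⟨none, 0, [], 1⟩ := by
  by_cases h : Admissible node γ (proposal γ)
  · exact Or.inl ⟨h, node_of_admissible h⟩
  · right
    rw [node, nextNode, if_neg]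
    exact fun h' => h (h'.congr fun η hη => by simp [hη])

/-- The node system produced by the recursion. -/
noncomputable def theNodes : NodeSystem where
  pre γ := (node γ).pre
  wt γ := (node γ).wt
  fn γ := (node γ).fn
  age γ := (node γ).age
  wt_le γ := by
    rcases node_cases γ with ⟨h, e⟩ | e <;> rw [e]
    · exact h.1
    · simp
  pre_lt {γ ξ} hγ := by
    rcases node_cases γ with ⟨h, e⟩ | e <;> rw [e] at hγ
    · exact (h.2.2.2.1 ξ hγ).1
    · simp at hγ
  wt_pre {γ ξ} hγ := by
    rcases node_cases γ with ⟨h, e⟩ | e <;> rw [e] at hγ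
    · rw [(h.2.2.2.1 ξ hγ).2.1, e]
    · simp at hγ
  age_pre {γ ξ} hγ := by
    rcases node_cases γ with ⟨h, e⟩ | e <;> rw [e] at hγ
    · simp only at hγ
      rw [e]
      simp [hγ]
    · simp at hγ
  age_none {γ} hγ := by
    rcases node_cases γ with ⟨h, e⟩ | e <;> rw [e] at hγ
    · simp only at hγ
      rw [e]
      simp [hγ]
    · rw [e]
  age_le γ := by
    rcases node_cases γ with ⟨h, e⟩ | e <;> rw [e]
    · rcases hd : (proposal γ).1 with _ | ξ
      · exact one_le_nn _
      · exact (h.2.2.2.1 ξ hd).2.2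
    · exact one_le_nn _
  fn_lt γ := by
    rcases node_cases γ with ⟨h, e⟩ | e <;> rw [e]
    · exact h.2.1
    · simp
  fn_size γ := by
    rcases node_cases γ with ⟨h, e⟩ | e <;> rw [e]
    · exact h.2.2.1
    · simp [Fn.size]
  special γ ho := by
    rcases node_cases γ with ⟨h, e⟩ | e <;> rw [e] at ho ⊢
    · exact h.2.2.2.2 ho
    · simp at ho
  exists_even o j b K hj hb ho := by
    obtain ⟨γ, hγ, e⟩ := exists_proposal (o, j, b)
      (K + j + (o.elim 0 fun ξ => ξ + 1) + (b.map fun a => a.1 + 1).sum)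
    have : Admissible node γ (proposal γ) := by
      rw [e]
      refine ⟨by simp only; omega, fun a ha => ?_, hb, fun ξ hξ => ⟨?_, ho ξ hξ⟩, fun h => ?_⟩
      · have := List.single_le_sum (l := b.map fun a : ℕ × ℕ × ℚ => a.1 + 1) (by simp) (a.1 + 1)
          (List.mem_map.2 ⟨a, ha, rfl⟩)
        omega
      · simp only at hξ
        rw [hξ] at hγ
        simp only [Option.elim_some] at hγ
        omega
      · exact absurd hj (Nat.not_even_iff_odd.2 h)
    refine ⟨γ, by omega, ?_⟩
    rw [node_of_admissible this, e]
    exact ⟨rfl, rfl, rfl⟩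
  exists_odd o j η K hj hη h0 h1 := by
    obtain ⟨γ, hγ, e⟩ := exists_proposal (o, j, [(η, 0, 1)])
      (K + j + (o.elim 0 fun ξ => ξ + 1) + (η + 1))
    have : Admissible node γ (proposal γ) := by
      rw [e]
      refine ⟨by simp only; omega, fun a ha => ?_, by simp [Fn.size], fun ξ hξ => ⟨?_, ?_⟩,
        fun h => ⟨η, rfl, hη, ?_⟩⟩
      · simp only [List.mem_singleton] at ha
        rw [ha]
        simp only
        omega
      · simp only at hξ
        rw [hξ] at hγ
        simp only [Option.elim_some] at hγ
        omega
      · exact ⟨(h1 ξ hξ).1, (h1 ξ hξ).2.1⟩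
      · rcases o with _ | ξ
        · exact Or.inl ⟨rfl, h0 rfl⟩
        · exact Or.inr ⟨ξ, rfl, (h1 ξ rfl).2.2⟩
    refine ⟨γ, by omega, ?_⟩
    rw [node_of_admissible this, e]
    exact ⟨rfl, rfl, rfl⟩

end

section

/-! ### Coefficient spaces with a nilpotent shift -/

/-- A normed space with a nilpotent contraction `N` and a functional `top` which, together with
the powers of `N`, determines the norm and all linear functionals. -/
class NilShift (E : Type) [NormedAddCommGroup E] [NormedSpace ℝ E] where
  /-- the nilpotent contraction -/
  N : E →ₗ[ℝ] E
  norm_N_le : ∀ v, ‖N v‖ ≤ ‖v‖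
  /-- the generating functional -/
  top : E →ₗ[ℝ] ℝ
  abs_top_le : ∀ v, |top v| ≤ ‖v‖
  /-- the order of nilpotency -/
  ord : ℕ
  exists_top : ∀ v, ∃ i, ‖v‖ ≤ |top ((N ^ i) v)|
  exists_repr : ∀ φ : E →ₗ[ℝ] ℝ, ∃ c : ℕ → ℝ, ∀ v,
    φ v = ∑ i ∈ Finset.range ord, c i * top ((N ^ i) v)
  pow_ord : N ^ ord = 0

open NilShift

variable {E : Type} [NormedAddCommGroup E] [NormedSpace ℝ E] [NilShift E]

theorem norm_pow_le (i : ℕ) (v : E) : ‖((N : E →ₗ[ℝ] E) ^ i) v‖ ≤ ‖v‖ := by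
  induction i with
  | zero => simp
  | succ i ih => rw [pow_succ']; exact (norm_N_le _).trans ih

/-- The action of a rational functional on a sequence of vectors. -/
noncomputable def Fn.ev (b : Fn) : (ℕ → E) →ₗ[ℝ] E :=
  (b.map fun a => (a.2.2 : ℝ) • (((N : E →ₗ[ℝ] E) ^ a.2.1) ∘ₗ LinearMap.proj a.1)).sum

@[simp] theorem Fn.ev_nil (x : ℕ → E) : Fn.ev [] x = 0 := by simp [Fn.ev]

@[simp] theorem Fn.ev_cons (a : ℕ × ℕ × ℚ) (b : Fn) (x : ℕ → E) :
    Fn.ev (a :: b) x = (a.2.2 : ℝ) • ((N : E →ₗ[ℝ] E) ^ a.2.1) (x a.1) + Fn.ev b x := by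
  simp [Fn.ev]

theorem Fn.ev_single (η : ℕ) (x : ℕ → E) : Fn.ev [(η, 0, 1)] x = x η := by simp

theorem Fn.ev_congr {b : Fn} {x y : ℕ → E} (h : ∀ a ∈ b, x a.1 = y a.1) :
    b.ev x = b.ev y := by
  induction b with
  | nil => simp
  | cons a b ih =>
    rw [Fn.ev_cons, Fn.ev_cons, h a (by simp), ih fun c hc => h c (by simp [hc])]

theorem Fn.size_cons (a : ℕ × ℕ × ℚ) (b : Fn) : Fn.size (a :: b) = |a.2.2| + Fn.size b := by
  simp [Fn.size]

theorem Fn.norm_ev_le_size {b : Fn} {x : ℕ → E} {C : ℝ} (h : ∀ a ∈ b, ‖x a.1‖ ≤ C) :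
    ‖b.ev x‖ ≤ b.size * C := by
  induction b with
  | nil => simp [Fn.size]
  | cons a b ih =>
    rw [Fn.ev_cons, Fn.size_cons]
    push_cast
    rw [add_mul]
    refine (norm_add_le _ _).trans (add_le_add ?_ (ih fun c hc => h c (by simp [hc])))
    rw [norm_smul, Real.norm_eq_abs]
    exact mul_le_mul_of_nonneg_left ((norm_pow_le _ _).trans (h a (by simp))) (abs_nonneg _)

theorem Fn.norm_ev_le {b : Fn} (hb : b.size ≤ 1) {x : ℕ → E} {C : ℝ} (hC : 0 ≤ C)
    (h : ∀ a ∈ b, ‖x a.1‖ ≤ C) : ‖b.ev x‖ ≤ C := by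
  refine (Fn.norm_ev_le_size h).trans (mul_le_of_le_one_left hC ?_)
  exact_mod_cast hb

theorem Fn.ev_pow (b : Fn) (x : ℕ → E) (i : ℕ) :
    b.ev (fun n => ((N : E →ₗ[ℝ] E) ^ i) (x n)) = ((N : E →ₗ[ℝ] E) ^ i) (b.ev x) := by
  induction b with
  | nil => simp
  | cons a b ih =>
    rw [Fn.ev_cons, Fn.ev_cons, ih, map_add, map_smul, ← Module.End.mul_apply,
      ← Module.End.mul_apply, ← pow_add, ← pow_add, Nat.add_comm i]

/-! ### Extension operators -/

namespace NodeSystem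

variable (𝒩 : NodeSystem)

/-- The point from which the functional attached to a node is cut off. -/
def start (γ : ℕ) : ℕ := (𝒩.pre γ).elim 0 fun ξ => ξ + 1

theorem start_le (γ : ℕ) : 𝒩.start γ ≤ γ := by
  unfold start
  rcases h : 𝒩.pre γ with _ | ξ
  · simp
  · exact 𝒩.pre_lt h

/-- The value at the predecessor, or `0`. -/
def atPre (γ : ℕ) (x : ℕ → E) : E := (𝒩.pre γ).elim 0 x

theorem atPre_none {γ : ℕ} (h : 𝒩.pre γ = none) (x : ℕ → E) : 𝒩.atPre γ x = 0 := by
  simp [atPre, h]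

theorem atPre_some {γ ξ : ℕ} (h : 𝒩.pre γ = some ξ) (x : ℕ → E) : 𝒩.atPre γ x = x ξ := by
  simp [atPre, h]

theorem atPre_congr {γ : ℕ} {x y : ℕ → E} (h : ∀ η < γ, x η = y η) :
    𝒩.atPre γ x = 𝒩.atPre γ y := by
  rcases e : 𝒩.pre γ with _ | ξ
  · rw [atPre_none _ e, atPre_none _ e]
  · rw [atPre_some _ e, atPre_some _ e, h ξ (𝒩.pre_lt e)]

/-- The values of the extension of `x` restricted to `[0, p)`. -/
noncomputable def extFun (x : ℕ → E) (γ p : ℕ) : E :=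
  if γ < p then x γ else
    𝒩.atPre γ (fun ξ => if _h : ξ < γ then extFun x ξ p else 0) +
      if 𝒩.start γ < p then (mm (𝒩.wt γ) : ℝ)⁻¹ • (𝒩.fn γ).ev
        (fun η => if _h : η < γ then extFun x η p - extFun x η (𝒩.start γ) else 0) else 0
termination_by γ

theorem extFun_of_lt (x : ℕ → E) {γ p : ℕ} (h : γ < p) : 𝒩.extFun x γ p = x γ := by
  rw [extFun, if_pos h]

theorem extFun_of_le (x : ℕ → E) {γ p : ℕ} (h : p ≤ γ) : 𝒩.extFun x γ p =
    𝒩.atPre γ (fun ξ => 𝒩.extFun x ξ p) +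
      if 𝒩.start γ < p then (mm (𝒩.wt γ) : ℝ)⁻¹ • (𝒩.fn γ).ev
        (fun η => 𝒩.extFun x η p - 𝒩.extFun x η (𝒩.start γ)) else 0 := by
  rw [extFun, if_neg (not_lt.2 h)]
  congr 1
  · exact 𝒩.atPre_congr fun η hη => by simp [hη]
  · congr 2
    exact Fn.ev_congr fun a ha => by simp [𝒩.fn_lt γ a ha]

theorem atPre_add (γ : ℕ) (x y : ℕ → E) :
    𝒩.atPre γ (x + y) = 𝒩.atPre γ x + 𝒩.atPre γ y := by
  rcases e : 𝒩.pre γ with _ | ξ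
  · simp [atPre_none _ e]
  · simp [atPre_some _ e]

theorem atPre_smul (γ : ℕ) (c : ℝ) (x : ℕ → E) :
    𝒩.atPre γ (c • x) = c • 𝒩.atPre γ x := by
  rcases e : 𝒩.pre γ with _ | ξ
  · simp [atPre_none _ e]
  · simp [atPre_some _ e]

theorem atPre_pow (γ i : ℕ) (x : ℕ → E) :
    𝒩.atPre γ (fun n => ((N : E →ₗ[ℝ] E) ^ i) (x n)) = ((N : E →ₗ[ℝ] E) ^ i) (𝒩.atPre γ x) := by
  rcases e : 𝒩.pre γ with _ | ξ
  · simp [atPre_none _ e]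
  · simp [atPre_some _ e]

theorem extFun_add (x y : ℕ → E) (γ : ℕ) : ∀ p,
    𝒩.extFun (x + y) γ p = 𝒩.extFun x γ p + 𝒩.extFun y γ p := by
  induction γ using Nat.strong_induction_on with
  | _ γ ih =>
  intro p
  rcases lt_or_ge γ p with h | h
  · simp [extFun_of_lt, h]
  rw [extFun_of_le _ _ h, extFun_of_le _ _ h, extFun_of_le _ _ h]
  rw [𝒩.atPre_congr (y := (fun ξ => 𝒩.extFun x ξ p) + fun ξ => 𝒩.extFun y ξ p)
    fun η hη => ih η hη p, atPre_add]
  split_ifs with hs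
  · rw [Fn.ev_congr (y := (fun η => 𝒩.extFun x η p - 𝒩.extFun x η (𝒩.start γ)) +
      fun η => 𝒩.extFun y η p - 𝒩.extFun y η (𝒩.start γ)), map_add, smul_add]
    · abel
    · intro a ha
      simp only [Pi.add_apply]
      rw [ih _ (𝒩.fn_lt γ a ha), ih _ (𝒩.fn_lt γ a ha)]
      abel
  · simp

theorem extFun_smul (c : ℝ) (x : ℕ → E) (γ : ℕ) : ∀ p,
    𝒩.extFun (c • x) γ p = c • 𝒩.extFun x γ p := by
  induction γ using Nat.strong_induction_on with
  | _ γ ih =>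
  intro p
  rcases lt_or_ge γ p with h | h
  · simp [extFun_of_lt, h]
  rw [extFun_of_le _ _ h, extFun_of_le _ _ h]
  rw [𝒩.atPre_congr (y := c • (fun ξ => 𝒩.extFun x ξ p)) fun η hη => ih η hη p, atPre_smul]
  split_ifs with hs
  · rw [Fn.ev_congr (y := c • (fun η => 𝒩.extFun x η p - 𝒩.extFun x η (𝒩.start γ))), map_smul,
      smul_add, smul_comm c]
    intro a ha
    simp only [Pi.smul_apply]
    rw [ih _ (𝒩.fn_lt γ a ha), ih _ (𝒩.fn_lt γ a ha), smul_sub]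
  · simp

theorem extFun_pow (i : ℕ) (x : ℕ → E) (γ : ℕ) : ∀ p,
    𝒩.extFun (fun n => ((N : E →ₗ[ℝ] E) ^ i) (x n)) γ p =
      ((N : E →ₗ[ℝ] E) ^ i) (𝒩.extFun x γ p) := by
  induction γ using Nat.strong_induction_on with
  | _ γ ih =>
  intro p
  rcases lt_or_ge γ p with h | h
  · simp [extFun_of_lt, h]
  rw [extFun_of_le _ _ h, extFun_of_le _ _ h]
  rw [𝒩.atPre_congr (y := fun n => ((N : E →ₗ[ℝ] E) ^ i) (𝒩.extFun x n p))
    fun η hη => ih η hη p, atPre_pow]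
  split_ifs with hs
  · rw [Fn.ev_congr (y := fun n => ((N : E →ₗ[ℝ] E) ^ i)
      (𝒩.extFun x n p - 𝒩.extFun x n (𝒩.start γ))), map_add, map_smul, Fn.ev_pow]
    intro a ha
    rw [ih _ (𝒩.fn_lt γ a ha), ih _ (𝒩.fn_lt γ a ha), map_sub]
  · simp

/-- The extension operator: restrict to `[0, p)` and extend to all nodes. -/
noncomputable def ext (p : ℕ) : (ℕ → E) →ₗ[ℝ] (ℕ → E) where
  toFun x γ := 𝒩.extFun x γ p
  map_add' x y := funext fun γ => 𝒩.extFun_add x y γ p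
  map_smul' c x := funext fun γ => 𝒩.extFun_smul c x γ p

theorem ext_of_lt (x : ℕ → E) {γ p : ℕ} (h : γ < p) : 𝒩.ext p x γ = x γ :=
  𝒩.extFun_of_lt x h

theorem ext_of_le (x : ℕ → E) {γ p : ℕ} (h : p ≤ γ) : 𝒩.ext p x γ =
    𝒩.atPre γ (𝒩.ext p x) + if 𝒩.start γ < p then (mm (𝒩.wt γ) : ℝ)⁻¹ • (𝒩.fn γ).ev
      (𝒩.ext p x - 𝒩.ext (𝒩.start γ) x) else 0 :=
  𝒩.extFun_of_le x h

theorem ext_pow (i p : ℕ) (x : ℕ → E) :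
    𝒩.ext p (fun n => ((N : E →ₗ[ℝ] E) ^ i) (x n)) =
      fun n => ((N : E →ₗ[ℝ] E) ^ i) (𝒩.ext p x n) :=
  funext fun γ => 𝒩.extFun_pow i x γ p

theorem ext_congr {x y : ℕ → E} (γ : ℕ) : ∀ p, (∀ η < p, x η = y η) →
    𝒩.ext p x γ = 𝒩.ext p y γ := by
  induction γ using Nat.strong_induction_on with
  | _ γ ih =>
  intro p hp
  rcases lt_or_ge γ p with h | h
  · rw [ext_of_lt _ _ h, ext_of_lt _ _ h, hp γ h]
  rw [ext_of_le _ _ h, ext_of_le _ _ h]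
  congr 1
  · exact 𝒩.atPre_congr fun η hη => ih η hη p hp
  · split_ifs with hs
    · congr 1
      refine Fn.ev_congr fun a ha => ?_
      simp only [Pi.sub_apply]
      rw [ih _ (𝒩.fn_lt γ a ha) p hp,
        ih _ (𝒩.fn_lt γ a ha) _ fun η hη => hp η (hη.trans hs)]
    · rfl

theorem ext_ext_of_le {p q : ℕ} (h : p ≤ q) (x : ℕ → E) : 𝒩.ext p (𝒩.ext q x) = 𝒩.ext p x :=
  funext fun γ => 𝒩.ext_congr γ p fun _ hη => 𝒩.ext_of_lt x (hη.trans_le h)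

theorem ext_ext_of_ge {q : ℕ} (x : ℕ → E) {p : ℕ} (hp : q ≤ p) :
    𝒩.ext p (𝒩.ext q x) = 𝒩.ext q x := by
  suffices ∀ γ, ∀ p, q ≤ p → 𝒩.ext p (𝒩.ext q x) γ = 𝒩.ext q x γ from
    funext fun γ => this γ p hp
  intro γ
  induction γ using Nat.strong_induction_on with
  | _ γ ih =>
  intro p hp
  rcases lt_or_ge γ p with h | h
  · rw [ext_of_lt _ _ h]
  rw [ext_of_le _ _ h, ext_of_le _ x (hp.trans h)]
  congr 1
  · exact 𝒩.atPre_congr fun η hη => ih η hη p hp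
  · rcases lt_or_ge (𝒩.start γ) q with hs | hs
    · rw [if_pos hs, if_pos (hs.trans_le hp), ext_ext_of_le _ hs.le]
      congr 1
      refine Fn.ev_congr fun a ha => ?_
      simp only [Pi.sub_apply]
      rw [ih _ (𝒩.fn_lt γ a ha) p hp]
    · rw [if_neg (not_lt.2 hs)]
      split_ifs
      · rw [Fn.ev_congr (y := 0), map_zero, smul_zero]
        intro a ha
        simp only [Pi.sub_apply]
        rw [ih _ (𝒩.fn_lt γ a ha) p hp, ih _ (𝒩.fn_lt γ a ha) _ hs]
        simp
      · rfl

theorem inv_mm_le (j : ℕ) : (mm j : ℝ)⁻¹ ≤ 1 / 4 := by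
  rw [one_div]
  apply inv_anti₀ (by norm_num)
  exact_mod_cast four_le_mm j

theorem inv_mm_nonneg (j : ℕ) : 0 ≤ (mm j : ℝ)⁻¹ := by positivity

theorem norm_ext_le {x : ℕ → E} {C : ℝ} (hC : 0 ≤ C) (γ : ℕ) :
    ∀ p, (∀ η < p, ‖x η‖ ≤ C) → ‖𝒩.ext p x γ‖ ≤ 2 * C := by
  induction γ using Nat.strong_induction_on with
  | _ γ ih =>
  intro p hp
  rcases lt_or_ge γ p with h | h
  · rw [ext_of_lt _ _ h]
    linarith [hp γ h]
  rw [ext_of_le _ _ h]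
  split_ifs with hs
  · have h1 : ‖𝒩.atPre γ (𝒩.ext p x)‖ ≤ C := by
      rcases e : 𝒩.pre γ with _ | ξ
      · simpa [atPre_none _ e] using hC
      · have : ξ < p := by
          simp only [start, e, Option.elim_some] at hs
          omega
        rw [atPre_some _ e, ext_of_lt _ _ this]
        exact hp ξ this
    have h2 : ‖(𝒩.fn γ).ev (𝒩.ext p x - 𝒩.ext (𝒩.start γ) x)‖ ≤ 4 * C := by
      refine Fn.norm_ev_le (𝒩.fn_size γ) (by positivity) fun a ha => ?_
      refine (norm_sub_le _ _).trans ?_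
      have := ih _ (𝒩.fn_lt γ a ha) p hp
      have := ih _ (𝒩.fn_lt γ a ha) (𝒩.start γ) fun η hη => hp η (hη.trans hs)
      linarith
    refine (norm_add_le _ _).trans ?_
    rw [norm_smul, Real.norm_of_nonneg (inv_mm_nonneg _)]
    have := mul_le_mul (inv_mm_le (𝒩.wt γ)) h2 (norm_nonneg _) (by norm_num)
    linarith
  · rw [add_zero]
    rcases e : 𝒩.pre γ with _ | ξ
    · simpa [atPre_none _ e] using hC
    · rw [atPre_some _ e]
      exact ih ξ (𝒩.pre_lt e) p hp

theorem norm_sub_ext_le {x : ℕ → E} {C : ℝ} (h : ∀ η, ‖x η‖ ≤ C) (p γ : ℕ) :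
    ‖(x - 𝒩.ext p x) γ‖ ≤ 3 * C := by
  have h0 : 0 ≤ C := (norm_nonneg _).trans (h 0)
  refine (norm_sub_le _ _).trans ?_
  linarith [h γ, 𝒩.norm_ext_le h0 γ p fun η _ => h η]

/-- The coordinate functionals of the basis. -/
noncomputable def coord (γ : ℕ) : (ℕ → E) →ₗ[ℝ] E :=
  LinearMap.proj γ ∘ₗ (LinearMap.id - 𝒩.ext γ)

theorem coord_apply (γ : ℕ) (x : ℕ → E) : 𝒩.coord γ x = x γ - 𝒩.ext γ x γ := rfl

theorem norm_coord_le {x : ℕ → E} {C : ℝ} (h : ∀ η, ‖x η‖ ≤ C) (γ : ℕ) :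
    ‖𝒩.coord γ x‖ ≤ 3 * C := 𝒩.norm_sub_ext_le h γ γ

theorem apply_eq (γ : ℕ) (x : ℕ → E) : x γ = 𝒩.coord γ x + 𝒩.atPre γ x +
    (mm (𝒩.wt γ) : ℝ)⁻¹ • (𝒩.fn γ).ev (x - 𝒩.ext (𝒩.start γ) x) := by
  rw [coord_apply, ext_of_le _ _ le_rfl]
  have h1 : 𝒩.atPre γ (𝒩.ext γ x) = 𝒩.atPre γ x := 𝒩.atPre_congr fun η hη => 𝒩.ext_of_lt x hη
  have h2 : (𝒩.fn γ).ev (𝒩.ext γ x - 𝒩.ext (𝒩.start γ) x) =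
      (𝒩.fn γ).ev (x - 𝒩.ext (𝒩.start γ) x) :=
    Fn.ev_congr fun a ha => by simp [ext_of_lt _ _ (𝒩.fn_lt γ a ha)]
  rw [h1, h2]
  split_ifs with h
  · abel
  · have e : 𝒩.start γ = γ := le_antisymm (𝒩.start_le γ) (not_lt.1 h)
    rw [e, Fn.ev_congr (y := 0)]
    · simp
    · intro a ha
      simp [ext_of_lt _ _ (𝒩.fn_lt γ a ha)]

/-! ### Blocks -/

/-- `x` is supported on `[p, q)` with respect to the basis. -/
def Blk (p q : ℕ) (x : ℕ → E) : Prop := (∀ γ < p, x γ = 0) ∧ 𝒩.ext q x = x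

variable {𝒩}

theorem Blk.mono {p q p' q' : ℕ} {x : ℕ → E} (h : 𝒩.Blk p q x) (hp : p' ≤ p) (hq : q ≤ q') :
    𝒩.Blk p' q' x :=
  ⟨fun γ hγ => h.1 γ (hγ.trans_le hp), by rw [← h.2, ext_ext_of_ge _ _ hq]⟩

theorem Blk.ext_of_ge {p q r : ℕ} {x : ℕ → E} (h : 𝒩.Blk p q x) (hr : q ≤ r) :
    𝒩.ext r x = x := (h.mono le_rfl hr).2

theorem Blk.ext_of_le {p q r : ℕ} {x : ℕ → E} (h : 𝒩.Blk p q x) (hr : r ≤ p) :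
    𝒩.ext r x = 0 := by
  rw [← map_zero (𝒩.ext r)]
  exact funext fun γ => 𝒩.ext_congr γ r fun η hη => h.1 η (hη.trans_le hr)

variable (𝒩) in
theorem blk_zero (p q : ℕ) : 𝒩.Blk p q (0 : ℕ → E) := ⟨fun _ _ => rfl, map_zero _⟩

theorem Blk.add {p q : ℕ} {x y : ℕ → E} (hx : 𝒩.Blk p q x) (hy : 𝒩.Blk p q y) :
    𝒩.Blk p q (x + y) :=
  ⟨fun γ hγ => by simp [hx.1 γ hγ, hy.1 γ hγ], by rw [map_add, hx.2, hy.2]⟩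

theorem Blk.smul {p q : ℕ} {x : ℕ → E} (hx : 𝒩.Blk p q x) (c : ℝ) : 𝒩.Blk p q (c • x) :=
  ⟨fun γ hγ => by simp [hx.1 γ hγ], by rw [map_smul, hx.2]⟩

theorem Blk.sum {ι : Type*} {s : Finset ι} {p q : ℕ} {x : ι → ℕ → E}
    (h : ∀ i ∈ s, 𝒩.Blk p q (x i)) : 𝒩.Blk p q (∑ i ∈ s, x i) := by
  classical
  induction s using Finset.induction_on with
  | empty => simpa using 𝒩.blk_zero p q
  | insert a s ha ih =>
    rw [Finset.sum_insert ha]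
    exact (h a (by simp)).add (ih fun i hi => h i (by simp [hi]))

theorem Blk.pow {p q : ℕ} {x : ℕ → E} (h : 𝒩.Blk p q x) (i : ℕ) :
    𝒩.Blk p q (fun n => ((N : E →ₗ[ℝ] E) ^ i) (x n)) :=
  ⟨fun γ hγ => by simp [h.1 γ hγ], by rw [ext_pow, h.2]⟩

variable (𝒩) in
theorem blk_ext_sub {p q : ℕ} (h : p ≤ q) (x : ℕ → E) :
    𝒩.Blk p q (𝒩.ext q x - 𝒩.ext p x) := by
  refine ⟨fun γ hγ => ?_, ?_⟩
  · simp [ext_of_lt _ _ hγ, ext_of_lt _ _ (hγ.trans_le h)]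
  · rw [map_sub, ext_ext_of_ge _ _ le_rfl, ext_ext_of_ge _ _ h]

theorem Blk.coord_of_ge {p q γ : ℕ} {x : ℕ → E} (h : 𝒩.Blk p q x) (hγ : q ≤ γ) :
    𝒩.coord γ x = 0 := by rw [coord_apply, h.ext_of_ge hγ, sub_self]

theorem Blk.coord_of_lt {p q γ : ℕ} {x : ℕ → E} (h : 𝒩.Blk p q x) (hγ : γ < p) :
    𝒩.coord γ x = 0 := by rw [coord_apply, h.ext_of_le hγ.le, h.1 γ hγ]; simp

end NodeSystem

end

section

open NilShift

variable {E : Type} [NormedAddCommGroup E] [NormedSpace ℝ E] [NilShift E]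

namespace NodeSystem

variable {𝒩 : NodeSystem}

/-! ### Successive blocks -/

variable (𝒩) in
/-- The first `L` terms of `x` are successive blocks. -/
structure Successive (L : ℕ) (P Q : ℕ → ℕ) (x : ℕ → ℕ → E) : Prop where
  blk : ∀ k < L, 𝒩.Blk (P k) (Q k) (x k)
  le : ∀ k l, k < l → l < L → Q k ≤ P l

theorem Successive.exists_split {L : ℕ} {P Q : ℕ → ℕ} {x : ℕ → ℕ → E}
    (S : 𝒩.Successive L P Q x) (t : ℕ) {a b : ℕ} (hab : a ≤ b) (hb : b ≤ L) :
    ∃ c, a ≤ c ∧ c ≤ b ∧ (∀ k, a ≤ k → k < c → Q k ≤ t) ∧ ∀ k, c < k → k < b → t < P k := by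
  classical
  by_cases h : ∃ c, a ≤ c ∧ c < b ∧ t < Q c
  · refine ⟨Nat.find h, (Nat.find_spec h).1, (Nat.find_spec h).2.1.le, fun k h1 h2 => ?_,
      fun k h1 h2 => ?_⟩
    · by_contra hk
      exact Nat.find_min h h2 ⟨h1, h2.trans (Nat.find_spec h).2.1, not_le.1 hk⟩
    · exact (Nat.find_spec h).2.2.trans_le (S.le _ _ h1 (h2.trans_le hb))
  · refine ⟨b, hab, le_rfl, fun k h1 h2 => ?_, fun k h1 h2 => by omega⟩
    by_contra hk
    exact h ⟨k, h1, h2, not_le.1 hk⟩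

theorem Successive.norm_coord_sum_le {L : ℕ} {P Q : ℕ → ℕ} {x : ℕ → ℕ → E}
    (S : 𝒩.Successive L P Q x) {γ : ℕ} {D : ℝ} (hD : 0 ≤ D)
    (h : ∀ k < L, ‖𝒩.coord γ (x k)‖ ≤ D) {a b : ℕ} (hab : a ≤ b) (hb : b ≤ L) :
    ‖𝒩.coord γ (∑ k ∈ Finset.Ico a b, x k)‖ ≤ D := by
  obtain ⟨c, h1, h2, h3, h4⟩ := S.exists_split γ hab hb
  have h0 : ∀ k ∈ Finset.Ico a b, k ≠ c → 𝒩.coord γ (x k) = 0 := by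
    intro k hk hkc
    rw [Finset.mem_Ico] at hk
    rcases lt_or_gt_of_ne hkc with h | h
    · exact (S.blk k (hk.2.trans_le hb)).coord_of_ge (h3 k hk.1 h)
    · exact (S.blk k (hk.2.trans_le hb)).coord_of_lt (h4 k h hk.2)
  rw [map_sum]
  by_cases hc : c ∈ Finset.Ico a b
  · rw [Finset.sum_eq_single_of_mem c hc h0]
    exact h c ((Finset.mem_Ico.1 hc).2.trans_le hb)
  · rw [Finset.sum_eq_zero]
    · simpa using hD
    · exact fun k hk => h0 k hk fun e => hc (e ▸ hk)

theorem Successive.exists_tail {L : ℕ} {P Q : ℕ → ℕ} {x : ℕ → ℕ → E}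
    (S : 𝒩.Successive L P Q x) (p : ℕ) {a b : ℕ} (hab : a ≤ b) (hb : b ≤ L) :
    ∃ (c d : ℕ) (e : ℕ → E), a ≤ c ∧ c ≤ b ∧ c ≤ d ∧ d ≤ b ∧
      (e = 0 ∨ ∃ k < L, e = x k) ∧
      (∑ k ∈ Finset.Ico a b, x k =
        ∑ k ∈ Finset.Ico a c, x k + e + ∑ k ∈ Finset.Ico d b, x k) ∧
      (∑ k ∈ Finset.Ico a b, x k - 𝒩.ext p (∑ k ∈ Finset.Ico a b, x k) =
        e - 𝒩.ext p e + ∑ k ∈ Finset.Ico d b, x k) ∧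
      ∀ ξ ≤ p, (∑ k ∈ Finset.Ico d b, x k) ξ = 0 := by
  obtain ⟨c, h1, h2, h3, h4⟩ := S.exists_split p hab hb
  have hl : 𝒩.ext p (∑ k ∈ Finset.Ico a c, x k) = ∑ k ∈ Finset.Ico a c, x k := by
    rw [map_sum]
    refine Finset.sum_congr rfl fun k hk => ?_
    rw [Finset.mem_Ico] at hk
    exact (S.blk k (by omega)).ext_of_ge (h3 k hk.1 hk.2)
  have hr : ∀ d, c < d → 𝒩.ext p (∑ k ∈ Finset.Ico d b, x k) = 0 := by
    intro d hd
    rw [map_sum]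
    refine Finset.sum_eq_zero fun k hk => ?_
    rw [Finset.mem_Ico] at hk
    exact (S.blk k (by omega)).ext_of_le (h4 k (by omega) hk.2).le
  have hr0 : ∀ d, c < d → ∀ ξ ≤ p, (∑ k ∈ Finset.Ico d b, x k) ξ = 0 := by
    intro d hd ξ hξ
    rw [Finset.sum_apply]
    refine Finset.sum_eq_zero fun k hk => ?_
    rw [Finset.mem_Ico] at hk
    exact (S.blk k (by omega)).1 ξ (hξ.trans_lt (h4 k (by omega) hk.2))
  rcases h2.eq_or_lt with rfl | hc
  · refine ⟨c, c, 0, h1, le_rfl, le_rfl, le_rfl, Or.inl rfl, by simp, ?_, by simp⟩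
    rw [hl]
    simp
  · have hsum : ∑ k ∈ Finset.Ico a b, x k =
        ∑ k ∈ Finset.Ico a c, x k + x c + ∑ k ∈ Finset.Ico (c + 1) b, x k := by
      rw [← Finset.sum_Ico_consecutive x h1 h2, Finset.sum_eq_sum_Ico_succ_bot hc]
      abel
    refine ⟨c, c + 1, x c, h1, h2, by omega, hc, Or.inr ⟨c, by omega, rfl⟩, hsum, ?_,
      hr0 _ (by omega)⟩
    rw [hsum, map_add, map_add, hl, hr _ (by omega)]
    abel

theorem Successive.norm_sum_le_age {L : ℕ} {P Q : ℕ → ℕ} {x : ℕ → ℕ → E}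
    (S : 𝒩.Successive L P Q x) {C A B : ℝ} (hC : 0 ≤ C) (hA : 0 ≤ A) (hB : 0 ≤ B)
    (hx : ∀ k < L, ∀ γ, ‖x k γ‖ ≤ C)
    (H : ∀ η a b, a ≤ b → b ≤ L → ‖(∑ k ∈ Finset.Ico a b, x k) η‖ ≤ A * ((b : ℝ) - a) + B)
    (γ : ℕ) : ∀ a b, a ≤ b → b ≤ L → ‖(∑ k ∈ Finset.Ico a b, x k) γ‖ ≤
      (mm (𝒩.wt γ) : ℝ)⁻¹ * (A * ((b : ℝ) - a)) + 𝒩.age γ * (7 * C + B) := by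
  induction γ using Nat.strong_induction_on with
  | _ γ ih =>
  intro a b hab hb
  obtain ⟨c, d, e, hac, hcb, hcd, hdb, he, hsum, htail, hzero⟩ :=
    S.exists_tail (𝒩.start γ) hab hb
  have heC : ∀ η, ‖e η‖ ≤ C := by
    rcases he with rfl | ⟨k, hk, rfl⟩
    · simpa using hC
    · exact hx k hk
  set i := 𝒩.wt γ with hi
  have hm0 := inv_mm_nonneg i
  have hm1 := inv_mm_le i
  have h1 : ‖𝒩.coord γ (∑ k ∈ Finset.Ico a b, x k)‖ ≤ 3 * C :=
    S.norm_coord_sum_le (by positivity) (fun k hk => 𝒩.norm_coord_le (hx k hk) γ) hab hb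
  have h2 : ‖𝒩.atPre γ (∑ k ∈ Finset.Ico a b, x k)‖ ≤
      (mm i : ℝ)⁻¹ * (A * ((c : ℝ) - a)) + (𝒩.age γ - 1) * (7 * C + B) + C := by
    have hca : (0 : ℝ) ≤ (c : ℝ) - a := by
      rw [sub_nonneg]; exact_mod_cast hac
    rcases hp : 𝒩.pre γ with _ | ξ
    · rw [atPre_none _ hp, 𝒩.age_none hp]
      simp only [norm_zero, Nat.cast_one, sub_self, zero_mul, add_zero]
      positivity
    · rw [atPre_some _ hp, hsum, 𝒩.age_pre hp]
      have := ih ξ (𝒩.pre_lt hp) a c hac (hcb.trans hb)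
      rw [𝒩.wt_pre hp, ← hi] at this
      have hz : (∑ k ∈ Finset.Ico d b, x k) ξ = 0 := hzero ξ (by simp [start, hp])
      rw [Pi.add_apply, Pi.add_apply, hz, add_zero]
      refine (norm_add_le _ _).trans ?_
      push_cast
      rw [add_sub_cancel_right]
      linarith [heC ξ]
  have hbd : (0 : ℝ) ≤ (b : ℝ) - d := by
    rw [sub_nonneg]; exact_mod_cast hdb
  have h3 : ‖(𝒩.fn γ).ev (∑ k ∈ Finset.Ico a b, x k -
      𝒩.ext (𝒩.start γ) (∑ k ∈ Finset.Ico a b, x k))‖ ≤ A * ((b : ℝ) - d) + B + 3 * C := by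
    rw [htail]
    refine Fn.norm_ev_le (𝒩.fn_size γ) (by positivity) fun η _ => ?_
    rw [Pi.add_apply]
    refine (norm_add_le _ _).trans ?_
    linarith [𝒩.norm_sub_ext_le heC (𝒩.start γ) η.1, H η.1 d b hdb hb]
  rw [𝒩.apply_eq γ (∑ k ∈ Finset.Ico a b, x k)]
  refine (norm_add_le _ _).trans ((add_le_add ((norm_add_le _ _).trans (add_le_add h1 h2))
    (le_of_eq (norm_smul _ _))).trans ?_)
  rw [Real.norm_of_nonneg hm0]
  have h4 := mul_le_mul_of_nonneg_left h3 hm0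
  have h5 : (mm i : ℝ)⁻¹ * (B + 3 * C) ≤ B + 3 * C :=
    mul_le_of_le_one_left (by positivity) (by linarith)
  have h6 : (mm i : ℝ)⁻¹ * (A * ((c : ℝ) - a)) + (mm i : ℝ)⁻¹ * (A * ((b : ℝ) - d)) ≤
      (mm i : ℝ)⁻¹ * (A * ((b : ℝ) - a)) := by
    have : (c : ℝ) ≤ d := by exact_mod_cast hcd
    rw [← mul_add, ← mul_add]
    apply mul_le_mul_of_nonneg_left _ hm0
    apply mul_le_mul_of_nonneg_left _ hA
    linarith
  have h7 : (mm i : ℝ)⁻¹ * (A * ((b : ℝ) - d) + B + 3 * C) =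
      (mm i : ℝ)⁻¹ * (A * ((b : ℝ) - d)) + (mm i : ℝ)⁻¹ * (B + 3 * C) := by ring
  linarith

/-- The main estimate for sums of successive blocks whose values at nodes with weight index at
least `j` are under control. -/
theorem Successive.norm_sum_le {L j M : ℕ} {P Q : ℕ → ℕ} {x : ℕ → ℕ → E}
    (S : 𝒩.Successive L P Q x) {C δ c₀ : ℝ} (hC : 0 ≤ C) (hδ : 0 ≤ δ) (hc : 0 ≤ c₀)
    (hx : ∀ k < L, ∀ γ, ‖x k γ‖ ≤ C) (hM : 1 ≤ M) (hn : ∀ i < j, nn i ≤ M)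
    (H : ∀ γ, j ≤ 𝒩.wt γ → ∀ a b, a ≤ b → b ≤ L →
      ‖(∑ k ∈ Finset.Ico a b, x k) γ‖ ≤ δ * ((b : ℝ) - a) + c₀) (s : ℕ) :
    ∀ γ, 𝒩.wt γ < j → ∀ a b, a ≤ b → b ≤ L → ‖(∑ k ∈ Finset.Ico a b, x k) γ‖ ≤
      (mm (𝒩.wt γ) : ℝ)⁻¹ * ((δ + C / 2 ^ s) * ((b : ℝ) - a)) +
        (2 * M) ^ (s + 1) * (c₀ + 8 * C) := by
  have hM' : (1 : ℝ) ≤ M := by exact_mod_cast hM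
  have key : ∀ s : ℕ, ∀ B : ℝ, 0 ≤ B → B + 7 * C ≤ 2 * (2 * M) ^ s * (c₀ + 8 * C) →
      (∀ η a b, a ≤ b → b ≤ L → ‖(∑ k ∈ Finset.Ico a b, x k) η‖ ≤
        (δ + C / 2 ^ s) * ((b : ℝ) - a) + B) → ∀ γ, 𝒩.wt γ < j → ∀ a b, a ≤ b → b ≤ L →
      ‖(∑ k ∈ Finset.Ico a b, x k) γ‖ ≤
        (mm (𝒩.wt γ) : ℝ)⁻¹ * ((δ + C / 2 ^ s) * ((b : ℝ) - a)) +
        (2 * M) ^ (s + 1) * (c₀ + 8 * C) := by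
    intro s B hB hBs h γ hγ a b hab hb
    refine (S.norm_sum_le_age hC (by positivity) hB hx h γ a b hab hb).trans ?_
    refine add_le_add le_rfl ?_
    have hage : (𝒩.age γ : ℝ) ≤ M := by exact_mod_cast (𝒩.age_le γ).trans (hn _ hγ)
    calc (𝒩.age γ : ℝ) * (7 * C + B) ≤ M * (2 * (2 * M) ^ s * (c₀ + 8 * C)) := by
          apply mul_le_mul hage (by linarith) (by positivity) (by positivity)
      _ = (2 * M) ^ (s + 1) * (c₀ + 8 * C) := by ring
  have all : ∀ s : ℕ, ∀ η a b, a ≤ b → b ≤ L → ‖(∑ k ∈ Finset.Ico a b, x k) η‖ ≤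
      (δ + C / 2 ^ s) * ((b : ℝ) - a) + (2 * M) ^ s * (c₀ + 8 * C) := by
    intro s
    induction s with
    | zero =>
      intro η a b hab hb
      have h1 : ‖(∑ k ∈ Finset.Ico a b, x k) η‖ ≤ C * ((b : ℝ) - a) := by
        rw [Finset.sum_apply]
        refine (norm_sum_le_of_le _ fun k hk => hx k ?_ η).trans ?_
        · rw [Finset.mem_Ico] at hk; omega
        · rw [Finset.sum_const, Nat.card_Ico, nsmul_eq_mul, Nat.cast_sub hab, mul_comm]
      have h2 : (0 : ℝ) ≤ (b : ℝ) - a := by rw [sub_nonneg]; exact_mod_cast hab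
      have h3 := mul_nonneg hδ h2
      simp only [pow_zero, div_one, one_mul]
      rw [add_mul]
      linarith
    | succ s ih =>
      intro η a b hab hb
      have h2 : (0 : ℝ) ≤ (b : ℝ) - a := by rw [sub_nonneg]; exact_mod_cast hab
      have hpow : (1 : ℝ) ≤ (2 * M) ^ s := one_le_pow₀ (by linarith)
      rcases lt_or_ge (𝒩.wt η) j with h | h
      · refine (key s _ (by positivity) ?_ ih η h a b hab hb).trans ?_
        · have : 7 * C ≤ (2 * M) ^ s * (c₀ + 8 * C) := by
            refine le_trans ?_ (le_mul_of_one_le_left (by positivity) hpow)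
            linarith
          linarith
        · refine add_le_add ?_ le_rfl
          have hm := inv_mm_le (𝒩.wt η)
          have h3 := inv_mm_nonneg (𝒩.wt η)
          rw [← mul_assoc]
          apply mul_le_mul_of_nonneg_right _ h2
          have h4 : 0 ≤ C / 2 ^ s := by positivity
          calc (mm (𝒩.wt η) : ℝ)⁻¹ * (δ + C / 2 ^ s) ≤ 1 / 2 * (δ + C / 2 ^ s) := by
                apply mul_le_mul_of_nonneg_right _ (by positivity)
                linarith
            _ ≤ δ + C / 2 ^ (s + 1) := by
                rw [pow_succ, ← div_div]
                linarith
      · refine (H η h a b hab hb).trans ?_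
        have h4 : 0 ≤ C / 2 ^ (s + 1) * ((b : ℝ) - a) := by positivity
        have h5 : c₀ + 8 * C ≤ (2 * M) ^ (s + 1) * (c₀ + 8 * C) :=
          le_mul_of_one_le_left (by positivity) (one_le_pow₀ (by linarith))
        rw [add_mul]
        linarith
  refine key s _ (by positivity) ?_ (all s)
  have hpow : (1 : ℝ) ≤ (2 * M) ^ s := one_le_pow₀ (by linarith)
  have : 7 * C ≤ (2 * M) ^ s * (c₀ + 8 * C) := by
    refine le_trans ?_ (le_mul_of_one_le_left (by positivity) hpow)
    linarith
  linarith

/-! ### Rapidly increasing sequences -/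

variable (𝒩) in
/-- A block whose values at nodes of weight index less than `j` are as small as the weight. -/
structure Rapid (C : ℝ) (p q j : ℕ) (x : ℕ → E) : Prop where
  blk : 𝒩.Blk p q x
  bound : ∀ γ, ‖x γ‖ ≤ C
  light : ∀ γ, 𝒩.wt γ < j → ‖x γ‖ ≤ (mm (𝒩.wt γ) : ℝ)⁻¹ * C

variable (𝒩) in
/-- The first `L` terms form a rapidly increasing sequence. -/
structure Ris (C : ℝ) (L : ℕ) (P Q J : ℕ → ℕ) (x : ℕ → ℕ → E) : Prop where
  rapid : ∀ k < L, 𝒩.Rapid C (P k) (Q k) (J k) (x k)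
  le : ∀ k l, k < l → l < L → Q k ≤ P l
  le_index : ∀ k l, k < l → l < L → Q k ≤ J l

theorem Ris.successive {C : ℝ} {L : ℕ} {P Q J : ℕ → ℕ} {x : ℕ → ℕ → E}
    (R : 𝒩.Ris C L P Q J x) : 𝒩.Successive L P Q x :=
  ⟨fun k hk => (R.rapid k hk).blk, R.le⟩

theorem Blk.norm_le_of_le_wt {p q : ℕ} {x : ℕ → E} (hx : 𝒩.Blk p q x) {C : ℝ}
    (hC : ∀ γ, ‖x γ‖ ≤ C) (γ : ℕ) (h : q ≤ 𝒩.wt γ) :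
    ‖x γ‖ ≤ (mm (𝒩.wt γ) : ℝ)⁻¹ * C := by
  induction γ using Nat.strong_induction_on with
  | _ γ ih =>
  have h0 : 0 ≤ C := (norm_nonneg _).trans (hC 0)
  rw [𝒩.apply_eq γ x, hx.coord_of_ge (h.trans (𝒩.wt_le γ)), zero_add]
  rcases hp : 𝒩.pre γ with _ | ξ
  · rw [atPre_none _ hp, zero_add, norm_smul, Real.norm_of_nonneg (inv_mm_nonneg _)]
    refine mul_le_mul_of_nonneg_left ?_ (inv_mm_nonneg _)
    refine Fn.norm_ev_le (𝒩.fn_size γ) h0 fun a _ => ?_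
    rw [show 𝒩.start γ = 0 by simp [start, hp], hx.ext_of_le (Nat.zero_le _), sub_zero]
    exact hC _
  · have hw := 𝒩.wt_pre hp
    have : q ≤ 𝒩.start γ := by
      simp only [start, hp, Option.elim_some]
      have := 𝒩.wt_le ξ
      omega
    rw [atPre_some _ hp, hx.ext_of_ge this, sub_self, map_zero, smul_zero, add_zero, ← hw]
    exact ih ξ (𝒩.pre_lt hp) (by rw [hw]; exact h)

theorem Ris.norm_sum_le_heavy {C : ℝ} {L : ℕ} {P Q J : ℕ → ℕ} {x : ℕ → ℕ → E}
    (R : 𝒩.Ris C L P Q J x) (hC : 0 ≤ C) (γ : ℕ) {a b : ℕ} (hab : a ≤ b) (hb : b ≤ L) :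
    ‖(∑ k ∈ Finset.Ico a b, x k) γ‖ ≤ (mm (𝒩.wt γ) : ℝ)⁻¹ * C * ((b : ℝ) - a) + C := by
  classical
  have hm := inv_mm_nonneg (𝒩.wt γ)
  have key : ∃ k', ∀ k ∈ Finset.Ico a b,
      ‖x k γ‖ ≤ (mm (𝒩.wt γ) : ℝ)⁻¹ * C + if k = k' then C else 0 := by
    by_cases h : ((Finset.Ico a b).filter fun k => J k ≤ 𝒩.wt γ).Nonempty
    · set F := (Finset.Ico a b).filter fun k => J k ≤ 𝒩.wt γ with hF
      refine ⟨F.max' h, fun k hk => ?_⟩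
      rw [Finset.mem_Ico] at hk
      have hR := R.rapid k (hk.2.trans_le hb)
      rcases lt_or_ge (𝒩.wt γ) (J k) with h1 | h1
      · have := hR.light γ h1
        split_ifs <;> linarith
      · have hkF : k ∈ F := by simp [hF, hk, h1]
        split_ifs with h2
        · have := hR.bound γ
          have := mul_nonneg hm hC
          linarith
        · have h3 : k < F.max' h := lt_of_le_of_ne (Finset.le_max' F k hkF) h2
          have h4 := Finset.max'_mem F h
          simp only [hF, Finset.mem_filter, Finset.mem_Ico] at h4
          rw [add_zero]
          exact hR.blk.norm_le_of_le_wt hR.bound γ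
            ((R.le_index k _ h3 (h4.1.2.trans_le hb)).trans h4.2)
    · refine ⟨0, fun k hk => ?_⟩
      have h1 : 𝒩.wt γ < J k := by
        by_contra h1
        exact h ⟨k, by simp [Finset.mem_Ico.1 hk, not_lt.1 h1]⟩
      rw [Finset.mem_Ico] at hk
      have := (R.rapid k (hk.2.trans_le hb)).light γ h1
      split_ifs <;> linarith
  obtain ⟨k', hk'⟩ := key
  rw [Finset.sum_apply]
  refine (norm_sum_le_of_le _ hk').trans ?_
  rw [Finset.sum_add_distrib, Finset.sum_const, Nat.card_Ico, nsmul_eq_mul, Nat.cast_sub hab,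
    Finset.sum_ite_eq']
  split_ifs <;> linarith

/-! ### Exact vectors -/

variable (𝒩) in
/-- The estimates enjoyed by normalized averages of rapidly increasing sequences. -/
structure Exact (C : ℝ) (p q j : ℕ) (z : ℕ → E) : Prop where
  blk : 𝒩.Blk p q z
  bound : ∀ γ, ‖z γ‖ ≤ C
  coord : ∀ γ, ‖𝒩.coord γ z‖ ≤ (mm j : ℝ)⁻¹ * C
  tail_lt : ∀ r γ, 𝒩.wt γ < j → ‖(z - 𝒩.ext r z) γ‖ ≤ (mm (𝒩.wt γ) : ℝ)⁻¹ * C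
  tail_gt : ∀ r γ, j < 𝒩.wt γ → ‖(z - 𝒩.ext r z) γ‖ ≤ (mm j : ℝ)⁻¹ * C

theorem Exact.rapid {C : ℝ} {p q j : ℕ} {z : ℕ → E} (h : 𝒩.Exact C p q j z) :
    𝒩.Rapid C p q j z :=
  ⟨h.blk, h.bound, fun γ hγ => by
    simpa [h.blk.ext_of_le (Nat.zero_le _)] using h.tail_lt 0 γ hγ⟩

theorem four_mul_mm_le {i j : ℕ} (h : i < j) : (4 : ℝ) * mm i ≤ mm j := by
  have h1 := mm_sq_le h
  have h2 := four_le_mm i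
  have : 4 * mm i ≤ mm j := by nlinarith
  exact_mod_cast this

theorem Ris.exact {C : ℝ} {j p q : ℕ} {P Q J : ℕ → ℕ} {x : ℕ → ℕ → E}
    (R : 𝒩.Ris C (nn j) P Q J x) (hC : 0 ≤ C) (hp : ∀ k < nn j, p ≤ P k)
    (hq : ∀ k < nn j, Q k ≤ q) :
    𝒩.Exact (5 * C) p q j (((mm j : ℝ) / nn j) • ∑ k ∈ Finset.Ico 0 (nn j), x k) := by
  obtain ⟨M, s, hM, hn, hs, hg⟩ := exists_growth j
  have S := R.successive
  have hxC : ∀ k < nn j, ∀ γ, ‖x k γ‖ ≤ C := fun k hk => (R.rapid k hk).bound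
  set n : ℝ := (nn j : ℝ) with hn_def
  set m : ℝ := (mm j : ℝ) with hm_def
  have hm4 : (4 : ℝ) ≤ m := by rw [hm_def]; exact_mod_cast four_le_mm j
  have hnm : m ^ 2 ≤ n := by rw [hm_def, hn_def]; exact_mod_cast mm_sq_le_nn j
  have hn0 : 0 < n := by nlinarith
  have hm0 : 0 < m := by linarith
  have hmn : m / n ≤ m⁻¹ := by
    rw [div_le_iff₀ hn0, inv_mul_eq_div, le_div_iff₀ hm0]
    nlinarith
  have hmn0 : 0 ≤ m / n := by positivity
  have hinv : ∀ {i}, j < i → (mm i : ℝ)⁻¹ * m ≤ m⁻¹ := by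
    intro i hi
    have h1 : m ^ 2 ≤ mm i := by rw [hm_def]; exact_mod_cast mm_sq_le hi
    have h2 : (0 : ℝ) < mm i := by nlinarith
    rw [inv_mul_le_iff₀ h2, ← div_eq_mul_inv, le_div_iff₀ hm0]
    nlinarith
  have hinv' : ∀ {i}, i < j → 4 * m⁻¹ ≤ (mm i : ℝ)⁻¹ := by
    intro i hi
    have h1 := four_mul_mm_le hi
    have h2 : (0 : ℝ) < mm i := by have := four_le_mm i; positivity
    rw [← div_eq_mul_inv, div_le_iff₀ hm0, inv_mul_eq_div, le_div_iff₀ h2]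
    exact h1
  have light : ∀ γ, 𝒩.wt γ < j → ∀ a b, a ≤ b → b ≤ nn j →
      m / n * ‖(∑ k ∈ Finset.Ico a b, x k) γ‖ ≤ (mm (𝒩.wt γ) : ℝ)⁻¹ * (17 / 4 * C) := by
    intro γ hγ a b hab hb
    have h0 := S.norm_sum_le (j := j) (δ := m⁻¹ * C) (c₀ := C) hC (by positivity) hC hxC hM hn
      (fun η hη a b hab hb => ?_) s γ hγ a b hab hb
    · have hs' : C / 2 ^ s ≤ C * m⁻¹ := by
        rw [div_eq_mul_inv]
        refine mul_le_mul_of_nonneg_left (inv_anti₀ hm0 ?_) hC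
        have : m ^ 2 ≤ 2 ^ s := by rw [hm_def]; exact_mod_cast hs
        nlinarith
      have hg' : (2 * (M : ℝ)) ^ (s + 1) ≤ n * (m⁻¹ * m⁻¹) := by
        have : m ^ 2 * (2 * (M : ℝ)) ^ (s + 1) ≤ n := by
          rw [hm_def, hn_def]; exact_mod_cast hg
        rw [← mul_inv, ← div_eq_mul_inv, le_div_iff₀ (by positivity)]
        nlinarith
      have hba : (b : ℝ) - a ≤ n := by
        have : (b : ℝ) ≤ n := by rw [hn_def]; exact_mod_cast hb
        have : (0 : ℝ) ≤ a := Nat.cast_nonneg a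
        linarith
      have hba0 : (0 : ℝ) ≤ (b : ℝ) - a := by rw [sub_nonneg]; exact_mod_cast hab
      have hw := inv_mm_nonneg (𝒩.wt γ)
      have hw' := hinv' hγ
      calc m / n * ‖(∑ k ∈ Finset.Ico a b, x k) γ‖
          ≤ m / n * ((mm (𝒩.wt γ) : ℝ)⁻¹ * ((m⁻¹ * C + C * m⁻¹) * n) +
            n * (m⁻¹ * m⁻¹) * (C + 8 * C)) := by
            refine mul_le_mul_of_nonneg_left (h0.trans ?_) hmn0
            gcongr
        _ = (mm (𝒩.wt γ) : ℝ)⁻¹ * (2 * C) + 9 * m⁻¹ * C := by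
            field_simp
            ring
        _ ≤ (mm (𝒩.wt γ) : ℝ)⁻¹ * (2 * C) + 9 / 4 * (mm (𝒩.wt γ) : ℝ)⁻¹ * C :=
            add_le_add le_rfl (mul_le_mul_of_nonneg_right (by linarith) hC)
        _ = _ := by ring
    · refine (R.norm_sum_le_heavy hC η hab hb).trans ?_
      have : (mm (𝒩.wt η) : ℝ)⁻¹ ≤ m⁻¹ := by
        apply inv_anti₀ hm0
        rw [hm_def]
        exact_mod_cast mm_mono hη
      have hba0 : (0 : ℝ) ≤ (b : ℝ) - a := by rw [sub_nonneg]; exact_mod_cast hab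
      gcongr
  have hcoord : ∀ γ, m / n * ‖𝒩.coord γ (∑ k ∈ Finset.Ico 0 (nn j), x k)‖ ≤ m⁻¹ * (3 * C) := by
    intro γ
    refine mul_le_mul hmn ?_ (norm_nonneg _) (by positivity)
    exact S.norm_coord_sum_le (by positivity) (fun k hk => 𝒩.norm_coord_le (hxC k hk) γ)
      (Nat.zero_le _) le_rfl
  have htail : ∀ r γ, ∃ d ≤ nn j, m / n * ‖(∑ k ∈ Finset.Ico 0 (nn j), x k -
      𝒩.ext r (∑ k ∈ Finset.Ico 0 (nn j), x k)) γ‖ ≤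
      m⁻¹ * (3 * C) + m / n * ‖(∑ k ∈ Finset.Ico d (nn j), x k) γ‖ := by
    intro r γ
    obtain ⟨c, d, e, -, -, -, hd, he, -, ht, -⟩ := S.exists_tail r (Nat.zero_le _) le_rfl
    refine ⟨d, hd, ?_⟩
    have heC : ∀ η, ‖e η‖ ≤ C := by
      rcases he with rfl | ⟨k, hk, rfl⟩
      · simpa using hC
      · exact hxC k hk
    rw [ht, Pi.add_apply]
    refine (mul_le_mul_of_nonneg_left (norm_add_le _ _) hmn0).trans ?_
    rw [mul_add]
    refine add_le_add (mul_le_mul hmn (𝒩.norm_sub_ext_le heC r γ) (norm_nonneg _)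
      (by positivity)) le_rfl
  have hheavy : ∀ γ d, d ≤ nn j → m / n * ‖(∑ k ∈ Finset.Ico d (nn j), x k) γ‖ ≤
      (mm (𝒩.wt γ) : ℝ)⁻¹ * m * C + m⁻¹ * C := by
    intro γ d hd
    have h1 := R.norm_sum_le_heavy hC γ hd le_rfl
    have h2 : (mm (𝒩.wt γ) : ℝ)⁻¹ * C * (((nn j : ℕ) : ℝ) - d) + C ≤
        (mm (𝒩.wt γ) : ℝ)⁻¹ * C * n + C := by
      refine add_le_add (mul_le_mul_of_nonneg_left ?_
        (mul_nonneg (inv_mm_nonneg _) hC)) le_rfl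
      have : (0 : ℝ) ≤ d := Nat.cast_nonneg d
      linarith
    refine (mul_le_mul_of_nonneg_left (h1.trans h2) hmn0).trans ?_
    rw [mul_add]
    refine add_le_add (le_of_eq ?_) (mul_le_mul_of_nonneg_right hmn hC)
    field_simp
  have hm1 : m⁻¹ ≤ 1 / 4 := by rw [hm_def]; exact inv_mm_le j
  have hm1' : 0 ≤ m⁻¹ := by positivity
  have hsub : ∀ r γ, ‖(((m / n) • ∑ k ∈ Finset.Ico 0 (nn j), x k) -
      𝒩.ext r ((m / n) • ∑ k ∈ Finset.Ico 0 (nn j), x k)) γ‖ = m / n *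
      ‖(∑ k ∈ Finset.Ico 0 (nn j), x k - 𝒩.ext r (∑ k ∈ Finset.Ico 0 (nn j), x k)) γ‖ := by
    intro r γ
    rw [map_smul, ← smul_sub, Pi.smul_apply, norm_smul, Real.norm_of_nonneg hmn0]
  refine ⟨Blk.smul (Blk.sum fun k hk => ?_) _, fun γ => ?_, fun γ => ?_, fun r γ hγ => ?_,
    fun r γ hγ => ?_⟩
  · have hk' := (Finset.mem_Ico.1 hk).2
    exact (S.blk k hk').mono (hp k hk') (hq k hk')
  · rw [Pi.smul_apply, norm_smul, Real.norm_of_nonneg hmn0]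
    rcases lt_or_ge (𝒩.wt γ) j with h | h
    · refine (light γ h 0 _ (Nat.zero_le _) le_rfl).trans ?_
      have := mul_le_mul_of_nonneg_right (inv_mm_le (𝒩.wt γ)) (by positivity : 0 ≤ 17 / 4 * C)
      linarith
    · refine (hheavy γ 0 (Nat.zero_le _)).trans ?_
      have h1 : (mm (𝒩.wt γ) : ℝ)⁻¹ * m ≤ 1 := by
        have : m ≤ mm (𝒩.wt γ) := by rw [hm_def]; exact_mod_cast mm_mono h
        rw [inv_mul_le_iff₀ (by linarith)]
        linarith
      have h2 := mul_le_mul_of_nonneg_right h1 hC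
      have h3 := mul_le_mul_of_nonneg_right hm1 hC
      linarith
  · rw [map_smul, norm_smul, Real.norm_of_nonneg hmn0]
    have := mul_nonneg hm1' hC
    linarith [hcoord γ]
  · rw [hsub]
    obtain ⟨d, hd, h⟩ := htail r γ
    have h1 := light γ hγ d _ hd le_rfl
    have h2 := mul_le_mul_of_nonneg_right (hinv' hγ) hC
    linarith
  · rw [hsub]
    obtain ⟨d, hd, h⟩ := htail r γ
    have h1 := hheavy γ d hd
    have h2 := mul_le_mul_of_nonneg_right (hinv hγ) hC
    linarith

end NodeSystem

/-- Finite sequences built by successive choices. -/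
theorem exists_finite_seq {α : Type*} {n : ℕ} {I : ℕ → α → Prop} {R : ℕ → α → α → Prop}
    (h0 : ∃ a, I 0 a)
    (hs : ∀ s a, s + 1 < n → I s a → ∃ b, I (s + 1) b ∧ R s a b) :
    ∃ u : ℕ → α, (∀ s < n, I s (u s)) ∧ ∀ s, s + 1 < n → R s (u s) (u (s + 1)) := by
  classical
  obtain ⟨a₀, ha₀⟩ := h0
  let next : ℕ → α → α := fun s a =>
    if h : ∃ b, I (s + 1) b ∧ R s a b then h.choose else a₀
  have hnext : ∀ s a, s + 1 < n → I s a → I (s + 1) (next s a) ∧ R s a (next s a) := by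
    intro s a h1 h2
    have h := hs s a h1 h2
    simp only [next, dif_pos h]
    exact h.choose_spec
  let u : ℕ → α := fun s => Nat.rec a₀ next s
  have hI : ∀ s < n, I s (u s) := by
    intro s
    induction s with
    | zero => exact fun _ => ha₀
    | succ s ih => exact fun h => (hnext s (u s) h (ih (by omega))).1
  exact ⟨u, hI, fun s h => (hnext s (u s) h (hI s (by omega))).2⟩

namespace NodeSystem

variable {𝒩 : NodeSystem}

/-! ### Chains of nodes -/

variable (𝒩) in
/-- The nodes `g 0, …, g (n - 1)` form a chain of weight index `j` with attached functionals
`b s` supported before `Q s`, interlaced with the intervals `[P s, Q s)`. -/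
structure Chain (n j : ℕ) (g : ℕ → ℕ) (b : ℕ → Fn) (P Q : ℕ → ℕ) : Prop where
  pre_zero : 𝒩.pre (g 0) = none
  pre_succ : ∀ s, s + 1 < n → 𝒩.pre (g (s + 1)) = some (g s)
  wt : ∀ s < n, 𝒩.wt (g s) = j
  fn : ∀ s < n, 𝒩.fn (g s) = b s
  supp : ∀ s < n, ∀ a ∈ b s, a.1 < Q s
  le : ∀ s < n, Q s ≤ g s
  lt : ∀ s, s + 1 < n → g s < P (s + 1)

theorem Chain.mono {n j : ℕ} {g : ℕ → ℕ} {b : ℕ → Fn} {P Q : ℕ → ℕ}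
    (h : 𝒩.Chain n j g b P Q) {r s : ℕ} (hrs : r ≤ s) (hs : s < n) : g r ≤ g s := by
  induction s, hrs using Nat.le_induction with
  | base => exact le_rfl
  | succ s _ ih => exact (ih (by omega)).trans (𝒩.pre_lt (h.pre_succ s hs)).le

theorem Chain.strictMono {n j : ℕ} {g : ℕ → ℕ} {b : ℕ → Fn} {P Q : ℕ → ℕ}
    (h : 𝒩.Chain n j g b P Q) {r s : ℕ} (hrs : r < s) (hs : s < n) : g r < g s :=
  (𝒩.pre_lt (h.pre_succ r (by omega))).trans_le (h.mono hrs hs)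

theorem Chain.lt_of_lt {n j : ℕ} {g : ℕ → ℕ} {b : ℕ → Fn} {P Q : ℕ → ℕ}
    (h : 𝒩.Chain n j g b P Q) {r s : ℕ} (hrs : r < s) (hs : s < n) : g r < P s := by
  obtain ⟨s, rfl⟩ : ∃ k, s = k + 1 := ⟨s - 1, by omega⟩
  exact (h.mono (Nat.lt_succ_iff.1 hrs) (by omega)).trans_lt (h.lt s hs)

theorem Chain.apply_sum {n j : ℕ} {g : ℕ → ℕ} {b : ℕ → Fn} {P Q : ℕ → ℕ}
    (h : 𝒩.Chain n j g b P Q) {y : ℕ → ℕ → E} (hy : ∀ s < n, 𝒩.Blk (P s) (Q s) (y s)) :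
    ∀ r < n, (∑ s ∈ Finset.range n, y s) (g r) =
      (mm j : ℝ)⁻¹ • ∑ s ∈ Finset.range (r + 1), (b s).ev (y s) := by
  have hcoord : ∀ r < n, 𝒩.coord (g r) (∑ s ∈ Finset.range n, y s) = 0 := by
    intro r hr
    rw [map_sum]
    refine Finset.sum_eq_zero fun s hs => ?_
    rw [Finset.mem_range] at hs
    rcases le_or_gt s r with h1 | h1
    · exact (hy s hs).coord_of_ge ((h.le s hs).trans (h.mono h1 hr))
    · exact (hy s hs).coord_of_lt (h.lt_of_lt h1 hs)
  have hev : ∀ r < n, ∀ p, (∀ s < r, Q s ≤ p) → (∀ s, r ≤ s → s < n → p ≤ P s) →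
      (b r).ev (∑ s ∈ Finset.range n, y s - 𝒩.ext p (∑ s ∈ Finset.range n, y s)) =
        (b r).ev (y r) := by
    intro r hr p h1 h2
    refine Fn.ev_congr fun a ha => ?_
    rw [map_sum, ← Finset.sum_sub_distrib, Finset.sum_apply,
      Finset.sum_eq_single_of_mem r (Finset.mem_range.2 hr)]
    · rw [(hy r hr).ext_of_le (h2 r le_rfl hr), sub_zero]
    · intro s hs hsr
      rw [Finset.mem_range] at hs
      rcases lt_or_gt_of_ne hsr with h3 | h3
      · rw [(hy s hs).ext_of_ge (h1 s h3), sub_self, Pi.zero_apply]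
      · rw [(hy s hs).ext_of_le (h2 s h3.le hs), sub_zero]
        refine (hy s hs).1 _ ((h.supp r hr a ha).trans ?_)
        exact (h.le r hr).trans_lt (h.lt_of_lt h3 hs)
  intro r
  induction r with
  | zero =>
    intro hr
    rw [𝒩.apply_eq (g 0) (∑ s ∈ Finset.range n, y s), hcoord 0 hr, atPre_none _ h.pre_zero, h.wt 0 hr, h.fn 0 hr,
      show 𝒩.start (g 0) = 0 by simp [start, h.pre_zero], hev 0 hr 0 (by simp) (by simp)]
    simp
  | succ r ih =>
    intro hr
    have hp := h.pre_succ r hr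
    rw [𝒩.apply_eq (g (r + 1)) (∑ s ∈ Finset.range n, y s), hcoord _ hr, atPre_some _ hp, h.wt _ hr, h.fn _ hr,
      show 𝒩.start (g (r + 1)) = g r + 1 by simp [start, hp], hev _ hr, ih (by omega),
      Finset.sum_range_succ _ (r + 1), smul_add, zero_add]
    · intro s hs
      have := h.le s (by omega)
      have := h.mono (Nat.lt_succ_iff.1 hs) (by omega)
      omega
    · intro s hs hs'
      exact h.lt_of_lt hs hs'

theorem exists_even_chain {j : ℕ} (hj : Even j) {P Q : ℕ → ℕ} (hP : Tendsto P atTop atTop)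
    {b : ℕ → Fn} (hb : ∀ l, (b l).size ≤ 1) (hbQ : ∀ l, ∀ a ∈ b l, a.1 < Q l) (L : ℕ)
    {n : ℕ} (hn0 : 0 < n) (hn : n ≤ nn j) :
    ∃ l g : ℕ → ℕ, 𝒩.Chain n j g (fun s => b (l s)) (fun s => P (l s)) (fun s => Q (l s)) ∧
      (∀ s < n, L ≤ l s) ∧ ∀ s t, s < t → t < n → l s < l t := by
  have key := exists_finite_seq (α := ℕ × ℕ) (n := n)
    (I := fun s a => L ≤ a.1 ∧ Q a.1 ≤ a.2 ∧ (s = 0 → 𝒩.pre a.2 = none) ∧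
      𝒩.wt a.2 = j ∧ 𝒩.fn a.2 = b a.1 ∧ 𝒩.age a.2 = s + 1)
    (R := fun _ a c => a.1 < c.1 ∧ 𝒩.pre c.2 = some a.2 ∧ a.2 < P c.1) ?_ ?_
  · obtain ⟨u, hu, hu'⟩ := key
    refine ⟨fun s => (u s).1, fun s => (u s).2, ⟨(hu 0 hn0).2.2.1 rfl,
      fun s hs => (hu' s hs).2.1, fun s hs => (hu s hs).2.2.2.1,
      fun s hs => (hu s hs).2.2.2.2.1, fun s hs => hbQ _,
      fun s hs => (hu s hs).2.1, fun s hs => (hu' s hs).2.2⟩,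
      fun s hs => (hu s hs).1, ?_⟩
    intro s t hst
    induction t, hst using Nat.le_induction with
    | base => exact fun h => (hu' s h).1
    | succ t _ ih => exact fun h => (ih (by omega)).trans (hu' t h).1
  · obtain ⟨γ, h1, h2, h3, h4⟩ := 𝒩.exists_even none j (b L) (Q L) hj (hb L) (by simp)
    exact ⟨(L, γ), le_rfl, h1, fun _ => h2, h3, h4, 𝒩.age_none h2⟩
  · rintro s ⟨l, γ⟩ hs ⟨h1, h2, h3, h5, h6, h7⟩
    obtain ⟨l', hl', hl''⟩ := ((hP.eventually_gt_atTop γ).and (eventually_gt_atTop l)).exists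
    obtain ⟨γ', e1, e2, e3, e4⟩ := 𝒩.exists_even (some γ) j (b l') (Q l') hj (hb l') (by
      rintro ξ ⟨rfl⟩
      exact ⟨h5, by dsimp only at h7; omega⟩)
    have := 𝒩.age_pre e2
    exact ⟨(l', γ'), ⟨h1.trans hl''.le, e1, by omega, e3, e4, by dsimp only at h7 ⊢; omega⟩,
      hl'', e2, hl'⟩

theorem Ris.comp {C : ℝ} {L L' : ℕ} {P Q J : ℕ → ℕ} {x : ℕ → ℕ → E} (R : 𝒩.Ris C L P Q J x)
    {l : ℕ → ℕ} (hl : ∀ s < L', l s < L) (h : ∀ s t, s < t → t < L' → l s < l t) :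
    𝒩.Ris C L' (fun s => P (l s)) (fun s => Q (l s)) (fun s => J (l s)) fun s => x (l s) :=
  ⟨fun s hs => R.rapid _ (hl s hs), fun s t hst ht => R.le _ _ (h s t hst ht) (hl t ht),
    fun s t hst ht => R.le_index _ _ (h s t hst ht) (hl t ht)⟩

/-- `z` and `τ` are the same combination of the `x l` and the `t l`, with coefficients in
`[0, 1]` and indices at least `K`. -/
def Comb (K : ℕ) (x t : ℕ → ℕ → E) (z τ : ℕ → E) : Prop :=
  ∃ a : ℕ →₀ ℝ, (∀ l, 0 ≤ a l ∧ a l ≤ 1) ∧ (∀ l ∈ a.support, K ≤ l) ∧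
    z = a.sum (fun l c => c • x l) ∧ τ = a.sum fun l c => c • t l

theorem Comb.average {K n : ℕ} {x t : ℕ → ℕ → E} {z τ : ℕ → ℕ → E}
    (h : ∀ s < n, Comb K x t (z s) (τ s)) {c : ℝ} (hc : 0 ≤ c) (hcn : c * n ≤ 1) :
    Comb K x t (c • ∑ s ∈ Finset.range n, z s) (c • ∑ s ∈ Finset.range n, τ s) := by
  classical
  have h' : ∀ s, ∃ a : ℕ →₀ ℝ, s < n → (∀ l, 0 ≤ a l ∧ a l ≤ 1) ∧ (∀ l ∈ a.support, K ≤ l) ∧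
      z s = a.sum (fun l c => c • x l) ∧ τ s = a.sum fun l c => c • t l := by
    intro s
    by_cases hs : s < n
    · obtain ⟨a, ha⟩ := h s hs
      exact ⟨a, fun _ => ha⟩
    · exact ⟨0, fun h => absurd h hs⟩
  choose a ha using h'
  have hsum : ∀ y : ℕ → ℕ → E, (c • ∑ s ∈ Finset.range n, a s).sum (fun l c => c • y l) =
      c • ∑ s ∈ Finset.range n, (a s).sum fun l c => c • y l := by
    intro y
    simp only [← Finsupp.linearCombination_apply ℝ]
    rw [map_smul, map_sum]
  refine ⟨c • ∑ s ∈ Finset.range n, a s, fun l => ?_, fun l hl => ?_, ?_, ?_⟩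
  · rw [Finsupp.smul_apply, Finsupp.finsetSum_apply, smul_eq_mul]
    refine ⟨mul_nonneg hc (Finset.sum_nonneg fun s hs =>
      ((ha s (Finset.mem_range.1 hs)).1 l).1), le_trans (mul_le_mul_of_nonneg_left ?_ hc) hcn⟩
    refine (Finset.sum_le_sum fun s hs => ((ha s (Finset.mem_range.1 hs)).1 l).2).trans ?_
    simp
  · by_contra hK
    rw [Finsupp.mem_support_iff] at hl
    apply hl
    rw [Finsupp.smul_apply, Finsupp.finsetSum_apply, Finset.sum_eq_zero, smul_zero]
    intro s hs
    by_contra h0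
    exact hK ((ha s (Finset.mem_range.1 hs)).2.1 l (Finsupp.mem_support_iff.2 h0))
  · rw [hsum, Finset.sum_congr rfl fun s hs => (ha s (Finset.mem_range.1 hs)).2.2.1]
  · rw [hsum, Finset.sum_congr rfl fun s hs => (ha s (Finset.mem_range.1 hs)).2.2.2]

theorem comb_of_injOn {K n : ℕ} (x t : ℕ → ℕ → E) {l : ℕ → ℕ} (hl : ∀ s < n, K ≤ l s)
    (h : ∀ s t, s < t → t < n → l s < l t) {c : ℝ} (hc : 0 ≤ c) (hc1 : c ≤ 1) :
    Comb K x t (c • ∑ s ∈ Finset.range n, x (l s)) (c • ∑ s ∈ Finset.range n, t (l s)) := by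
  classical
  have hinj : Set.InjOn l (Finset.range n : Finset ℕ) := by
    intro s hs t ht e
    rw [Finset.mem_coe, Finset.mem_range] at hs ht
    rcases lt_trichotomy s t with h1 | h1 | h1
    · exact absurd e (h s t h1 ht).ne
    · exact h1
    · exact absurd e.symm (h t s h1 hs).ne
  have hval : ∀ i, Finsupp.indicator ((Finset.range n).image l) (fun _ _ => c) i =
      if i ∈ (Finset.range n).image l then c else 0 := by
    intro i
    rw [Finsupp.indicator_apply]
    split_ifs <;> rfl
  have hsum : ∀ y : ℕ → ℕ → E,
      (Finsupp.indicator ((Finset.range n).image l) fun _ _ => c).sum (fun l c => c • y l) =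
      c • ∑ s ∈ Finset.range n, y (l s) := by
    intro y
    rw [Finsupp.sum_of_support_subset _ (Finsupp.support_indicator_subset _ _) _
      (fun i _ => zero_smul ℝ (y i)), Finset.sum_congr rfl fun i hi => by rw [hval, if_pos hi],
      Finset.sum_image hinj, Finset.smul_sum]
  refine ⟨Finsupp.indicator ((Finset.range n).image l) fun _ _ => c, fun i => ?_, fun i hi => ?_,
    (hsum x).symm, (hsum t).symm⟩
  · rw [hval]
    split_ifs
    · exact ⟨hc, hc1⟩
    · norm_num
  · obtain ⟨s, hs, rfl⟩ := Finset.mem_image.1 (Finsupp.support_indicator_subset _ _ hi)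
    exact hl s (Finset.mem_range.1 hs)

end NodeSystem

namespace NodeSystem

variable {𝒩 : NodeSystem}

theorem one_le_nn_real (j : ℕ) : (1 : ℝ) ≤ nn j := by exact_mod_cast one_le_nn j

theorem mm_pos (j : ℕ) : (0 : ℝ) < mm j := by
  have := four_le_mm j
  positivity

variable (𝒩) in
/-- An exact vector `z` with a companion `τ`, both supported on `[p, q)`, and a node `η`
nearly annihilating `z` but not `τ`. -/
structure ExactPair (D ε δ : ℝ) (i p q η : ℕ) (z τ : ℕ → E) : Prop where
  exact : 𝒩.Exact D p q i z
  blk : 𝒩.Blk p q τ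
  lt : η < q
  wt : 𝒩.wt η = i
  small : ‖z η‖ ≤ ε
  large : δ ≤ top (τ η)

theorem mm_le_nn (j : ℕ) : mm j ≤ nn j :=
  (Nat.le_self_pow two_ne_zero _).trans (mm_sq_le_nn j)

theorem exists_exactPair {C : ℝ} {P Q J : ℕ → ℕ} {x t : ℕ → ℕ → E} (hC : 0 ≤ C)
    (R : ∀ L, 𝒩.Ris C L P Q J x) (hP : Tendsto P atTop atTop)
    (ht : ∀ l, 𝒩.Blk (P l) (Q l) (t l)) {b : ℕ → Fn} (hb : ∀ l, (b l).size ≤ 1)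
    (hbQ : ∀ l, ∀ a ∈ b l, a.1 < Q l) {ε : ℝ} (hε : 0 < ε)
    (hx : Tendsto (fun l => ‖(b l).ev (x l)‖) atTop (𝓝 0)) {δ : ℝ}
    (hδ : ∀ l, δ ≤ top ((b l).ev (t l))) {i : ℕ} (hi : Even i) (K K' : ℕ) :
    ∃ q η z τ, 𝒩.ExactPair (5 * C) ε δ i K q η z τ ∧ Comb K' x t z τ := by
  obtain ⟨L, hL⟩ := eventually_atTop.1 ((hx.eventually_le_const hε).and
    ((hP.eventually_ge_atTop K).and (eventually_ge_atTop K')))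
  have hn0 : 0 < nn i := one_le_nn i
  obtain ⟨l, g, hch, hl, hlt⟩ := 𝒩.exists_even_chain hi hP hb hbQ L hn0 le_rfl
  have hR : 𝒩.Ris C (nn i) (fun s => P (l s)) (fun s => Q (l s)) (fun s => J (l s))
      (fun s => x (l s)) := by
    obtain ⟨B, hB⟩ := ((Finset.range (nn i)).image l).exists_nat_subset_range
    exact (R B).comp (fun s hs => Finset.mem_range.1
      (hB (Finset.mem_image_of_mem l (Finset.mem_range.2 hs)))) hlt
  have hlast : nn i - 1 < nn i := by omega
  set q := g (nn i - 1) + 1 with hq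
  have hQq : ∀ s < nn i, Q (l s) ≤ q := fun s hs =>
    ((hch.le s hs).trans (hch.mono (by omega) hlast)).trans (Nat.le_succ _)
  have hPK : ∀ s < nn i, K ≤ P (l s) := fun s hs => (hL _ (hl s hs)).2.1
  have hn : (0 : ℝ) < nn i := by exact_mod_cast hn0
  have hm := mm_pos i
  have hval : ∀ y : ℕ → ℕ → E, (∀ l, 𝒩.Blk (P l) (Q l) (y l)) →
      (((mm i : ℝ) / nn i) • ∑ s ∈ Finset.range (nn i), y (l s)) (g (nn i - 1)) =
        (nn i : ℝ)⁻¹ • ∑ s ∈ Finset.range (nn i), (b (l s)).ev (y (l s)) := by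
    intro y hy
    rw [Pi.smul_apply, hch.apply_sum (fun s _ => hy (l s)) _ hlast, smul_smul,
      Nat.sub_add_cancel hn0]
    congr 1
    field_simp
  have hxb : ∀ l, 𝒩.Blk (P l) (Q l) (x l) := fun l => ((R (l + 1)).rapid l (by omega)).blk
  refine ⟨q, g (nn i - 1), ((mm i : ℝ) / nn i) • ∑ s ∈ Finset.range (nn i), x (l s),
    ((mm i : ℝ) / nn i) • ∑ s ∈ Finset.range (nn i), t (l s),
    ⟨?_, Blk.smul (Blk.sum fun s hs => ?_) _, by omega, hch.wt _ hlast, ?_, ?_⟩,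
    comb_of_injOn x t (fun s hs => (hL _ (hl s hs)).2.2) hlt (by positivity)
      ((div_le_one hn).2 (by exact_mod_cast mm_le_nn i))⟩
  · have := hR.exact hC hPK hQq
    rwa [← Finset.range_eq_Ico] at this
  · rw [Finset.mem_range] at hs
    exact (ht _).mono (hPK s hs) (hQq s hs)
  · rw [hval x hxb, norm_smul, norm_inv, Real.norm_of_nonneg hn.le, inv_mul_le_iff₀ hn]
    refine (norm_sum_le_of_le (n := fun _ => ε) _ fun s hs => ?_).trans (by simp)
    exact (hL _ (hl s (Finset.mem_range.1 hs))).1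
  · rw [hval t ht, map_smul, map_sum, smul_eq_mul, le_inv_mul_iff₀ hn, ← nsmul_eq_mul]
    have := Finset.card_nsmul_le_sum (Finset.range (nn i)) (fun s => top ((b (l s)).ev (t (l s))))
      δ fun s _ => hδ (l s)
    rwa [Finset.card_range] at this

/-- Sums of a special sequence are bounded at nodes of the weight of the sequence. -/
theorem norm_sum_le_special {j : ℕ} (hj : Odd j) {D : ℝ} (hD : 0 ≤ D)
    {i P Q η ξ : ℕ → ℕ} {z : ℕ → ℕ → E}
    (hz : ∀ s < nn j, 𝒩.Exact D (P s) (Q s) (i s) (z s))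
    (hi : ∀ s < nn j, nn j ^ 2 ≤ mm (i s)) (hη : ∀ s < nn j, ‖z s (η s)‖ ≤ D / nn j)
    (hch : 𝒩.Chain (nn j) j ξ (fun s => [(η s, 0, 1)]) P Q)
    (hle : ∀ s t, s < t → t < nn j → Q s ≤ P t) (hi0 : 4 ∣ i 0)
    (hi1 : ∀ s, s + 1 < nn j → i (s + 1) = 4 * ξ s + 2) {a b : ℕ} (hab : a ≤ b)
    (hb : b ≤ nn j) (γ : ℕ) (hγ : 𝒩.wt γ = j) :
    ‖(∑ s ∈ Finset.Ico a b, z s) γ‖ ≤ 5 * D := by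
  classical
  set n : ℝ := ((nn j : ℕ) : ℝ) with hn_def
  have hn1 : 1 ≤ n := one_le_nn_real j
  have hn0 : 0 < n := by linarith
  have S : 𝒩.Successive (nn j) P Q z := ⟨fun s hs => (hz s hs).blk, hle⟩
  have hinv : ∀ w, nn j ^ 2 ≤ mm w → (mm w : ℝ)⁻¹ * D ≤ D / n * n⁻¹ := by
    intro w hw
    have h1 : n ^ 2 ≤ mm w := by rw [hn_def]; exact_mod_cast hw
    rw [show D / n * n⁻¹ = (n ^ 2)⁻¹ * D by field_simp]
    exact mul_le_mul_of_nonneg_right (inv_anti₀ (by positivity) h1) hD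
  have hDn : 0 ≤ D / n := by positivity
  have hDnD : D / n ≤ D := div_le_self hD hn1
  have hinv1 : n⁻¹ ≤ 1 := inv_le_one_of_one_le₀ hn1
  have hDnn : D / n * n⁻¹ ≤ D / n := mul_le_of_le_one_right hDn hinv1
  have hm0 := inv_mm_nonneg j
  have hm1 := inv_mm_le j
  have hm2 : ∀ {y : ℝ}, 0 ≤ y → (mm j : ℝ)⁻¹ * y ≤ 1 / 4 * y := fun hy =>
    mul_le_mul_of_nonneg_right hm1 hy
  -- the values along the chain
  have hchain : ∀ r < nn j, ‖(∑ s ∈ Finset.Ico a b, z s) (ξ r)‖ ≤ D := by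
    intro r hr
    have h1 : ∑ s ∈ Finset.Ico a b, z s =
        ∑ s ∈ Finset.range (nn j), if s ∈ Finset.Ico a b then z s else 0 := by
      rw [Finset.sum_ite_mem, Finset.inter_eq_right.2]
      intro s hs
      rw [Finset.mem_Ico] at hs
      exact Finset.mem_range.2 (by omega)
    rw [h1, hch.apply_sum (y := fun s => if s ∈ Finset.Ico a b then z s else 0) _ r hr,
      norm_smul, Real.norm_of_nonneg hm0]
    · have h2 : ‖∑ s ∈ Finset.range (r + 1), Fn.ev [(η s, 0, 1)]
          (if s ∈ Finset.Ico a b then z s else 0)‖ ≤ D := by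
        refine (norm_sum_le_of_le (n := fun _ => D / n) _ fun s hs => ?_).trans ?_
        · rw [Finset.mem_range] at hs
          rw [Fn.ev_single]
          split_ifs
          · exact hη s (by omega)
          · simpa using hDn
        · rw [Finset.sum_const, Finset.card_range, nsmul_eq_mul, mul_div_assoc', div_le_iff₀ hn0,
            mul_comm]
          refine mul_le_mul_of_nonneg_left ?_ hD
          rw [hn_def]
          exact_mod_cast hr
      have := mul_le_mul_of_nonneg_left h2 hm0
      linarith [hm2 hD]
    · intro s hs
      split_ifs
      · exact S.blk s hs
      · exact 𝒩.blk_zero _ _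
  -- the values at nodes outside the chain
  suffices ∀ γ, 𝒩.wt γ = j →
      ‖(∑ s ∈ Finset.Ico a b, z s) γ‖ ≤ 3 * D + 𝒩.age γ * (2 * (D / n)) by
    refine (this γ hγ).trans ?_
    have h1 : (𝒩.age γ : ℝ) ≤ n := by
      rw [hn_def]
      exact_mod_cast hγ ▸ 𝒩.age_le γ
    have h2 := mul_le_mul_of_nonneg_right h1 (by positivity : 0 ≤ 2 * (D / n))
    have h3 : n * (2 * (D / n)) = 2 * D := by field_simp
    linarith
  intro γ
  induction γ using Nat.strong_induction_on with
  | _ γ ih =>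
  intro hγ
  obtain ⟨η', hfn, hw', hpre⟩ := 𝒩.special γ (hγ ▸ hj)
  rw [hγ] at hw'
  have hcoord : ‖𝒩.coord γ (∑ s ∈ Finset.Ico a b, z s)‖ ≤ D / n := by
    refine S.norm_coord_sum_le hDn (fun s hs => ?_) hab hb
    exact ((hz s hs).coord γ).trans ((hinv _ (hi s hs)).trans hDnn)
  set st := 𝒩.start γ
  have hterm : ∀ s < nn j, i s ≠ 𝒩.wt η' → ‖(z s - 𝒩.ext st (z s)) η'‖ ≤ D / n * n⁻¹ := by
    intro s hs hne
    rcases lt_or_gt_of_ne hne with h | h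
    · exact ((hz s hs).tail_gt st η' h).trans (hinv _ (hi s hs))
    · exact ((hz s hs).tail_lt st η' h).trans (hinv _ hw')
  have hsub : (∑ s ∈ Finset.Ico a b, z s - 𝒩.ext st (∑ s ∈ Finset.Ico a b, z s)) η' =
      ∑ s ∈ Finset.Ico a b, (z s - 𝒩.ext st (z s)) η' := by
    rw [map_sum, ← Finset.sum_sub_distrib, Finset.sum_apply]
  have hcount : ∑ s ∈ Finset.Ico a b, D / n * n⁻¹ ≤ D / n := by
    rw [Finset.sum_const, Nat.card_Ico, nsmul_eq_mul]
    have h1 : ((b - a : ℕ) : ℝ) ≤ n := by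
      rw [hn_def]
      exact_mod_cast (Nat.sub_le _ _).trans hb
    calc ((b - a : ℕ) : ℝ) * (D / n * n⁻¹) ≤ n * (D / n * n⁻¹) :=
          mul_le_mul_of_nonneg_right h1 (by positivity)
      _ = D / n := by field_simp
  have hinj : ∀ s < nn j, ∀ t < nn j, i s = i t → s = t := by
    have hlt : ∀ s t, s < t → t < nn j → i s ≠ i t := by
      intro s t hst ht
      obtain ⟨t, rfl⟩ : ∃ k, t = k + 1 := ⟨t - 1, by omega⟩
      rw [hi1 t ht]
      rcases Nat.eq_zero_or_pos s with rfl | hs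
      · omega
      · obtain ⟨s, rfl⟩ : ∃ k, s = k + 1 := ⟨s - 1, by omega⟩
        rw [hi1 s (by omega)]
        have h1 := hch.strictMono (show s < t by omega) (by omega)
        omega
    intro s hs t ht h
    rcases lt_trichotomy s t with h1 | h1 | h1
    · exact absurd h (hlt s t h1 ht)
    · exact h1
    · exact absurd h.symm (hlt t s h1 hs)
  have hev3 : ‖(∑ s ∈ Finset.Ico a b, z s - 𝒩.ext st (∑ s ∈ Finset.Ico a b, z s)) η'‖ ≤
      4 * D := by
    rw [hsub]
    have h1 : ∀ s ∈ Finset.Ico a b, ‖(z s - 𝒩.ext st (z s)) η'‖ ≤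
        D / n * n⁻¹ + if i s = 𝒩.wt η' then 3 * D else 0 := by
      intro s hs
      have hs' : s < nn j := (Finset.mem_Ico.1 hs).2.trans_le hb
      split_ifs with h
      · have := 𝒩.norm_sub_ext_le (hz s hs').bound st η'
        have : 0 ≤ D / n * n⁻¹ := by positivity
        linarith
      · rw [add_zero]
        exact hterm s hs' h
    refine (norm_sum_le_of_le _ h1).trans ?_
    rw [Finset.sum_add_distrib, ← Finset.sum_filter]
    have h2 : ((Finset.Ico a b).filter fun s => i s = 𝒩.wt η').card ≤ 1 := by
      rw [Finset.card_le_one]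
      intro s hs t ht
      simp only [Finset.mem_filter, Finset.mem_Ico] at hs ht
      exact hinj s (by omega) t (by omega) (hs.2.trans ht.2.symm)
    have h3 : (((Finset.Ico a b).filter fun s => i s = 𝒩.wt η').card : ℝ) ≤ 1 := by
      exact_mod_cast h2
    have h4 := mul_le_mul_of_nonneg_right h3 (by positivity : 0 ≤ 3 * D)
    refine (add_le_add hcount (le_of_eq (Finset.sum_const _))).trans ?_
    rw [nsmul_eq_mul]
    linarith
  rw [𝒩.apply_eq γ (∑ s ∈ Finset.Ico a b, z s), hfn, Fn.ev_single, hγ]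
  have htri : ∀ u v w : E, ‖u + v + (mm j : ℝ)⁻¹ • w‖ ≤ ‖u‖ + ‖v‖ + (mm j : ℝ)⁻¹ * ‖w‖ := by
    intro u v w
    refine (norm_add_le _ _).trans (add_le_add (norm_add_le _ _) ?_)
    rw [norm_smul, Real.norm_of_nonneg hm0]
  refine (htri _ _ _).trans ?_
  have hage : 0 ≤ (𝒩.age γ : ℝ) * (2 * (D / n)) := by positivity
  have hev3' := mul_le_mul_of_nonneg_left hev3 hm0
  have hm4 := hm2 (by positivity : 0 ≤ 4 * D)
  rcases hpre with ⟨hp, -⟩ | ⟨ξ', hp, hw⟩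
  · rw [atPre_none _ hp, norm_zero]
    linarith
  · rw [atPre_some _ hp]
    by_cases hξ : ∃ r < nn j, ξ r = ξ'
    · obtain ⟨r, hr, rfl⟩ := hξ
      linarith [hchain r hr]
    · have hne : ∀ s < nn j, i s ≠ 𝒩.wt η' := by
        intro s hs h
        rw [hw] at h
        rcases Nat.eq_zero_or_pos s with rfl | hs0
        · omega
        · obtain ⟨s, rfl⟩ : ∃ k, s = k + 1 := ⟨s - 1, by omega⟩
          rw [hi1 s hs] at h
          exact hξ ⟨s, by omega, by omega⟩
      have hev1 : ‖(∑ s ∈ Finset.Ico a b, z s -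
          𝒩.ext st (∑ s ∈ Finset.Ico a b, z s)) η'‖ ≤ D / n := by
        rw [hsub]
        refine (norm_sum_le_of_le _ fun s hs => ?_).trans hcount
        exact hterm s ((Finset.mem_Ico.1 hs).2.trans_le hb)
          (hne s ((Finset.mem_Ico.1 hs).2.trans_le hb))
      have h1 := ih ξ' (𝒩.pre_lt hp) (𝒩.wt_pre hp ▸ hγ)
      have h2 := mul_le_mul_of_nonneg_left hev1 hm0
      have h3 := hm2 hDn
      rw [𝒩.age_pre hp]
      push_cast
      linarith

end NodeSystem

theorem exists_even_ge (N : ℕ) : ∃ i, 4 ∣ i ∧ N ≤ mm i :=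
  ⟨4 * N, dvd_mul_right _ _, by have := lt_mm (4 * N); omega⟩

namespace NodeSystem

variable {𝒩 : NodeSystem}

theorem exists_dependent {C : ℝ} {P Q J : ℕ → ℕ} {x t : ℕ → ℕ → E} (hC : 0 < C)
    (R : ∀ L, 𝒩.Ris C L P Q J x) (hP : Tendsto P atTop atTop)
    (ht : ∀ l, 𝒩.Blk (P l) (Q l) (t l)) {b : ℕ → Fn} (hb : ∀ l, (b l).size ≤ 1)
    (hbQ : ∀ l, ∀ a ∈ b l, a.1 < Q l)
    (hx : Tendsto (fun l => ‖(b l).ev (x l)‖) atTop (𝓝 0)) {δ : ℝ}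
    (hδ : ∀ l, δ ≤ top ((b l).ev (t l))) {j : ℕ} (hj : Odd j) (K : ℕ) :
    ∃ u v, Comb K x t u v ∧ (∀ γ, ‖u γ‖ ≤ 70 * C * ((mm j : ℝ) ^ 2)⁻¹) ∧
      ∃ γ, (mm j : ℝ)⁻¹ * δ ≤ top (v γ) := by
  set n : ℝ := ((nn j : ℕ) : ℝ) with hn_def
  have hn1 : 1 ≤ n := one_le_nn_real j
  have hn0 : 0 < n := by linarith
  set D := 5 * C with hD_def
  have hD : 0 < D := by positivity
  have hmpos := mm_pos j
  -- the special sequence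
  obtain ⟨u, hu, hu'⟩ := exists_finite_seq
    (α := (ℕ × ℕ × ℕ × ℕ × ℕ) × (ℕ → E) × (ℕ → E)) (n := nn j)
    (I := fun s a => 𝒩.ExactPair D (D / n) δ a.1.1 a.1.2.1 a.1.2.2.1 a.1.2.2.2.1 a.2.1 a.2.2 ∧
      Comb K x t a.2.1 a.2.2 ∧ nn j ^ 2 ≤ mm a.1.1 ∧ a.1.2.2.1 ≤ a.1.2.2.2.2 ∧
      (s = 0 → 𝒩.pre a.1.2.2.2.2 = none ∧ 4 ∣ a.1.1) ∧ 𝒩.wt a.1.2.2.2.2 = j ∧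
      𝒩.fn a.1.2.2.2.2 = [(a.1.2.2.2.1, 0, 1)] ∧ 𝒩.age a.1.2.2.2.2 = s + 1)
    (R := fun _ a c => 𝒩.pre c.1.2.2.2.2 = some a.1.2.2.2.2 ∧ c.1.1 = 4 * a.1.2.2.2.2 + 2 ∧
      a.1.2.2.2.2 < c.1.2.1)
    (by
      obtain ⟨i, hi4, hi⟩ := exists_even_ge (nn j ^ 2)
      obtain ⟨q, η, z, τ, hz, hc⟩ := exists_exactPair hC.le R hP ht hb hbQ
        (show 0 < D / n by positivity) hx hδ
        (i := i) (even_iff_two_dvd.2 ((by norm_num : 2 ∣ 4).trans hi4)) 0 K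
      obtain ⟨ξ, h1, h2, h3, h4⟩ := 𝒩.exists_odd none j η q hj (by rwa [hz.wt])
        (fun _ => by rwa [hz.wt]) (by simp)
      exact ⟨⟨⟨i, 0, q, η, ξ⟩, z, τ⟩, hz, hc, hi, h1, fun _ => ⟨h2, hi4⟩, h3, h4,
        𝒩.age_none h2⟩)
    (by
      rintro s ⟨⟨i, p, q, η, ξ⟩, z, τ⟩ hs ⟨h1, h2, h3, h4, h5, h6, h7, h8⟩
      dsimp only at h1 h2 h3 h4 h5 h6 h7 h8
      obtain ⟨q', η', z', τ', hz, hc⟩ := exists_exactPair hC.le R hP ht hb hbQ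
        (show 0 < D / n by positivity) hx hδ (i := 4 * ξ + 2)
        (even_iff_two_dvd.2 ⟨2 * ξ + 1, by ring⟩) (ξ + 1) K
      have hmm : nn j ^ 2 ≤ mm (4 * ξ + 2) := by
        refine h3.trans (mm_mono ?_)
        have := 𝒩.wt_le η
        have := h1.lt
        have := h1.wt
        omega
      obtain ⟨ξ', e1, e2, e3, e4⟩ := 𝒩.exists_odd (some ξ) j η' q' hj (by rwa [hz.wt])
        (by simp) (by
          rintro ζ ⟨rfl⟩
          exact ⟨h6, by omega, hz.wt⟩)
      have := 𝒩.age_pre e2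
      exact ⟨⟨⟨4 * ξ + 2, ξ + 1, q', η', ξ'⟩, z', τ'⟩,
        ⟨hz, hc, hmm, e1, by omega, e3, e4, by dsimp only; omega⟩, e2, rfl, Nat.lt_succ_self _⟩)
  obtain ⟨i, hi⟩ : ∃ i : ℕ → ℕ, ∀ s, i s = (u s).1.1 := ⟨_, fun _ => rfl⟩
  obtain ⟨p, hp⟩ : ∃ p : ℕ → ℕ, ∀ s, p s = (u s).1.2.1 := ⟨_, fun _ => rfl⟩
  obtain ⟨q, hq⟩ : ∃ q : ℕ → ℕ, ∀ s, q s = (u s).1.2.2.1 := ⟨_, fun _ => rfl⟩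
  obtain ⟨η, hη⟩ : ∃ η : ℕ → ℕ, ∀ s, η s = (u s).1.2.2.2.1 := ⟨_, fun _ => rfl⟩
  obtain ⟨ξ, hξ⟩ : ∃ ξ : ℕ → ℕ, ∀ s, ξ s = (u s).1.2.2.2.2 := ⟨_, fun _ => rfl⟩
  obtain ⟨z, hz⟩ : ∃ z : ℕ → ℕ → E, ∀ s, z s = (u s).2.1 := ⟨_, fun _ => rfl⟩
  obtain ⟨τ, hτ⟩ : ∃ τ : ℕ → ℕ → E, ∀ s, τ s = (u s).2.2 := ⟨_, fun _ => rfl⟩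
  simp only [← hi, ← hp, ← hq, ← hη, ← hξ, ← hz, ← hτ] at hu hu'
  have hch : 𝒩.Chain (nn j) j ξ (fun s => [(η s, 0, 1)]) p q := by
    refine ⟨((hu 0 (one_le_nn j)).2.2.2.2.1 rfl).1, fun s hs => (hu' s hs).1,
      fun s hs => (hu s hs).2.2.2.2.2.1, fun s hs => (hu s hs).2.2.2.2.2.2.1, fun s hs => ?_,
      fun s hs => (hu s hs).2.2.2.1, fun s hs => (hu' s hs).2.2⟩
    simpa using (hu s hs).1.lt
  have hle : ∀ s t, s < t → t < nn j → q s ≤ p t := fun s t hst ht =>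
    (hch.le s (hst.trans ht)).trans (hch.lt_of_lt hst ht).le
  have hex : ∀ s < nn j, 𝒩.Exact D (p s) (q s) (i s) (z s) := fun s hs => (hu s hs).1.exact
  have hRis : 𝒩.Ris D (nn j) p q i z := by
    refine ⟨fun s hs => (hex s hs).rapid, hle, fun s t hst ht => ?_⟩
    obtain ⟨t, rfl⟩ : ∃ k, t = k + 1 := ⟨t - 1, by omega⟩
    have h1 := hch.le s (by omega)
    have h2 := hch.mono (show s ≤ t by omega) (by omega)
    have h3 := (hu' t ht).2.1
    omega
  have hspecial := fun γ hγ a b hab hb => norm_sum_le_special hj hD.le hex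
    (fun s hs => (hu s hs).2.2.1) (fun s hs => (hu s hs).1.small) hch hle
    ((hu 0 (one_le_nn j)).2.2.2.2.1 rfl).2 (fun s hs => (hu' s hs).2.1) (a := a) (b := b) hab hb γ
    hγ
  obtain ⟨M, s₀, hM, hnM, hs₀, hg⟩ := exists_growth j
  have H : ∀ γ, j ≤ 𝒩.wt γ → ∀ a b, a ≤ b → b ≤ nn j →
      ‖(∑ s ∈ Finset.Ico a b, z s) γ‖ ≤ D * ((mm j : ℝ) ^ 2)⁻¹ * ((b : ℝ) - a) + 5 * D := by
    intro γ hγ a b hab hb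
    have hba : (0 : ℝ) ≤ (b : ℝ) - a := by rw [sub_nonneg]; exact_mod_cast hab
    rcases hγ.eq_or_lt with h | h
    · refine (hspecial γ h.symm a b hab hb).trans ?_
      have : 0 ≤ D * ((mm j : ℝ) ^ 2)⁻¹ * ((b : ℝ) - a) := by positivity
      linarith
    · refine (hRis.norm_sum_le_heavy hD.le γ hab hb).trans ?_
      have h1 : (mm (𝒩.wt γ) : ℝ)⁻¹ ≤ ((mm j : ℝ) ^ 2)⁻¹ :=
        inv_anti₀ (by positivity) (by exact_mod_cast mm_sq_le h)
      have h2 := mul_le_mul_of_nonneg_right (mul_le_mul_of_nonneg_left h1 hD.le) hba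
      linarith
  refine ⟨n⁻¹ • ∑ s ∈ Finset.range (nn j), z s, n⁻¹ • ∑ s ∈ Finset.range (nn j), τ s,
    Comb.average (fun s hs => (hu s hs).2.1) (by positivity) (inv_mul_cancel₀ hn0.ne').le,
    fun γ => ?_, ξ (nn j - 1), ?_⟩
  · rw [Pi.smul_apply, norm_smul, norm_inv, Real.norm_of_nonneg hn0.le, inv_mul_le_iff₀ hn0,
      Finset.range_eq_Ico]
    have hmm' : 13 * (mm j : ℝ) ^ 2 ≤ 13 * n := by
      have : (mm j : ℝ) ^ 2 ≤ n := by rw [hn_def]; exact_mod_cast mm_sq_le_nn j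
      linarith
    set y := ((mm j : ℝ) ^ 2)⁻¹ with hy
    have hy0 : 0 < y := by positivity
    have hyn : 1 ≤ y * n := by
      rw [hy, le_inv_mul_iff₀ (by positivity)]
      linarith
    rcases lt_or_ge (𝒩.wt γ) j with h | h
    · have h1 := hRis.successive.norm_sum_le hD.le (by positivity) (by positivity)
        (fun s hs => (hex s hs).bound) hM hnM H s₀ γ h 0 (nn j) (Nat.zero_le _) le_rfl
      have h2 : D / 2 ^ s₀ ≤ D * y := by
        rw [div_eq_mul_inv]
        refine mul_le_mul_of_nonneg_left (inv_anti₀ (by positivity) ?_) hD.le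
        exact_mod_cast hs₀
      have h3 : (2 * (M : ℝ)) ^ (s₀ + 1) ≤ y * n := by
        rw [hy, le_inv_mul_iff₀ (by positivity), hn_def]
        exact_mod_cast hg
      refine h1.trans ?_
      have h4 := inv_mm_le (𝒩.wt γ)
      have h5 := inv_mm_nonneg (𝒩.wt γ)
      rw [Nat.cast_zero, sub_zero, ← hn_def]
      calc (mm (𝒩.wt γ) : ℝ)⁻¹ * ((D * y + D / 2 ^ s₀) * n) +
            (2 * (M : ℝ)) ^ (s₀ + 1) * (5 * D + 8 * D)
          ≤ 1 / 4 * ((D * y + D * y) * n) + y * n * (5 * D + 8 * D) := by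
            gcongr
        _ ≤ n * (70 * C * y) := by
            have : 0 ≤ D * y * n := by positivity
            have e : n * (70 * C * y) = 14 * (D * y * n) := by rw [hD_def]; ring
            rw [e]
            linarith
    · have h1 := H γ h 0 (nn j) (Nat.zero_le _) le_rfl
      rw [Nat.cast_zero, sub_zero, ← hn_def] at h1
      refine h1.trans ?_
      have h2 := mul_le_mul_of_nonneg_left hyn hD.le
      have : 0 ≤ D * (y * n) := by positivity
      have e : n * (70 * C * y) = 14 * (D * (y * n)) := by rw [hD_def]; ring
      rw [e]
      linarith
  · have hlast : nn j - 1 < nn j := by have := one_le_nn j; omega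
    rw [Pi.smul_apply, hch.apply_sum (fun s hs => (hu s hs).1.blk) _ hlast, map_smul, map_smul,
      map_sum, Nat.sub_add_cancel (one_le_nn j)]
    simp only [Fn.ev_single, smul_eq_mul]
    rw [mul_left_comm]
    refine mul_le_mul_of_nonneg_left ?_ (inv_mm_nonneg j)
    rw [le_inv_mul_iff₀ hn0, hn_def]
    have := Finset.card_nsmul_le_sum (Finset.range (nn j)) (fun s => top (τ s (η s)))
      δ fun s hs => (hu s (Finset.mem_range.1 hs)).1.large
    rwa [Finset.card_range, nsmul_eq_mul] at this

end NodeSystem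

/-! ### Separating functionals -/

theorem Fn.exists_combination (b c : Fn) {r : ℚ} (h0 : 0 ≤ r) (h1 : r ≤ 1) (hb : b.size ≤ 1)
    (hc : c.size ≤ 1) {q : ℕ} (hbq : ∀ a ∈ b, a.1 < q) (hcq : ∀ a ∈ c, a.1 < q) :
    ∃ d : Fn, d.size ≤ 1 ∧ (∀ a ∈ d, a.1 < q) ∧ ∀ x : ℕ → E,
      d.ev x = (r : ℝ) • b.ev x + (1 - (r : ℝ)) • c.ev x := by
  have hscale : ∀ (r : ℚ) (b : Fn), 0 ≤ r → (∀ a ∈ b, a.1 < q) → ∃ d : Fn, d.size = r * b.size ∧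
      (∀ a ∈ d, a.1 < q) ∧ ∀ x : ℕ → E, d.ev x = (r : ℝ) • b.ev x := by
    intro r b hr
    induction b with
    | nil => exact fun _ => ⟨[], by simp [Fn.size], by simp, by simp⟩
    | cons a b ih =>
      intro hb
      obtain ⟨d, h1, h2, h3⟩ := ih fun a ha => hb a (by simp [ha])
      refine ⟨(a.1, a.2.1, r * a.2.2) :: d, ?_, ?_, fun x => ?_⟩
      · rw [Fn.size_cons, Fn.size_cons, h1, abs_mul, abs_of_nonneg hr, mul_add]
      · simpa [hb a (by simp)] using h2
      · rw [Fn.ev_cons, Fn.ev_cons, h3, smul_add, smul_smul]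
        push_cast
        rfl
  have happend : ∀ b c : Fn, Fn.size (b ++ c) = b.size + c.size ∧ ∀ x : ℕ → E,
      Fn.ev (b ++ c) x = b.ev x + c.ev x := by
    intro b c
    induction b with
    | nil => simp [Fn.size]
    | cons a b ih =>
      refine ⟨?_, fun x => ?_⟩
      · rw [List.cons_append, Fn.size_cons, Fn.size_cons, ih.1, add_assoc]
      · rw [List.cons_append, Fn.ev_cons, Fn.ev_cons, ih.2, add_assoc]
  obtain ⟨d, h2, h3, h4⟩ := hscale r b h0 hbq
  obtain ⟨e, h5, h6, h7⟩ := hscale (1 - r) c (sub_nonneg.2 h1) hcq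
  refine ⟨d ++ e, ?_, ?_, fun x => ?_⟩
  · rw [(happend d e).1, h2, h5]
    nlinarith
  · intro a ha
    rcases List.mem_append.1 ha with h | h
    exacts [h3 a h, h6 a h]
  · rw [(happend d e).2, h4, h7]
    push_cast
    rfl

theorem exists_ratCast_tendsto {a : ℝ} (h0 : 0 ≤ a) (h1 : a ≤ 1) :
    ∃ r : ℕ → ℚ, (∀ n, 0 ≤ r n ∧ r n ≤ 1) ∧ Tendsto (fun n => (r n : ℝ)) atTop (𝓝 a) := by
  refine ⟨fun n => (⌊a * n⌋₊ : ℚ) / n, fun n => ⟨by positivity, div_le_one_of_le₀ ?_ (by positivity)⟩,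
    ?_⟩
  · have : (⌊a * n⌋₊ : ℝ) ≤ n := (Nat.floor_le (by positivity)).trans
      (mul_le_of_le_one_left (by positivity) h1)
    exact_mod_cast this
  · have := (tendsto_nat_floor_mul_div_atTop h0).comp (tendsto_natCast_atTop_atTop (R := ℝ))
    refine this.congr fun n => ?_
    push_cast
    rfl

theorem exists_fn_of_functionals {F : Type} [NormedAddCommGroup F] [NormedSpace ℝ F]
    (L : E →ₗ[ℝ] F) {x t : ℕ → E} {q : ℕ} {δ ε : ℝ} (hδ : 0 < δ) (hε : 0 < ε)
    (h : ∀ ψ : F →L[ℝ] ℝ, ∃ γ < q, ∃ i, δ ≤ |top (((N : E →ₗ[ℝ] E) ^ i) (t γ)) -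
      ψ (L (((N : E →ₗ[ℝ] E) ^ i) (x γ)))|) :
    ∃ b : Fn, b.size ≤ 1 ∧ (∀ a ∈ b, a.1 < q) ∧ ‖L (b.ev x)‖ ≤ ε ∧ δ / 2 ≤ top (b.ev t) := by
  set A : Set (ℝ × F) := {p | ∃ b : Fn, b.size ≤ 1 ∧ (∀ a ∈ b, a.1 < q) ∧
    p = (top (b.ev t), L (b.ev x))} with hA
  have hconv : Convex ℝ (closure A) := by
    intro p hp p' hp' a c ha hc hac
    obtain rfl : c = 1 - a := by linarith
    rw [← closure_closure]
    refine map_mem_closure₂ (f := fun p p' : ℝ × F => a • p + (1 - a) • p') (by fun_prop) hp hp' ?_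
    rintro _ ⟨b, h1, h2, rfl⟩ _ ⟨b', h1', h2', rfl⟩
    obtain ⟨r, hr, hlim⟩ := exists_ratCast_tendsto ha (by linarith)
    refine mem_closure_of_tendsto (b := atTop)
      (f := fun n => (r n : ℝ) • ((top (b.ev t), L (b.ev x)) : ℝ × F) +
        (1 - (r n : ℝ)) • (top (b'.ev t), L (b'.ev x))) ?_ (Eventually.of_forall fun n => ?_)
    · exact (hlim.smul_const _).add ((tendsto_const_nhds.sub hlim).smul_const _)
    · obtain ⟨d, e1, e2, e3⟩ := Fn.exists_combination (E := E) b b' (hr n).1 (hr n).2 h1 h1' h2 h2'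
      refine ⟨d, e1, e2, ?_⟩
      rw [e3, e3, map_add, map_smul, map_smul, map_add, map_smul, map_smul]
      rfl
  have hmem : ((3 * δ / 4, 0) : ℝ × F) ∈ closure A := by
    by_contra hnot
    obtain ⟨f, u, hf1, hf2⟩ := geometric_hahn_banach_closed_point hconv isClosed_closure hnot
    have hfA : ∀ b : Fn, b.size ≤ 1 → (∀ a ∈ b, a.1 < q) → f (top (b.ev t), L (b.ev x)) < u :=
      fun b h1 h2 => hf1 _ (subset_closure ⟨b, h1, h2, rfl⟩)
    have hsplit : ∀ s v, f (s, v) = f (1, 0) * s + f (0, v) := by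
      intro s v
      have : ((s, v) : ℝ × F) = s • ((1, 0) : ℝ × F) + (0, v) := by simp
      rw [this, map_add, map_smul, smul_eq_mul, mul_comm]
    have hf0 : f (0, (0 : F)) = 0 := by
      have : ((0, 0) : ℝ × F) = 0 := rfl
      rw [this, map_zero]
    have hu : 0 < u := by
      have := hfA [] (by simp [Fn.size]) (by simp)
      simpa [hf0] using this
    set α := f (1, 0) with hα_def
    rw [hsplit] at hf2
    rw [hf0, add_zero] at hf2
    have hα : 0 < α := by
      by_contra hneg
      have := mul_nonpos_of_nonpos_of_nonneg (not_lt.1 hneg) (by positivity : 0 ≤ 3 * δ / 4)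
      linarith
    obtain ⟨γ, hγ, i, hγδ⟩ := h (-(α⁻¹ • f.comp (ContinuousLinearMap.inr ℝ ℝ F)))
    set y := top (((N : E →ₗ[ℝ] E) ^ i) (t γ)) -
      (-(α⁻¹ • f.comp (ContinuousLinearMap.inr ℝ ℝ F))) (L (((N : E →ₗ[ℝ] E) ^ i) (x γ))) with hy
    have hval : ∀ r : ℚ, |r| ≤ 1 → (r : ℝ) * (α * y) < u := by
      intro r hr
      have h1 := hfA [(γ, i, r)] (by simpa [Fn.size] using hr) (by simpa using hγ)
      rw [hsplit] at h1
      have h2 : ∀ z, f (0, (r : ℝ) • z) = r * f (0, z) := fun z => by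
        have : ((0, (r : ℝ) • z) : ℝ × F) = (r : ℝ) • (0, z) := by simp
        rw [this, map_smul, smul_eq_mul]
      simp only [Fn.ev_cons, Fn.ev_nil, add_zero, map_smul, smul_eq_mul, h2] at h1
      refine lt_of_eq_of_lt ?_ h1
      rw [hy]
      simp only [neg_apply, smul_apply, ContinuousLinearMap.comp_apply,
        ContinuousLinearMap.inr_apply, smul_eq_mul]
      field_simp
      ring
    have h1 := hval 1 (by simp)
    have h2 := hval (-1) (by simp)
    push_cast at h1 h2
    have h3 : α * |y| < α * (3 * δ / 4) := by
      rw [← abs_of_pos hα, ← abs_mul, abs_of_pos hα, abs_lt]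
      constructor <;> linarith
    have h4 := lt_of_mul_lt_mul_left h3 hα.le
    linarith
  obtain ⟨_, ⟨b, h1, h2, rfl⟩, hb⟩ := Metric.mem_closure_iff.1 hmem (min (δ / 4) ε)
    (lt_min (by positivity) hε)
  rw [Prod.dist_eq, max_lt_iff, lt_min_iff, lt_min_iff] at hb
  refine ⟨b, h1, h2, ?_, ?_⟩
  · have := hb.2.2
    rw [dist_zero_left] at this
    exact this.le
  · have := abs_lt.1 hb.1.1
    dsimp only at this
    linarith [this.2]

/-- If `t` is far from all combinations of the `N ^ i x`, some rational functional of size at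
most `1` nearly annihilates `x` but not `t`. -/
theorem exists_fn {x t : ℕ → E} {q : ℕ} {δ ε : ℝ} (hδ : 0 < δ) (hε : 0 < ε)
    (h : ∀ c : ℕ → ℝ, ∃ γ < q,
      δ ≤ ‖t γ - ∑ i ∈ Finset.range (ord E), c i • ((N : E →ₗ[ℝ] E) ^ i) (x γ)‖) :
    ∃ b : Fn, b.size ≤ 1 ∧ (∀ a ∈ b, a.1 < q) ∧ ‖b.ev x‖ ≤ ε ∧ δ / 2 ≤ top (b.ev t) := by
  refine exists_fn_of_functionals LinearMap.id hδ hε fun ψ => ?_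
  obtain ⟨c, hc⟩ := exists_repr (ψ : E →ₗ[ℝ] ℝ)
  have hc' : ∀ v, ψ v = ∑ i ∈ Finset.range (ord E), c i * top (((N : E →ₗ[ℝ] E) ^ i) v) := hc
  obtain ⟨γ, hγ, hγδ⟩ := h c
  obtain ⟨i, hi⟩ := exists_top (t γ - ∑ i ∈ Finset.range (ord E),
    c i • ((N : E →ₗ[ℝ] E) ^ i) (x γ))
  refine ⟨γ, hγ, i, hγδ.trans (hi.trans (le_of_eq ?_))⟩
  rw [LinearMap.id_apply, hc', map_sub, map_sub, map_sum, map_sum]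
  simp only [map_smul, smul_eq_mul, ← Module.End.mul_apply, ← pow_add, add_comm i]

/-- If `t` is far from all multiples of `x`, some rational functional of size at most `1` is
small in the top coordinate at `x` but not at `t`. -/
theorem exists_fn_top {x t : ℕ → E} {q : ℕ} {δ ε : ℝ} (hδ : 0 < δ) (hε : 0 < ε)
    (h : ∀ c : ℝ, ∃ γ < q, δ ≤ ‖t γ - c • x γ‖) :
    ∃ b : Fn, b.size ≤ 1 ∧ (∀ a ∈ b, a.1 < q) ∧ |top (b.ev x)| ≤ ε ∧ δ / 2 ≤ top (b.ev t) := by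
  refine exists_fn_of_functionals (top : E →ₗ[ℝ] ℝ) hδ hε fun ψ => ?_
  obtain ⟨γ, hγ, hγδ⟩ := h (ψ 1)
  obtain ⟨i, hi⟩ := exists_top (t γ - ψ 1 • x γ)
  refine ⟨γ, hγ, i, hγδ.trans (hi.trans (le_of_eq ?_))⟩
  have : ∀ s : ℝ, ψ s = s * ψ 1 := fun s => by
    rw [← smul_eq_mul, ← map_smul, smul_eq_mul, mul_one]
  rw [map_sub, map_sub, map_smul, map_smul, smul_eq_mul, mul_comm, ← this]

/-! ### Operators on the Bourgain–Delbaen space -/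

theorem norm_le_sum_top (v : E) :
    ‖v‖ ≤ ∑ i ∈ Finset.range (ord E), |top (((N : E →ₗ[ℝ] E) ^ i) v)| := by
  obtain ⟨i, hi⟩ := exists_top v
  by_cases h : i < ord E
  · exact hi.trans (Finset.single_le_sum
      (f := fun i => |top (((N : E →ₗ[ℝ] E) ^ i) v)|) (fun _ _ => abs_nonneg _)
      (Finset.mem_range.2 h))
  · obtain ⟨r, rfl⟩ := Nat.exists_eq_add_of_le (not_lt.1 h)
    rw [pow_add, pow_ord, zero_mul] at hi
    refine (hi.trans (by simp)).trans (Finset.sum_nonneg fun _ _ => abs_nonneg _)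

namespace NodeSystem

variable {𝒩 : NodeSystem}

variable (𝒩 E) in
/-- A realization of the Bourgain–Delbaen space attached to a node system as a normed space. -/
structure Model (X : Type) [NormedAddCommGroup X] [NormedSpace ℝ X] where
  /-- the values of an element at the nodes -/
  vals : X →ₗ[ℝ] (ℕ → E)
  norm_vals_le : ∀ x γ, ‖vals x γ‖ ≤ ‖x‖
  norm_le : ∀ x C, 0 ≤ C → (∀ γ, ‖vals x γ‖ ≤ C) → ‖x‖ ≤ C
  exists_vals : ∀ q f, 𝒩.ext q f = f → ∃ x, vals x = f
  /-- the basis projections -/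
  proj : ℕ → X →L[ℝ] X
  vals_proj : ∀ p x, vals (proj p x) = 𝒩.ext p (vals x)
  tendsto_proj : ∀ x, Tendsto (fun p => proj p x) atTop (𝓝 x)
  /-- the nilpotent operator -/
  shift : X →L[ℝ] X
  vals_shift : ∀ x γ, vals (shift x) γ = N (vals x γ)

theorem Rapid.mono {C C' : ℝ} {p p' q q' j j' : ℕ} {x : ℕ → E} (h : 𝒩.Rapid C p q j x)
    (hC : C ≤ C') (hp : p' ≤ p) (hq : q ≤ q') (hj : j' ≤ j) : 𝒩.Rapid C' p' q' j' x :=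
  ⟨h.blk.mono hp hq, fun γ => (h.bound γ).trans hC, fun γ hγ =>
    (h.light γ (hγ.trans_le hj)).trans (mul_le_mul_of_nonneg_left hC (inv_mm_nonneg _))⟩

theorem Rapid.add {C D : ℝ} {p q j : ℕ} {x y : ℕ → E} (hx : 𝒩.Rapid C p q j x)
    (hy : 𝒩.Rapid D p q j y) : 𝒩.Rapid (C + D) p q j (x + y) :=
  ⟨hx.blk.add hy.blk, fun γ => (norm_add_le _ _).trans (add_le_add (hx.bound γ) (hy.bound γ)),
    fun γ hγ => by
      rw [mul_add]
      exact (norm_add_le _ _).trans (add_le_add (hx.light γ hγ) (hy.light γ hγ))⟩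

theorem Rapid.pow {C : ℝ} {p q j : ℕ} {x : ℕ → E} (hx : 𝒩.Rapid C p q j x) (i : ℕ) :
    𝒩.Rapid C p q j (fun n => ((N : E →ₗ[ℝ] E) ^ i) (x n)) :=
  ⟨hx.blk.pow i, fun γ => (norm_pow_le _ _).trans (hx.bound γ),
    fun γ hγ => (norm_pow_le _ _).trans (hx.light γ hγ)⟩

/-- Sufficiently late rapid vectors can be arranged in a rapidly increasing sequence. -/
theorem exists_ris {α : Type*} {C : ℝ} {f : α → ℕ → E} {Φ : ℕ → ℕ → ℕ → α → Prop}
    (H : ∀ n, ∃ p q j x, n ≤ p ∧ n ≤ j ∧ 𝒩.Rapid C p q j (f x) ∧ Φ n p q x) :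
    ∃ (P Q J : ℕ → ℕ) (x : ℕ → α), (∀ L, 𝒩.Ris C L P Q J fun l => f (x l)) ∧
      Tendsto P atTop atTop ∧ ∀ l, ∃ n ≥ l, Φ n (P l) (Q l) (x l) := by
  choose p q j x hp hj hR hΦ using H
  let ν : ℕ → ℕ := fun l => Nat.rec 0 (fun _ n => max n (q n) + 1) l
  have hν : ∀ l, ν (l + 1) = max (ν l) (q (ν l)) + 1 := fun _ => rfl
  have hmono : StrictMono ν := strictMono_nat_of_lt_succ fun l => by rw [hν]; omega
  have hq : ∀ k l, k < l → q (ν k) ≤ ν l := fun k l hkl => by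
    have h1 : ν (k + 1) ≤ ν l := hmono.monotone hkl
    rw [hν] at h1
    omega
  refine ⟨fun l => p (ν l), fun l => q (ν l), fun l => j (ν l), fun l => x (ν l), fun L =>
    ⟨fun k _ => hR _, fun k l hkl _ => (hq k l hkl).trans (hp _),
      fun k l hkl _ => (hq k l hkl).trans (hj _)⟩, ?_, fun l => ⟨ν l, hmono.le_apply, hΦ _⟩⟩
  exact tendsto_atTop_mono (fun l => hmono.le_apply.trans (hp (ν l))) tendsto_id

namespace Model

variable {X : Type} [NormedAddCommGroup X] [NormedSpace ℝ X] (M : 𝒩.Model E X)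

theorem vals_injective : Function.Injective M.vals := by
  rw [← LinearMap.ker_eq_bot, LinearMap.ker_eq_bot']
  intro x hx
  have := M.norm_le x 0 le_rfl fun γ => by rw [hx]; simp
  exact norm_le_zero_iff.1 this

theorem norm_proj_le (p : ℕ) (x : X) : ‖M.proj p x‖ ≤ 2 * ‖x‖ :=
  M.norm_le _ _ (by positivity) fun γ => by
    rw [vals_proj]
    exact 𝒩.norm_ext_le (norm_nonneg _) γ p fun η _ => M.norm_vals_le x η

theorem vals_shift_pow (i : ℕ) (x : X) (γ : ℕ) :
    M.vals ((M.shift ^ i) x) γ = ((N : E →ₗ[ℝ] E) ^ i) (M.vals x γ) := by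
  induction i generalizing x with
  | zero => simp
  | succ i ih => rw [pow_succ', pow_succ', Module.End.mul_apply, ← ih, ← M.vals_shift]; rfl

theorem vals_shift_pow_eq (i : ℕ) (x : X) :
    M.vals ((M.shift ^ i) x) = fun γ => ((N : E →ₗ[ℝ] E) ^ i) (M.vals x γ) :=
  funext (M.vals_shift_pow i x)

theorem norm_shift_pow_le (i : ℕ) (x : X) : ‖(M.shift ^ i) x‖ ≤ ‖x‖ :=
  M.norm_le _ _ (norm_nonneg _) fun γ => by
    rw [vals_shift_pow]
    exact (norm_pow_le _ _).trans (M.norm_vals_le x γ)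

theorem norm_le_of_lt {p q : ℕ} {x : X} (hx : 𝒩.Blk p q (M.vals x)) {C : ℝ} (hC : 0 ≤ C)
    (h : ∀ γ < q, ‖M.vals x γ‖ ≤ C) : ‖x‖ ≤ 2 * C :=
  M.norm_le _ _ (by positivity) fun γ => by
    rw [← hx.2]
    exact 𝒩.norm_ext_le hC γ q h

theorem norm_le_of_rapid {C : ℝ} {p q j : ℕ} {x : X} (hx : 𝒩.Rapid C p q j (M.vals x)) :
    ‖x‖ ≤ C :=
  M.norm_le _ _ ((norm_nonneg _).trans (hx.bound 0)) hx.bound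

theorem blk_proj_sub {p q : ℕ} (h : p ≤ q) (x : X) :
    𝒩.Blk p q (M.vals (M.proj q x - M.proj p x)) := by
  rw [map_sub, vals_proj, vals_proj]
  exact 𝒩.blk_ext_sub h _

/-- A bounded functional is small on late rapid vectors. -/
theorem exists_functional_le {C : ℝ} (hC : 0 ≤ C) (φ : X →L[ℝ] ℝ) {ε : ℝ} (hε : 0 < ε) :
    ∃ n, ∀ p q j x, n ≤ p → n ≤ j → 𝒩.Rapid C p q j (M.vals x) → φ x ≤ ε := by
  by_contra! h
  obtain ⟨P, Q, J, x, R, hP, hx⟩ := exists_ris (f := M.vals)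
    (Φ := fun _ _ _ x => ε < φ x) fun n => by
      obtain ⟨p, q, j, x, h1, h2, h3, h4⟩ := h n
      exact ⟨p, q, j, x, h1, h2, h3, h4⟩
  have key : ∀ j, (mm j : ℝ) * ε ≤ ‖φ‖ * (5 * C) := by
    intro j
    set n : ℝ := ((nn j : ℕ) : ℝ) with hn_def
    have hn0 : 0 < n := lt_of_lt_of_le one_pos (one_le_nn_real j)
    have hex := (R (nn j)).exact hC (p := 0) (q := ∑ k ∈ Finset.range (nn j), Q k)
      (fun _ _ => Nat.zero_le _)
      fun k hk => Finset.single_le_sum (f := Q) (fun _ _ => Nat.zero_le _) (Finset.mem_range.2 hk)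
    have hb : ‖((mm j : ℝ) / n) • ∑ k ∈ Finset.Ico 0 (nn j), x k‖ ≤ 5 * C :=
      M.norm_le _ _ (by positivity) fun γ => by
        rw [map_smul, map_sum]
        exact hex.bound γ
    have h1 : φ (((mm j : ℝ) / n) • ∑ k ∈ Finset.Ico 0 (nn j), x k) ≤ ‖φ‖ * (5 * C) :=
      (le_abs_self _).trans ((φ.le_opNorm _).trans (mul_le_mul_of_nonneg_left hb (norm_nonneg _)))
    refine le_trans ?_ h1
    rw [map_smul, map_sum, smul_eq_mul]
    have h2 : n * ε ≤ ∑ k ∈ Finset.Ico 0 (nn j), φ (x k) := by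
      have := Finset.card_nsmul_le_sum (Finset.Ico 0 (nn j)) (fun k => φ (x k)) ε fun k _ => by
        obtain ⟨_, _, h⟩ := hx k
        exact h.le
      simpa using this
    calc (mm j : ℝ) * ε = mm j / n * (n * ε) := by field_simp
      _ ≤ _ := mul_le_mul_of_nonneg_left h2 (by positivity)
  obtain ⟨j, hj⟩ := exists_nat_gt (‖φ‖ * (5 * C) / ε)
  have h1 := key j
  rw [div_lt_iff₀ hε] at hj
  have h2 : (j : ℝ) * ε ≤ mm j * ε :=
    mul_le_mul_of_nonneg_right (by exact_mod_cast (lt_mm j).le) hε.le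
  linarith

/-- The images of late rapid vectors have small values at any given node. -/
theorem exists_vals_le {C : ℝ} (hC : 0 ≤ C) (T : X →L[ℝ] X) (γ : ℕ) {ε : ℝ} (hε : 0 < ε) :
    ∃ n, ∀ p q j x, n ≤ p → n ≤ j → 𝒩.Rapid C p q j (M.vals x) → ‖M.vals (T x) γ‖ ≤ ε := by
  classical
  let ψ : ℕ → X →L[ℝ] ℝ := fun i => (LinearMap.mkContinuous
    (((top : E →ₗ[ℝ] ℝ) ∘ₗ ((N : E →ₗ[ℝ] E) ^ i)) ∘ₗ (LinearMap.proj γ ∘ₗ M.vals)) 1 fun x => by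
      rw [one_mul]
      exact (abs_top_le _).trans ((norm_pow_le _ _).trans (M.norm_vals_le x γ))).comp T
  have hψ : ∀ i x, ψ i x = top (((N : E →ₗ[ℝ] E) ^ i) (M.vals (T x) γ)) := fun _ _ => rfl
  have hε' : 0 < ε / (ord E + 1) := by positivity
  choose a ha using fun i => M.exists_functional_le hC (ψ i) hε'
  choose b hb using fun i => M.exists_functional_le hC (-ψ i) hε'
  refine ⟨(Finset.range (ord E)).sup fun i => max (a i) (b i), fun p q j x hp hj hx => ?_⟩
  refine (norm_le_sum_top _).trans ?_
  have h1 : ∀ i ∈ Finset.range (ord E),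
      |top (((N : E →ₗ[ℝ] E) ^ i) (M.vals (T x) γ))| ≤ ε / (ord E + 1) := by
    intro i hi
    have h2 := Finset.le_sup (f := fun i => max (a i) (b i)) hi
    have h3 := ha i p q j x ((le_max_left _ _).trans (h2.trans hp))
      ((le_max_left _ _).trans (h2.trans hj)) hx
    have h4 := hb i p q j x ((le_max_right _ _).trans (h2.trans hp))
      ((le_max_right _ _).trans (h2.trans hj)) hx
    rw [neg_apply, hψ] at h4
    rw [hψ] at h3
    exact abs_le.2 ⟨by linarith, h3⟩
  refine (Finset.sum_le_card_nsmul _ _ _ h1).trans ?_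
  rw [Finset.card_range, nsmul_eq_mul, mul_div_assoc', div_le_iff₀ (by positivity)]
  nlinarith

theorem exists_proj_le {C : ℝ} (hC : 0 ≤ C) (T : X →L[ℝ] X) (r : ℕ) {ε : ℝ} (hε : 0 < ε) :
    ∃ n, ∀ p q j x, n ≤ p → n ≤ j → 𝒩.Rapid C p q j (M.vals x) → ‖M.proj r (T x)‖ ≤ ε := by
  choose a ha using fun γ => M.exists_vals_le hC T γ (half_pos hε)
  refine ⟨(Finset.range r).sup a, fun p q j x hp hj hx => ?_⟩
  have := M.norm_le (M.proj r (T x)) (2 * (ε / 2)) (by positivity) fun γ => by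
    rw [vals_proj]
    refine 𝒩.norm_ext_le (by positivity) γ r fun η hη => ?_
    have h2 := Finset.le_sup (f := a) (Finset.mem_range.2 hη)
    exact ha η p q j x (h2.trans hp) (h2.trans hj) hx
  linarith

/-- There is no bounded relation carrying late rapid vectors to vectors which can be separated
from them by functionals of size at most `1`. -/
theorem not_separated {C K δ : ℝ} (hC : 0 < C) (hδ : 0 < δ) (G : Submodule ℝ (X × X))
    (hG : ∀ w ∈ G, ‖w.2‖ ≤ K * ‖w.1‖) : ¬ ∀ n : ℕ, ∃ p q j x, n ≤ p ∧ n ≤ j ∧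
      𝒩.Rapid C p q j (M.vals x) ∧ ∃ (b : Fn) (t x' t' : X), 𝒩.Blk p q (M.vals t) ∧ b.size ≤ 1 ∧
      (∀ a ∈ b, a.1 < q) ∧ ‖b.ev (M.vals x)‖ ≤ (1 / 2 : ℝ) ^ n ∧ δ ≤ top (b.ev (M.vals t)) ∧
      (x', t') ∈ G ∧ ‖x' - x‖ ≤ (1 / 2 : ℝ) ^ n ∧ ‖t' - t‖ ≤ (1 / 2 : ℝ) ^ n := by
  intro H
  obtain ⟨P, Q, J, x, R, hP, hx⟩ := exists_ris (f := M.vals) H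
  choose ν hν b t x' t' h1 h2 h3 h4 h5 h6 h6' h7 using hx
  have hpow : ∀ l, (1 / 2 : ℝ) ^ ν l ≤ (1 / 2) ^ l := fun l =>
    pow_le_pow_of_le_one (by norm_num) (by norm_num) (hν l)
  have hlim : Tendsto (fun l => ‖(b l).ev (M.vals (x l))‖) atTop (𝓝 0) :=
    squeeze_zero (fun _ => norm_nonneg _) (fun l => (h4 l).trans (hpow l))
      (tendsto_pow_atTop_nhds_zero_of_lt_one (by norm_num) (by norm_num))
  have key : ∀ j, Odd j → (mm j : ℝ)⁻¹ * δ ≤ 2 * (|K| * (70 * C * ((mm j : ℝ) ^ 2)⁻¹)) := by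
    intro j hj
    have hm := mm_pos j
    have hθ : 0 < (mm j : ℝ)⁻¹ * δ / 4 / (|K| + 1) := by positivity
    obtain ⟨k, hk⟩ := exists_pow_lt_of_lt_one hθ (by norm_num : (1 / 2 : ℝ) < 1)
    obtain ⟨u, v, ⟨a, ha, hak, hu, hv⟩, hub, γ, hγ⟩ :=
      exists_dependent (x := fun l => M.vals (x l)) (t := fun l => M.vals (t l)) hC R hP h1 h2 h3
        hlim h5 hj k
    have hu' : u = M.vals (a.sum fun l c => c • x l) := by
      rw [hu, Finsupp.sum, Finsupp.sum, map_sum]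
      simp only [map_smul]
    have hv' : v = M.vals (a.sum fun l c => c • t l) := by
      rw [hv, Finsupp.sum, Finsupp.sum, map_sum]
      simp only [map_smul]
    have hmem : (a.sum fun l c => c • (x' l, t' l)) ∈ G :=
      Submodule.sum_mem _ fun l _ => G.smul_mem _ (h6 l)
    have e1 : (a.sum fun l c => c • (x' l, t' l)).1 = a.sum fun l c => c • x' l := by
      simp [Finsupp.sum, Prod.fst_sum]
    have e2 : (a.sum fun l c => c • (x' l, t' l)).2 = a.sum fun l c => c • t' l := by
      simp [Finsupp.sum, Prod.snd_sum]
    have hbd := hG _ hmem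
    rw [e1, e2] at hbd
    have hun : ‖a.sum fun l c => c • x l‖ ≤ 70 * C * ((mm j : ℝ) ^ 2)⁻¹ :=
      M.norm_le _ _ (by positivity) fun γ => by rw [← hu']; exact hub γ
    have hdiff : ∀ f f' : ℕ → X, (∀ l, ‖f' l - f l‖ ≤ (1 / 2) ^ ν l) →
        ‖(a.sum fun l c => c • f' l) - a.sum fun l c => c • f l‖ ≤ 2 * (1 / 2) ^ k := by
      intro f f' hf
      rw [Finsupp.sum, Finsupp.sum, ← Finset.sum_sub_distrib]
      refine (norm_sum_le_of_le (n := fun l => (1 / 2 : ℝ) ^ k * (1 / 2) ^ (l - k)) _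
        fun l hl => ?_).trans ?_
      · rw [← smul_sub, norm_smul, Real.norm_of_nonneg (ha l).1, ← pow_add,
          Nat.add_sub_cancel' (hak l hl)]
        exact (mul_le_of_le_one_left (norm_nonneg _) (ha l).2).trans ((hf l).trans (hpow l))
      · rw [← Finset.mul_sum, mul_comm 2]
        refine mul_le_mul_of_nonneg_left ?_ (by positivity)
        have hinj : Set.InjOn (fun l => l - k) (a.support : Set ℕ) := fun l hl l' hl' h => by
          have := hak l hl
          have := hak l' hl'
          dsimp only at h
          omega
        rw [← Finset.sum_image (f := fun l => (1 / 2 : ℝ) ^ l) hinj]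
        refine (summable_geometric_two.sum_le_tsum _ fun _ _ => by positivity).trans ?_
        rw [tsum_geometric_two]
    have h8 : top (v γ) ≤ ‖a.sum fun l c => c • t l‖ := by
      rw [hv']
      exact (le_abs_self _).trans ((abs_top_le _).trans (M.norm_vals_le _ γ))
    have h9 := norm_sub_norm_le (a.sum fun l c => c • t l) (a.sum fun l c => c • t' l)
    rw [norm_sub_rev] at h9
    have h10 := norm_sub_norm_le (a.sum fun l c => c • x' l) (a.sum fun l c => c • x l)
    have h11 := hdiff x x' h6'
    have h12 := hdiff t t' h7
    have h13 : K * ‖a.sum fun l c => c • x' l‖ ≤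
        |K| * (70 * C * ((mm j : ℝ) ^ 2)⁻¹ + 2 * (1 / 2) ^ k) :=
      mul_le_mul (le_abs_self _) (by linarith) (norm_nonneg _) (abs_nonneg _)
    rw [lt_div_iff₀ (by positivity)] at hk
    linarith
  obtain ⟨i, hi⟩ := exists_nat_gt (140 * (|K| * C) / δ)
  have hj : Odd (2 * i + 1) := odd_two_mul_add_one i
  have h := key _ hj
  have hm := mm_pos (2 * i + 1)
  rw [div_lt_iff₀ hδ] at hi
  have him : (i : ℝ) ≤ mm (2 * i + 1) := by
    have := lt_mm (2 * i + 1)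
    exact_mod_cast (by omega : i ≤ mm (2 * i + 1))
  set m : ℝ := ((mm (2 * i + 1) : ℕ) : ℝ)
  have h' : m * δ ≤ 140 * (|K| * C) := by
    have := mul_le_mul_of_nonneg_left h (sq_nonneg m)
    calc m * δ = m ^ 2 * (m⁻¹ * δ) := by field_simp
      _ ≤ _ := this
      _ = _ := by field_simp; ring
  nlinarith

end Model

end NodeSystem

namespace NodeSystem

variable {𝒩 : NodeSystem}

namespace Model

variable {X : Type} [NormedAddCommGroup X] [NormedSpace ℝ X] (M : 𝒩.Model E X)

/-- The polynomial in the shift with coefficients `c`. -/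
noncomputable def poly (c : ℕ → ℝ) : X →L[ℝ] X :=
  ∑ i ∈ Finset.range (ord E), c i • M.shift ^ i

theorem vals_poly (c : ℕ → ℝ) (x : X) (γ : ℕ) : M.vals (M.poly c x) γ =
    ∑ i ∈ Finset.range (ord E), c i • ((N : E →ₗ[ℝ] E) ^ i) (M.vals x γ) := by
  rw [poly, sum_apply, map_sum, Finset.sum_apply]
  refine Finset.sum_congr rfl fun i _ => ?_
  rw [smul_apply, map_smul, Pi.smul_apply, vals_shift_pow]

theorem norm_poly_le {c : ℕ → ℝ} {D : ℝ} (h : ∀ i < ord E, |c i| ≤ D) (x : X) :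
    ‖M.poly c x‖ ≤ ord E * D * ‖x‖ := by
  rw [poly, sum_apply]
  refine (norm_sum_le_of_le (n := fun _ => D * ‖x‖) _ fun i hi => ?_).trans
    (by simp [mul_assoc])
  rw [smul_apply, norm_smul, Real.norm_eq_abs]
  exact mul_le_mul (h i (Finset.mem_range.1 hi)) (M.norm_shift_pow_le i x) (norm_nonneg _)
    ((abs_nonneg _).trans (h i (Finset.mem_range.1 hi)))

theorem blk_poly {p q : ℕ} {x : X} (hx : 𝒩.Blk p q (M.vals x)) (c : ℕ → ℝ) :
    𝒩.Blk p q (M.vals (M.poly c x)) := by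
  rw [poly, sum_apply, map_sum]
  refine Blk.sum fun i _ => ?_
  rw [smul_apply, map_smul, vals_shift_pow_eq]
  exact (hx.pow i).smul _

/-- A bounded operator acts on late rapid vectors almost like some polynomial in the shift. -/
theorem exists_poly {C : ℝ} (hC : 0 < C) (T : X →L[ℝ] X) {ε : ℝ} (hε : 0 < ε) :
    ∃ n, ∀ p q j x, n ≤ p → n ≤ j → 𝒩.Rapid C p q j (M.vals x) →
      ∃ c, ‖T x - M.poly c x‖ ≤ ε := by
  by_contra! h
  refine M.not_separated (K := ‖T‖) (δ := ε / 8 / 2) hC (by positivity)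
    (LinearMap.graph (T : X →ₗ[ℝ] X)) ?_ fun n => ?_
  · rintro ⟨x, y⟩ hxy
    rw [LinearMap.mem_graph_iff] at hxy
    dsimp only at hxy ⊢
    rw [hxy]
    exact T.le_opNorm x
  set η : ℝ := min ((1 / 2) ^ n / 2) (ε / 8) with hη
  have hη0 : 0 < η := lt_min (by positivity) (by positivity)
  obtain ⟨n', hn'⟩ := M.exists_proj_le hC.le T n hη0
  obtain ⟨p, q, j, x, h1, h2, h3, h4⟩ := h (max n n')
  have hp := hn' p q j x ((le_max_right _ _).trans h1) ((le_max_right _ _).trans h2) h3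
  obtain ⟨q', hq'⟩ := ((((Metric.tendsto_nhds.1 (M.tendsto_proj (T x))) η hη0).and
    (eventually_ge_atTop (max q n))).exists)
  rw [dist_eq_norm] at hq'
  have hqq : q ≤ q' := (le_max_left _ _).trans hq'.2
  have hnq : n ≤ q' := (le_max_right _ _).trans hq'.2
  set t := M.proj q' (T x) - M.proj n (T x) with ht_def
  have ht : 𝒩.Blk n q' (M.vals t) := M.blk_proj_sub hnq _
  have hTt : ‖T x - t‖ ≤ 2 * η := by
    have : T x - t = -(M.proj q' (T x) - T x) + M.proj n (T x) := by rw [ht_def]; abel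
    rw [this]
    refine (norm_add_le _ _).trans ?_
    rw [norm_neg]
    linarith [hq'.1]
  have hx' : 𝒩.Rapid C n q' j (M.vals x) := h3.mono le_rfl ((le_max_left _ _).trans h1) hqq le_rfl
  obtain ⟨b, hb1, hb2, hb3, hb4⟩ := exists_fn (x := M.vals x) (t := M.vals t) (q := q')
    (δ := ε / 8) (ε := (1 / 2 : ℝ) ^ n) (by positivity) (by positivity) fun c => by
      by_contra! hlt
      have h5 : ‖t - M.poly c x‖ ≤ 2 * (ε / 8) := by
        refine M.norm_le_of_lt (p := n) (q := q') ?_ (by positivity) fun γ hγ => ?_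
        · rw [sub_eq_add_neg, map_add, ← neg_one_smul ℝ (M.poly c x), map_smul]
          exact ht.add ((M.blk_poly hx'.blk c).smul _)
        · rw [map_sub, Pi.sub_apply, vals_poly]
          exact (hlt γ hγ).le
      have h6 := norm_add_le (T x - t) (t - M.poly c x)
      rw [sub_add_sub_cancel] at h6
      have h7 := h4 c
      have h8 : η ≤ ε / 8 := min_le_right _ _
      linarith
  refine ⟨n, q', j, x, le_rfl, (le_max_left _ _).trans h2, hx', b, t, x, T x, ht, hb1, hb2, hb3,
    hb4, ?_, by simp, ?_⟩
  · rw [LinearMap.mem_graph_iff]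
    rfl
  · have h8 : η ≤ (1 / 2) ^ n / 2 := min_le_left _ _
    linarith

end Model

theorem norm_ext_le_of_wt {u : ℕ → E} {q γ : ℕ} {C : ℝ} (hC : ∀ η, ‖𝒩.ext q u η‖ ≤ C)
    (h : ∀ ξ < q, 𝒩.wt ξ = 𝒩.wt γ → u ξ = 0) :
    ‖𝒩.ext q u γ‖ ≤ (mm (𝒩.wt γ) : ℝ)⁻¹ * (3 * C) := by
  have h0 : 0 ≤ C := (norm_nonneg _).trans (hC 0)
  induction γ using Nat.strong_induction_on with
  | _ γ ih =>
  rcases lt_or_ge γ q with hγ | hγ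
  · rw [ext_of_lt _ _ hγ, h γ hγ rfl, norm_zero]
    have := inv_mm_nonneg (𝒩.wt γ)
    positivity
  rw [ext_of_le _ _ hγ]
  have hstep : ‖if 𝒩.start γ < q then (mm (𝒩.wt γ) : ℝ)⁻¹ • (𝒩.fn γ).ev
      (𝒩.ext q u - 𝒩.ext (𝒩.start γ) u) else 0‖ ≤ (mm (𝒩.wt γ) : ℝ)⁻¹ * (3 * C) := by
    split_ifs with hs
    · rw [norm_smul, Real.norm_of_nonneg (inv_mm_nonneg _)]
      refine mul_le_mul_of_nonneg_left ?_ (inv_mm_nonneg _)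
      refine Fn.norm_ev_le (𝒩.fn_size γ) (by positivity) fun a _ => ?_
      rw [← 𝒩.ext_ext_of_le hs.le]
      exact 𝒩.norm_sub_ext_le hC _ _
    · rw [norm_zero]
      have := inv_mm_nonneg (𝒩.wt γ)
      positivity
  rcases hp : 𝒩.pre γ with _ | ξ
  · rwa [atPre_none _ hp, zero_add]
  · rw [atPre_some _ hp]
    have hw := 𝒩.wt_pre hp
    rcases lt_or_ge ξ q with hξ | hξ
    · rw [ext_of_lt _ _ hξ, h ξ hξ hw, zero_add]
      exact hstep
    · have hs : ¬ 𝒩.start γ < q := by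
        rw [start, hp, Option.elim_some]
        omega
      rw [if_neg hs, add_zero, ← hw]
      exact ih ξ (𝒩.pre_lt hp) fun η hη e => h η hη (e.trans hw)

open Classical in
/-- A block is the sum of two rapid vectors: one carried by the nodes of small weight, and one
carried by those of large weight. -/
theorem Blk.exists_rapid_add {p q : ℕ} {y : ℕ → E} (hy : 𝒩.Blk p q y) (h : ∀ γ, ‖y γ‖ ≤ 1)
    (n : ℕ) : ∃ v w, y = v + w ∧ (∀ j, 𝒩.Rapid (6 * mm n) p q j v) ∧ 𝒩.Rapid 6 p q (n + 1) w := by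
  set u : ℕ → E := fun γ => if 𝒩.wt γ ≤ n then y γ else 0 with hu
  have hy0 : ∀ γ < p, u γ = 0 ∧ (y - u) γ = 0 := fun γ hγ => by
    have := hy.1 γ hγ
    simp [hu, this]
  have hbu : ∀ γ, ‖u γ‖ ≤ 1 := fun γ => by
    rw [hu]; dsimp only; split_ifs
    exacts [h γ, by simp]
  have hbu' : ∀ γ, ‖(y - u) γ‖ ≤ 1 := fun γ => by
    rw [Pi.sub_apply, hu]; dsimp only; split_ifs
    exacts [by simp, by simpa using h γ]
  have hE : ∀ γ, ‖𝒩.ext q u γ‖ ≤ 2 := fun γ => by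
    simpa using 𝒩.norm_ext_le zero_le_one γ q fun η _ => hbu η
  have hE' : ∀ γ, ‖𝒩.ext q (y - u) γ‖ ≤ 2 := fun γ => by
    simpa using 𝒩.norm_ext_le zero_le_one γ q fun η _ => hbu' η
  have hblk : ∀ u : ℕ → E, (∀ γ < p, u γ = 0) → 𝒩.Blk p q (𝒩.ext q u) := fun u hu => by
    refine ⟨fun γ hγ => ?_, 𝒩.ext_ext_of_le le_rfl u⟩
    rcases lt_or_ge γ q with h | h
    · rw [ext_of_lt _ _ h, hu γ hγ]
    · rw [𝒩.ext_congr (y := 0) γ q fun η hη => hu η (by omega), map_zero, Pi.zero_apply]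
  have hm1 : (1 : ℝ) ≤ mm n := by exact_mod_cast (by have := four_le_mm n; omega : 1 ≤ mm n)
  refine ⟨𝒩.ext q u, 𝒩.ext q (y - u), ?_, fun j => ⟨hblk u fun γ hγ => (hy0 γ hγ).1,
    fun γ => (hE γ).trans (by linarith), fun γ _ => ?_⟩,
    ⟨hblk _ fun γ hγ => (hy0 γ hγ).2, fun γ => (hE' γ).trans (by norm_num), fun γ hγ => ?_⟩⟩
  · rw [map_sub, add_sub_cancel, hy.2]
  · rcases le_or_gt (𝒩.wt γ) n with hw | hw
    · refine (hE γ).trans ?_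
      have h1 : (mm (𝒩.wt γ) : ℝ) ≤ mm n := by exact_mod_cast mm_mono hw
      have h2 := mm_pos (𝒩.wt γ)
      rw [inv_mul_eq_div, le_div_iff₀ h2]
      linarith
    · refine (norm_ext_le_of_wt hE fun ξ _ hξ => ?_).trans ?_
      · simp [hu, hξ, hw]
      · exact mul_le_mul_of_nonneg_left (by linarith) (inv_mm_nonneg _)
  · refine (norm_ext_le_of_wt hE' fun ξ _ hξ => ?_).trans (by norm_num)
    have : 𝒩.wt ξ ≤ n := by omega
    simp [hu, this]

namespace Model

variable {X : Type} [NormedAddCommGroup X] [NormedSpace ℝ X] (M : 𝒩.Model E X)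

theorem finiteDimensional_range_proj [FiniteDimensional ℝ E] (p : ℕ) :
    FiniteDimensional ℝ (LinearMap.range (M.proj p : X →ₗ[ℝ] X)) := by
  let ρ : LinearMap.range (M.proj p : X →ₗ[ℝ] X) →ₗ[ℝ] (Fin p → E) :=
    (LinearMap.pi fun γ : Fin p => LinearMap.proj (γ : ℕ) ∘ₗ M.vals) ∘ₗ Submodule.subtype _
  refine FiniteDimensional.of_injective ρ ?_
  rw [← LinearMap.ker_eq_bot, LinearMap.ker_eq_bot']
  rintro ⟨_, x, rfl⟩ hx
  have h1 : ∀ γ < p, M.vals (M.proj p x) γ = 0 := fun γ hγ => congrFun hx ⟨γ, hγ⟩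
  have h2 : M.vals (M.proj p x) = 0 := by
    have : 𝒩.ext p (M.vals (M.proj p x)) = M.vals (M.proj p x) := by
      rw [vals_proj, 𝒩.ext_ext_of_le le_rfl]
    rw [← this, ← map_zero (𝒩.ext p)]
    exact funext fun γ => 𝒩.ext_congr γ p h1
  have h3 : M.proj p x = 0 := M.vals_injective (by rw [h2, map_zero])
  exact Subtype.ext h3

/-- An operator tending to `0` on late rapid vectors is compact. -/
theorem isCompactOperator_of_small [FiniteDimensional ℝ E] [CompleteSpace X] (T : X →L[ℝ] X)
    (h : ∀ C > 0, ∀ ε > 0, ∃ n, ∀ p q j x, n ≤ p → n ≤ j → 𝒩.Rapid C p q j (M.vals x) →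
      ‖T x‖ ≤ ε) : IsCompactOperator T := by
  have hblk : ∀ ε > 0, ∃ n, ∀ p q x, n ≤ p → 𝒩.Blk p q (M.vals x) → ‖x‖ ≤ 1 → ‖T x‖ ≤ ε := by
    intro ε hε
    obtain ⟨n, hn⟩ := h 6 (by norm_num) (ε / 2) (half_pos hε)
    have hm := mm_pos n
    obtain ⟨n', hn'⟩ := h (6 * mm n) (by positivity) (ε / 2) (half_pos hε)
    refine ⟨max n n', fun p q x hp hx hx1 => ?_⟩
    obtain ⟨v, w, hvw, hv, hw⟩ := hx.exists_rapid_add (fun γ => (M.norm_vals_le x γ).trans hx1) n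
    obtain ⟨v, rfl⟩ := M.exists_vals q v (hv 0).blk.2
    obtain ⟨w, rfl⟩ := M.exists_vals q w hw.blk.2
    rw [← map_add] at hvw
    rw [M.vals_injective hvw, map_add]
    refine (norm_add_le _ _).trans ?_
    have h1 := hn p q (n + 1) w ((le_max_left _ _).trans hp) (Nat.le_succ n) hw
    have h2 := hn' p q n' v ((le_max_right _ _).trans hp) le_rfl (hv n')
    linarith
  have htail : ∀ ε > 0, ∃ n, ∀ p ≥ n, ‖T - T.comp (M.proj p)‖ ≤ ε := by
    intro ε hε
    obtain ⟨n, hn⟩ := hblk (ε / 4) (by positivity)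
    refine ⟨n, fun p hp => ContinuousLinearMap.opNorm_le_bound _ hε.le fun x => ?_⟩
    have hlim : Tendsto (fun q => ‖T (M.proj q x - M.proj p x)‖) atTop
        (𝓝 ‖(T - T.comp (M.proj p)) x‖) := by
      have : (T - T.comp (M.proj p)) x = T (x - M.proj p x) := by simp
      rw [this]
      exact ((T.continuous.tendsto _).comp ((M.tendsto_proj x).sub_const _)).norm
    refine le_of_tendsto hlim ((eventually_ge_atTop p).mono fun q hq => ?_)
    set y := M.proj q x - M.proj p x with hy
    have hy1 : ‖y‖ ≤ 4 * ‖x‖ := by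
      refine (norm_sub_le _ _).trans ?_
      linarith [M.norm_proj_le p x, M.norm_proj_le q x]
    rcases eq_or_ne x 0 with rfl | hx0
    · simp [hy]
    have hx : 0 < ‖x‖ := norm_pos_iff.2 hx0
    have h1 := hn p q ((4 * ‖x‖)⁻¹ • y) hp (by rw [map_smul]; exact (M.blk_proj_sub hq x).smul _) (by
      rw [norm_smul, norm_inv, Real.norm_of_nonneg (by positivity), inv_mul_le_iff₀ (by positivity)]
      linarith)
    rw [map_smul, norm_smul, norm_inv, Real.norm_of_nonneg (by positivity),
      inv_mul_le_iff₀ (by positivity)] at h1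
    linarith
  refine isCompactOperator_of_tendsto (l := atTop) (F := fun p => T.comp (M.proj p)) ?_
    (Eventually.of_forall fun p => ?_)
  · rw [Metric.tendsto_nhds]
    intro ε hε
    obtain ⟨n, hn⟩ := htail (ε / 2) (half_pos hε)
    filter_upwards [eventually_ge_atTop n] with p hp
    rw [dist_comm, dist_eq_norm]
    linarith [hn p hp]
  · have hc : IsCompactOperator (M.proj p) := by
      have := M.finiteDimensional_range_proj p
      let F := LinearMap.range (M.proj p : X →ₗ[ℝ] X)
      have h1 : IsCompactOperator (id : F → F) :=
        isCompactOperator_id_iff_finiteDimensional (𝕜 := ℝ) |>.2 this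
      have h2 := h1.comp_clm ((M.proj p).codRestrict F fun x => ⟨x, rfl⟩)
      exact h2.clm_comp F.subtypeL
    exact hc.clm_comp T

end Model

end NodeSystem

/-- A vector of norm at most `1` whose orbit dominates the unit vector basis of `ℓ_∞`. -/
structure Generates (e : E) : Prop where
  norm_le : ‖e‖ ≤ 1
  le_norm : ∀ (c : ℕ → ℝ), ∀ i < ord E,
    |c i| ≤ ‖∑ i ∈ Finset.range (ord E), c i • ((N : E →ₗ[ℝ] E) ^ i) e‖

namespace NodeSystem

variable {𝒩 : NodeSystem}

variable (𝒩) in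
/-- The basis vector attached to a node. -/
noncomputable def basisVec (n : ℕ) (e : E) : ℕ → E := 𝒩.ext (n + 1) (Pi.single n e)

variable (𝒩) in
theorem basisVec_self (n : ℕ) (e : E) : 𝒩.basisVec n e n = e := by
  rw [basisVec, ext_of_lt _ _ (Nat.lt_succ_self n), Pi.single_eq_same]

variable (𝒩) in
theorem blk_basisVec (n : ℕ) (e : E) : 𝒩.Blk n (n + 1) (𝒩.basisVec n e) := by
  refine ⟨fun γ hγ => ?_, 𝒩.ext_ext_of_le le_rfl _⟩
  rw [basisVec, ext_of_lt _ _ (hγ.trans (Nat.lt_succ_self n)), Pi.single_eq_of_ne hγ.ne]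

theorem rapid_basisVec {n : ℕ} (hn : 𝒩.wt n = 0) {e : E} (he : ‖e‖ ≤ 1) (j : ℕ) :
    𝒩.Rapid 8 n (n + 1) j (𝒩.basisVec n e) := by
  have h2 : ∀ γ, ‖𝒩.ext (n + 1) (Pi.single n e) γ‖ ≤ 2 := fun γ => by
    refine (𝒩.norm_ext_le zero_le_one γ _ fun η _ => ?_).trans (by norm_num)
    by_cases h : η = n
    · subst h; simpa using he
    · simp [h]
  refine ⟨𝒩.blk_basisVec n e, fun γ => (h2 γ).trans (by norm_num), fun γ _ => ?_⟩
  by_cases h : 𝒩.wt γ = 0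
  · refine (h2 γ).trans ?_
    rw [h]
    norm_num [mm]
  · refine (norm_ext_le_of_wt h2 fun ξ _ hξ => ?_).trans
      (mul_le_mul_of_nonneg_left (by norm_num) (inv_mm_nonneg _))
    rw [Pi.single_eq_of_ne]
    rintro rfl
    exact h (hξ.symm.trans hn)

variable (𝒩) in
theorem exists_wt_eq_zero (k : ℕ) : ∃ n ≥ k, 𝒩.wt n = 0 := by
  obtain ⟨γ, h, _, h', _⟩ := 𝒩.exists_even none 0 [] k Even.zero (by simp [Fn.size]) (by simp)
  exact ⟨γ, h, h'⟩

namespace Model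

variable {X : Type} [NormedAddCommGroup X] [NormedSpace ℝ X] (M : 𝒩.Model E X)

theorem poly_sub (c d : ℕ → ℝ) : M.poly (c - d) = M.poly c - M.poly d := by
  simp only [poly, Pi.sub_apply, sub_smul, Finset.sum_sub_distrib]

theorem abs_le_norm_poly {e : E} (he : Generates e) {n : ℕ} {y : X}
    (hy : M.vals y = 𝒩.basisVec n e) (c : ℕ → ℝ) {i : ℕ} (hi : i < ord E) :
    |c i| ≤ ‖M.vals (M.poly c y) n‖ := by
  rw [vals_poly, hy, basisVec_self]
  exact he.le_norm c i hi

theorem norm_coord_le (n : ℕ) (x : X) : ‖𝒩.coord n (M.vals x)‖ ≤ 3 * ‖x‖ :=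
  𝒩.norm_coord_le (M.norm_vals_le x) n

theorem exists_poly_basisVec {e : E} (he : Generates e) {y : ℕ → X}
    (hy : ∀ n, M.vals (y n) = 𝒩.basisVec n e) (T : X →L[ℝ] X) :
    ∃ c, ∀ ε > 0, ∀ k, ∃ n ≥ k, 𝒩.wt n = 0 ∧ ‖T (y n) - M.poly c (y n)‖ ≤ ε := by
  have hrapid : ∀ n, 𝒩.wt n = 0 → ∀ j, 𝒩.Rapid 8 n (n + 1) j (M.vals (y n)) := fun n hn j => by
    rw [hy]
    exact rapid_basisVec hn he.norm_le j
  have h1 : ∀ l : ℕ, ∃ n ≥ l, 𝒩.wt n = 0 ∧ ∃ c, ‖T (y n) - M.poly c (y n)‖ ≤ 1 / ((l : ℝ) + 1) := by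
    intro l
    obtain ⟨k, hk⟩ := M.exists_poly (C := 8) (by norm_num) T (ε := 1 / ((l : ℝ) + 1))
      (by positivity)
    obtain ⟨n, hn, hn0⟩ := 𝒩.exists_wt_eq_zero (max k l)
    exact ⟨n, (le_max_right _ _).trans hn, hn0, hk n (n + 1) k (y n) ((le_max_left _ _).trans hn)
      le_rfl (hrapid n hn0 k)⟩
  choose n hnl hn0 c hc using h1
  let d : ℕ → Fin (ord E) → ℝ := fun l i => c l i
  have hbdd : ∀ l, d l ∈ Metric.closedBall (0 : Fin (ord E) → ℝ) (‖T‖ * 8 + 1) := by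
    intro l
    rw [mem_closedBall_zero_iff, pi_norm_le_iff_of_nonneg (by positivity)]
    intro i
    rw [Real.norm_eq_abs]
    refine (M.abs_le_norm_poly he (hy (n l)) (c l) i.2).trans ((M.norm_vals_le _ _).trans ?_)
    have h2 := norm_sub_norm_le (M.poly (c l) (y (n l))) (T (y (n l)))
    rw [norm_sub_rev] at h2
    have h3 : ‖T (y (n l))‖ ≤ ‖T‖ * 8 := (T.le_opNorm _).trans
      (mul_le_mul_of_nonneg_left (M.norm_le_of_rapid (hrapid _ (hn0 l) 0)) (norm_nonneg _))
    have h4 := hc l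
    have h5 : 1 / ((l : ℝ) + 1) ≤ 1 := by
      rw [div_le_one (by positivity)]
      linarith [(Nat.cast_nonneg l : (0 : ℝ) ≤ l)]
    linarith
  obtain ⟨a, -, φ, hφ, hlim⟩ := tendsto_subseq_of_bounded Metric.isBounded_closedBall hbdd
  let a' : ℕ → ℝ := fun i => if h : i < ord E then a ⟨i, h⟩ else 0
  refine ⟨a', fun ε hε k => ?_⟩
  have hη : 0 < ε / (2 * (ord E * 8 + 1)) := by positivity
  obtain ⟨l, hl, hlk, hlε⟩ := ((Metric.tendsto_nhds.1 hlim _ hη).and ((eventually_ge_atTop k).and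
    ((Metric.tendsto_nhds.1 (tendsto_one_div_add_atTop_nhds_zero_nat (𝕜 := ℝ)) (ε / 2)
      (half_pos hε))))).exists
  refine ⟨n (φ l), (hlk.trans hφ.le_apply).trans (hnl _), hn0 _, ?_⟩
  have h2 := hc (φ l)
  have h3 : ∀ i < ord E, |(c (φ l) - a') i| ≤ ε / (2 * (ord E * 8 + 1)) := by
    intro i hi
    have := (dist_le_pi_dist (d (φ l)) a ⟨i, hi⟩).trans hl.le
    rw [Real.dist_eq] at this
    simpa [a', hi, d] using this
  have h4 := M.norm_poly_le h3 (y (n (φ l)))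
  have h5 := M.norm_le_of_rapid (hrapid _ (hn0 (φ l)) 0)
  have h6 : 1 / ((φ l : ℝ) + 1) ≤ ε / 2 := by
    refine le_trans ?_ ((abs_lt.1 (by simpa [Real.dist_eq] using hlε)).2.le :
      ((l : ℝ) + 1)⁻¹ ≤ ε / 2)
    rw [one_div]
    have : (l : ℝ) ≤ φ l := by exact_mod_cast hφ.le_apply
    exact inv_anti₀ (by positivity) (by linarith)
  have h7 : ord E * (ε / (2 * (ord E * 8 + 1))) * ‖y (n (φ l))‖ ≤ ε / 2 := by
    refine (mul_le_mul_of_nonneg_left h5 (by positivity)).trans ?_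
    rw [mul_div_assoc', div_mul_eq_mul_div, div_le_iff₀ (by positivity)]
    nlinarith
  have h8 : T (y (n (φ l))) - M.poly a' (y (n (φ l))) =
      (T (y (n (φ l))) - M.poly (c (φ l)) (y (n (φ l)))) + M.poly (c (φ l) - a') (y (n (φ l))) := by
    rw [poly_sub, sub_apply]
    abel
  rw [h8]
  refine (norm_add_le _ _).trans ?_
  linarith

theorem exists_basis (e : E) : ∃ y : ℕ → X, ∀ n, M.vals (y n) = 𝒩.basisVec n e :=
  Classical.axiomOfChoice fun n => M.exists_vals (n + 1) _ (𝒩.blk_basisVec n e).2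

/-- Every operator is a polynomial in the shift modulo the compact operators. -/
theorem exists_poly_compact [FiniteDimensional ℝ E] [CompleteSpace X] {e : E} (he : Generates e)
    (T : X →L[ℝ] X) : ∃ c, IsCompactOperator (T - M.poly c) := by
  obtain ⟨y, hy⟩ := M.exists_basis e
  obtain ⟨c, hc⟩ := M.exists_poly_basisVec he hy T
  refine ⟨c, M.isCompactOperator_of_small _ fun C hC ε hε => ?_⟩
  set T' := T - M.poly c with hT'
  set η : ℝ := ε / (2 + ord E * 9 * (C + 8)) with hη_def
  have hη : 0 < η := by positivity
  obtain ⟨k, hk⟩ := M.exists_poly (C := C + 8) (by positivity) T' hη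
  refine ⟨k, fun p q j x hp hj hx => ?_⟩
  have hcoord : ∃ n₀ ≥ max p q, ∀ n ≥ n₀, ‖𝒩.coord n (M.vals (T' x))‖ ≤ 3 * η := by
    obtain ⟨n₀, h1, h2⟩ := ((Metric.tendsto_nhds.1 (M.tendsto_proj (T' x)) η hη).and
      (eventually_ge_atTop (max p q))).exists
    refine ⟨n₀, h2, fun n hn => ?_⟩
    have h3 : 𝒩.coord n (M.vals (T' x)) =
        𝒩.coord n (M.vals (T' x - M.proj n₀ (T' x))) := by
      have h4 : 𝒩.Blk 0 n₀ (𝒩.ext n₀ (M.vals (T' x))) :=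
        ⟨fun γ hγ => absurd hγ (Nat.not_lt_zero γ), 𝒩.ext_ext_of_le le_rfl _⟩
      rw [map_sub, map_sub, vals_proj, h4.coord_of_ge hn, sub_zero]
    rw [h3]
    refine (M.norm_coord_le _ _).trans (mul_le_mul_of_nonneg_left ?_ (by norm_num))
    rw [dist_comm, dist_eq_norm] at h1
    exact h1.le
  obtain ⟨n₀, hn₀, hn₀'⟩ := hcoord
  obtain ⟨n, hn, hw, hyn⟩ := hc η hη n₀
  have hpn : p ≤ n := ((le_max_left _ _).trans hn₀).trans hn
  have hqn : q ≤ n := ((le_max_right _ _).trans hn₀).trans hn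
  have hyr : 𝒩.Rapid 8 n (n + 1) j (M.vals (y n)) := by
    rw [hy]
    exact rapid_basisVec hw he.norm_le j
  have hsum : 𝒩.Rapid (C + 8) p (n + 1) j (M.vals (x + y n)) := by
    rw [map_add]
    exact (hx.mono le_rfl le_rfl (by omega) le_rfl).add (hyr.mono le_rfl hpn le_rfl le_rfl)
  obtain ⟨μ, hμ⟩ := hk p (n + 1) j _ hp hj hsum
  have hTy : ‖T' (y n)‖ ≤ η := by rwa [hT', sub_apply]
  have hz : ‖T' x - M.poly μ x - M.poly μ (y n)‖ ≤ 2 * η := by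
    have : T' x - M.poly μ x - M.poly μ (y n) =
        T' (x + y n) - M.poly μ (x + y n) - T' (y n) := by
      rw [map_add, map_add]
      abel
    rw [this]
    exact (norm_sub_le _ _).trans (by linarith)
  have hμi : ∀ i < ord E, |μ i| ≤ 9 * η := by
    intro i hi
    have h1 := M.norm_coord_le n (T' x - M.poly μ x - M.poly μ (y n))
    have h2 : 𝒩.coord n (M.vals (M.poly μ x)) = 0 := (M.blk_poly hx.blk μ).coord_of_ge hqn
    have h3 : 𝒩.coord n (M.vals (M.poly μ (y n))) = M.vals (M.poly μ (y n)) n := by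
      rw [coord_apply, (M.blk_poly hyr.blk μ).ext_of_le le_rfl]
      simp
    rw [map_sub, map_sub, map_sub, map_sub, h2, h3, sub_zero] at h1
    have h4 := M.abs_le_norm_poly he (hy n) μ hi
    have h5 := hn₀' n hn
    have h6 := norm_sub_norm_le (M.vals (M.poly μ (y n)) n) (𝒩.coord n (M.vals (T' x)))
    rw [norm_sub_rev] at h6
    linarith
  have h1 : ‖M.poly μ x‖ ≤ ord E * (9 * η) * C := (M.norm_poly_le hμi x).trans
    (mul_le_mul_of_nonneg_left (M.norm_le_of_rapid hx) (by positivity))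
  have h2 : ‖M.poly μ (y n)‖ ≤ ord E * (9 * η) * 8 := (M.norm_poly_le hμi _).trans
    (mul_le_mul_of_nonneg_left (M.norm_le_of_rapid hyr) (by positivity))
  have h3 : η * (2 + ord E * 9 * (C + 8)) = ε := div_mul_cancel₀ _ (by positivity)
  have h4 : T' x = (T' x - M.poly μ x - M.poly μ (y n)) + (M.poly μ x + M.poly μ (y n)) := by abel
  rw [h4]
  refine (norm_add_le _ _).trans ?_
  have h5 := norm_add_le (M.poly μ x) (M.poly μ (y n))
  linarith

/-- A polynomial in the shift is compact only if it is trivial. -/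
theorem eq_zero_of_isCompactOperator_poly {e : E} (he : Generates e) {c : ℕ → ℝ}
    (h : IsCompactOperator (M.poly c)) : ∀ i < ord E, c i = 0 := by
  intro i hi
  obtain ⟨y, hy⟩ := M.exists_basis e
  have hyb : ∀ n, ‖y n‖ ≤ 2 := fun n => by
    refine (M.norm_le_of_lt (p := n) (q := n + 1) (C := 1) ?_ zero_le_one fun γ hγ => ?_).trans
      (by norm_num)
    · rw [hy]
      exact 𝒩.blk_basisVec n e
    · rw [hy]
      rcases Nat.lt_succ_iff_lt_or_eq.1 hγ with h | rfl
      · rw [(𝒩.blk_basisVec n e).1 γ h, norm_zero]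
        exact zero_le_one
      · rw [basisVec_self]
        exact he.norm_le
  obtain ⟨K, hK, hKs⟩ := IsCompactOperator.image_closedBall_subset_compact (𝕜₁ := ℝ)
    (f := (M.poly c : X →ₗ[ℝ] X)) h 2
  obtain ⟨a, -, φ, hφ, hlim⟩ := hK.tendsto_subseq (x := fun n => M.poly c (y n)) fun n =>
    hKs ⟨y n, by simpa using hyb n, rfl⟩
  by_contra hci
  have hpos : 0 < |c i| := abs_pos.2 hci
  obtain ⟨k, hk⟩ := Metric.cauchySeq_iff.1 hlim.cauchySeq _ hpos
  have h1 := hk k le_rfl (k + 1) (Nat.le_succ k)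
  rw [dist_eq_norm] at h1
  have h2 := M.norm_vals_le (M.poly c (y (φ k)) - M.poly c (y (φ (k + 1)))) (φ k)
  have h3 : M.vals (M.poly c (y (φ (k + 1)))) (φ k) = 0 := by
    refine (M.blk_poly (p := φ (k + 1)) (q := φ (k + 1) + 1) ?_ c).1 _ (hφ (Nat.lt_succ_self k))
    rw [hy]
    exact 𝒩.blk_basisVec _ e
  rw [map_sub, Pi.sub_apply, h3, sub_zero] at h2
  have h4 := M.abs_le_norm_poly he (hy (φ k)) c hi
  exact absurd h1 (not_lt.2 (h4.trans h2))

end Model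

end NodeSystem

namespace NodeSystem

variable {𝒩 : NodeSystem}

theorem sum_Ico_mul {X : Type} [AddCommMonoid X] (f : ℕ → X) (c m n : ℕ) :
    ∑ s ∈ Finset.Ico (c * m) ((c + n) * m), f s =
      ∑ i ∈ Finset.range n, ∑ s ∈ Finset.Ico ((c + i) * m) ((c + i + 1) * m), f s := by
  induction n with
  | zero => simp
  | succ n ih =>
    rw [Finset.sum_range_succ, ← ih, ← add_assoc, Finset.sum_Ico_consecutive]
    · exact Nat.mul_le_mul_right _ (by omega)
    · exact Nat.mul_le_mul_right _ (by omega)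

/-- A long average of successive normalized vectors is rapid. -/
theorem rapid_average {j : ℕ} {P Q : ℕ → ℕ} {x : ℕ → ℕ → E}
    (S : 𝒩.Successive (nn j) P Q x) (hx : ∀ k < nn j, ∀ γ, ‖x k γ‖ ≤ 1) {p q : ℕ}
    (hp : ∀ k < nn j, p ≤ P k) (hq : ∀ k < nn j, Q k ≤ q) :
    𝒩.Rapid 8 p q j ((nn j : ℝ)⁻¹ • ∑ k ∈ Finset.range (nn j), x k) := by
  set n : ℝ := ((nn j : ℕ) : ℝ) with hn_def
  have hn0 : 0 < n := lt_of_lt_of_le one_pos (one_le_nn_real j)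
  have hle : ∀ η a b, a ≤ b → b ≤ nn j →
      ‖(∑ k ∈ Finset.Ico a b, x k) η‖ ≤ 1 * ((b : ℝ) - a) + 0 := by
    intro η a b hab hb
    rw [Finset.sum_apply]
    refine (norm_sum_le_of_le (n := fun _ => (1 : ℝ)) _ fun k hk =>
      hx k ((Finset.mem_Ico.1 hk).2.trans_le hb) η).trans (le_of_eq ?_)
    rw [Finset.sum_const, Nat.card_Ico, nsmul_eq_mul, Nat.cast_sub hab]
    ring
  refine ⟨?_, fun γ => ?_, fun γ hγ => ?_⟩
  · exact (Blk.sum fun k hk => (S.blk k (Finset.mem_range.1 hk)).mono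
      (hp k (Finset.mem_range.1 hk)) (hq k (Finset.mem_range.1 hk))).smul _
  · have h1 := hle γ 0 (nn j) (Nat.zero_le _) le_rfl
    rw [← Finset.range_eq_Ico] at h1
    rw [Pi.smul_apply, norm_smul, norm_inv, Real.norm_of_nonneg hn0.le, inv_mul_le_iff₀ hn0]
    push_cast at h1
    linarith
  · have h1 := S.norm_sum_le_age zero_le_one zero_le_one le_rfl hx hle γ 0 (nn j) (Nat.zero_le _)
      le_rfl
    rw [← Finset.range_eq_Ico] at h1
    have hm := mm_pos (𝒩.wt γ)
    have h2 : (𝒩.age γ : ℝ) ≤ nn (𝒩.wt γ) := by exact_mod_cast 𝒩.age_le γ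
    have h3 : (mm (𝒩.wt γ) : ℝ) * nn (𝒩.wt γ) ≤ (nn j : ℕ) := by
      exact_mod_cast mm_mul_nn_le hγ
    rw [Pi.smul_apply, norm_smul, norm_inv, Real.norm_of_nonneg hn0.le, inv_mul_le_iff₀ hn0]
    have h4 : (𝒩.age γ : ℝ) ≤ (mm (𝒩.wt γ) : ℝ)⁻¹ * n := by
      rw [← div_eq_inv_mul, le_div_iff₀ hm]
      nlinarith
    push_cast at h1
    linarith

namespace Model

variable {X : Type} [NormedAddCommGroup X] [NormedSpace ℝ X] (M : 𝒩.Model E X)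

/-- A functional carried by the support of a block norms it up to a constant. -/
theorem exists_fn_lt_top {p q : ℕ} {x : X} (hx : 𝒩.Blk p q (M.vals x)) (h : 1 / 2 ≤ ‖x‖) :
    ∃ b : Fn, b.size ≤ 1 ∧ (∀ a ∈ b, a.1 < q) ∧ 1 / 5 ≤ top (b.ev (M.vals x)) := by
  have h1 : ∃ γ < q, 1 / 5 ≤ ‖M.vals x γ‖ := by
    by_contra! hlt
    have := M.norm_le_of_lt hx (C := 1 / 5) (by norm_num) fun γ hγ => (hlt γ hγ).le
    linarith
  obtain ⟨γ, hγ, h2⟩ := h1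
  obtain ⟨i, hi⟩ := exists_top (M.vals x γ)
  rcases le_total 0 (top (((N : E →ₗ[ℝ] E) ^ i) (M.vals x γ))) with h3 | h3
  · refine ⟨[(γ, i, 1)], by simp [Fn.size], by simpa using hγ, ?_⟩
    rw [abs_of_nonneg h3] at hi
    simpa using h2.trans hi
  · refine ⟨[(γ, i, -1)], by simp [Fn.size], by simpa using hγ, ?_⟩
    rw [abs_of_nonpos h3] at hi
    simpa using h2.trans hi

/-- Block sequences have arbitrarily late rapid combinations of norm at least `1 / 2`. -/
theorem exists_rapid_combination {w : ℕ → X} {P Q : ℕ → ℕ} (hP : Tendsto P atTop atTop)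
    (hPQ : ∀ r, P r ≤ Q r) (hQP : ∀ r s, r < s → Q r ≤ P s)
    (hw : ∀ r, 𝒩.Blk (P r) (Q r) (M.vals (w r))) (h1 : ∀ r, ‖w r‖ ≤ 1)
    (h2 : ∀ r, 1 / 2 ≤ ‖w r‖) {j : ℕ} (hj : Even (j + 1)) (L : ℕ) :
    ∃ (F : Finset ℕ) (κ : ℝ) (r q : ℕ), L ≤ r ∧ (∀ s ∈ F, r ≤ s) ∧ 0 ≤ κ ∧ κ ≤ 1 ∧
      1 / 2 < ‖κ • ∑ s ∈ F, w s‖ ∧ 𝒩.Rapid 8 (P r) q j (M.vals (κ • ∑ s ∈ F, w s)) := by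
  by_contra! hcon
  choose b hb1 hb2 hb3 using fun r => M.exists_fn_lt_top (hw r) (h2 r)
  obtain ⟨e, he, hme⟩ := exists_pow_growth j
  set n := nn j with hn_def
  have hn1 : 1 ≤ n := one_le_nn j
  have hn2 : 2 ≤ n := by
    have h3 := mm_sq_le_nn j
    have h4 := four_le_mm j
    nlinarith
  have hN0 : 0 < n ^ e := by positivity
  obtain ⟨l, g, hch, hL, hl⟩ := 𝒩.exists_even_chain hj hP hb1 hb2 L hN0 he
  have hle : ∀ s t, s ≤ t → t < n ^ e → l s ≤ l t := fun s t hst ht => by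
    rcases hst.eq_or_lt with rfl | h
    exacts [le_rfl, (hl s t h ht).le]
  have hPP : ∀ s t, s ≤ t → t < n ^ e → P (l s) ≤ P (l t) := fun s t hst ht => by
    rcases hst.eq_or_lt with rfl | h
    exacts [le_rfl, (hPQ _).trans (hQP _ _ (hl s t h ht))]
  have hQQ : ∀ s t, s ≤ t → t < n ^ e → Q (l s) ≤ Q (l t) := fun s t hst ht => by
    rcases hst.eq_or_lt with rfl | h
    exacts [le_rfl, (hQP _ _ (hl s t h ht)).trans (hPQ _)]
  have hlow : (mm (j + 1) : ℝ)⁻¹ * ((n : ℝ) ^ e * (1 / 5)) ≤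
      ‖∑ s ∈ Finset.range (n ^ e), w (l s)‖ := by
    have h3 := hch.apply_sum (y := fun s => M.vals (w (l s))) (fun s _ => hw _) (n ^ e - 1)
      (by omega)
    rw [Nat.sub_add_cancel hN0] at h3
    refine le_trans ?_ (M.norm_vals_le _ (g (n ^ e - 1)))
    rw [map_sum, h3]
    refine le_trans ?_ ((le_abs_self _).trans (abs_top_le _))
    rw [map_smul, smul_eq_mul, map_sum]
    refine mul_le_mul_of_nonneg_left ?_ (inv_mm_nonneg _)
    refine le_trans (le_of_eq ?_) (Finset.card_nsmul_le_sum _ _ (1 / 5 : ℝ) fun s _ => hb3 (l s))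
    rw [Finset.card_range, nsmul_eq_mul]
    push_cast
    ring
  have hup : ∀ t ≤ e, ∀ r, (r + 1) * n ^ t ≤ n ^ e →
      ‖(2 / n : ℝ) ^ t • ∑ s ∈ Finset.Ico (r * n ^ t) ((r + 1) * n ^ t), w (l s)‖ ≤ 1 := by
    intro t
    induction t with
    | zero => intro _ r _; simpa using h1 (l r)
    | succ t ih =>
      intro ht r hr
      have hsplit : ∑ s ∈ Finset.Ico (r * n ^ (t + 1)) ((r + 1) * n ^ (t + 1)), w (l s) =
          ∑ i ∈ Finset.range n, ∑ s ∈ Finset.Ico ((r * n + i) * n ^ t) ((r * n + i + 1) * n ^ t),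
            w (l s) := by
        rw [← sum_Ico_mul, ← Nat.succ_mul, pow_succ', ← mul_assoc, ← mul_assoc]
      have hlt : ∀ i < n, (r * n + i + 1) * n ^ t ≤ (r + 1) * n ^ (t + 1) := fun i hi => by
        rw [pow_succ', ← mul_assoc]
        exact Nat.mul_le_mul_right _ (by nlinarith)
      have hnt : 0 < n ^ t := by positivity
      have hne : ∀ i, i * n ^ t < (i + 1) * n ^ t := fun i => by nlinarith
      have hpow : ((n : ℝ)⁻¹ * (2 / n) ^ t) ≤ 1 := by
        refine mul_le_one₀ (inv_le_one_of_one_le₀ (by exact_mod_cast hn1)) (by positivity)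
          (pow_le_one₀ (by positivity) ?_)
        rw [div_le_one (by positivity)]
        exact_mod_cast hn2
      have hnn : r * n ^ (t + 1) = r * n * n ^ t := by rw [pow_succ', mul_assoc]
      have hlast : (r + 1) * n ^ (t + 1) - 1 < n ^ e := by omega
      have hfirst : r * n ^ (t + 1) < n ^ e := by
        have := hne (r * n)
        have := hlt 0 (by omega)
        rw [add_zero] at this
        omega
      have hsum : ∑ s ∈ (Finset.Ico (r * n ^ (t + 1)) ((r + 1) * n ^ (t + 1))).image l, w s =
          ∑ s ∈ Finset.Ico (r * n ^ (t + 1)) ((r + 1) * n ^ (t + 1)), w (l s) := by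
        refine Finset.sum_image fun s hs s' hs' h => ?_
        rw [Finset.mem_coe, Finset.mem_Ico] at hs hs'
        rcases lt_trichotomy s s' with h' | h' | h'
        · exact absurd h (hl s s' h' (by omega)).ne
        · exact h'
        · exact absurd h.symm (hl s' s h' (by omega)).ne
      have hrapid : 𝒩.Rapid 8 (P (l (r * n ^ (t + 1)))) (Q (l ((r + 1) * n ^ (t + 1) - 1))) j
          (M.vals (((n : ℝ)⁻¹ * (2 / n) ^ t) •
            ∑ s ∈ (Finset.Ico (r * n ^ (t + 1)) ((r + 1) * n ^ (t + 1))).image l, w s)) := by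
        rw [hsum, hsplit, mul_smul, Finset.smul_sum, map_smul, map_sum]
        refine rapid_average (P := fun i => P (l ((r * n + i) * n ^ t)))
          (Q := fun i => Q (l ((r * n + i + 1) * n ^ t - 1))) ⟨fun i hi => ?_, fun i i' hii hi => ?_⟩
          (fun i hi γ => ?_) (fun i hi => ?_) fun i hi => ?_
        · have h3 := hlt i hi
          have h4 := hne (r * n + i)
          rw [map_smul, map_sum]
          refine (Blk.sum fun s hs => (hw (l s)).mono (hPP _ _ ?_ ?_) (hQQ _ _ ?_ ?_)).smul _ <;>
            rw [Finset.mem_Ico] at hs <;> omega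
        · have h3 := hlt i' hi
          have h4 := hne (r * n + i')
          have h5 := hne (r * n + i)
          have h6 : (r * n + i + 1) * n ^ t ≤ (r * n + i') * n ^ t :=
            Nat.mul_le_mul_right _ (by omega)
          exact hQP _ _ (hl _ _ (by omega) (by omega))
        · exact (M.norm_vals_le _ γ).trans (ih (by omega) _ ((hlt i hi).trans hr))
        · have h3 := hlt i hi
          have h4 := hne (r * n + i)
          have h6 : r * n * n ^ t ≤ (r * n + i) * n ^ t := Nat.mul_le_mul_right _ (by omega)
          exact hPP _ _ (by omega) (by omega)
        · have h3 := hlt i hi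
          exact hQQ _ _ (by omega) (by omega)
      have hkey : ‖((n : ℝ)⁻¹ * (2 / n) ^ t) •
          ∑ s ∈ (Finset.Ico (r * n ^ (t + 1)) ((r + 1) * n ^ (t + 1))).image l, w s‖ ≤ 1 / 2 := by
        by_contra! hlt'
        refine hcon _ _ (l (r * n ^ (t + 1))) _ (hL _ hfirst) (fun s hs => ?_) (by positivity) hpow
          hlt' hrapid
        obtain ⟨s', hs', rfl⟩ := Finset.mem_image.1 hs
        rw [Finset.mem_Ico] at hs'
        exact hle _ _ hs'.1 (by omega)
      have h3 : (2 / n : ℝ) ^ (t + 1) = 2 * ((n : ℝ)⁻¹ * (2 / n) ^ t) := by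
        rw [pow_succ]
        ring
      rw [h3, mul_smul, ← hsum, norm_smul]
      norm_num
      linarith
  have h3 := hup e le_rfl 0 (by simp)
  rw [zero_mul, zero_add, one_mul, ← Finset.range_eq_Ico, norm_smul,
    Real.norm_of_nonneg (by positivity)] at h3
  have h4 := (mul_le_mul_of_nonneg_left hlow (by positivity : 0 ≤ (2 / n : ℝ) ^ e)).trans h3
  have hn0 : (0 : ℝ) < n := by exact_mod_cast hn1
  have hm := mm_pos (j + 1)
  have h5 : (2 / n : ℝ) ^ e * ((mm (j + 1) : ℝ)⁻¹ * ((n : ℝ) ^ e * (1 / 5))) =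
      2 ^ e / (5 * mm (j + 1)) := by
    rw [div_pow]
    field_simp
  rw [h5, div_le_one (by positivity)] at h4
  have h6 : (mm (j + 1) : ℝ) ^ 2 ≤ 2 ^ e := by exact_mod_cast hme
  have h7 : (6 : ℝ) ≤ mm (j + 1) := by
    have h8 := lt_mm (j + 1)
    have h9 := mm_sq j
    have h10 := four_le_mm j
    have : 6 ≤ mm (j + 1) := by nlinarith
    exact_mod_cast this
  nlinarith

end Model

end NodeSystem

theorem Fn.norm_ev_le_max {b : Fn} (hb : b.size ≤ 1) {x : ℕ → E} {C : ℝ} (hC : 0 ≤ C)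
    (hx : ∀ γ, ‖N (x γ)‖ ≤ C) (h : |top (b.ev x)| ≤ C) : ‖b.ev x‖ ≤ C := by
  obtain ⟨i, hi⟩ := exists_top (b.ev x)
  rcases i with _ | i
  · exact hi.trans h
  · refine hi.trans ((abs_top_le _).trans ?_)
    rw [pow_succ, Module.End.mul_apply]
    refine (norm_pow_le _ _).trans ?_
    have h1 := Fn.ev_pow b x 1
    rw [pow_one] at h1
    rw [← h1]
    exact Fn.norm_ev_le hb hC fun a _ => hx a.1

namespace NodeSystem

variable {𝒩 : NodeSystem}

namespace Model

variable {X : Type} [NormedAddCommGroup X] [NormedSpace ℝ X] (M : 𝒩.Model E X)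

theorem exists_mem_blk [FiniteDimensional ℝ E] {Y : Submodule ℝ X} (hY : ¬FiniteDimensional ℝ Y)
    {A : X →L[ℝ] X} (hA : ∀ Z ≤ Y, ¬FiniteDimensional ℝ Z → ∀ c > 0, ∃ z ∈ Z, ‖A z‖ < c * ‖z‖)
    (p : ℕ) {ε : ℝ} (hε : 0 < ε) (hε' : ε ≤ 1 / 4) : ∃ z ∈ Y, ∃ (q : ℕ) (w : X), p ≤ q ∧
      𝒩.Blk p q (M.vals w) ∧ ‖w - z‖ ≤ ε ∧ 1 / 2 ≤ ‖w‖ ∧ ‖w‖ ≤ 1 ∧ ‖A z‖ ≤ ε := by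
  have hZ : ¬FiniteDimensional ℝ (Y ⊓ (M.proj p : X →ₗ[ℝ] X).ker : Submodule ℝ X) := by
    intro hfd
    refine hY ?_
    have := M.finiteDimensional_range_proj p
    let g : Y →ₗ[ℝ] LinearMap.range (M.proj p : X →ₗ[ℝ] X) :=
      ((M.proj p : X →ₗ[ℝ] X).rangeRestrict).domRestrict Y
    let ι : LinearMap.ker g →ₗ[ℝ] (Y ⊓ (M.proj p : X →ₗ[ℝ] X).ker : Submodule ℝ X) :=
      (Y.subtype ∘ₗ (LinearMap.ker g).subtype).codRestrict _ fun y =>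
        ⟨y.1.2, congrArg Subtype.val (LinearMap.mem_ker.1 y.2)⟩
    have h1 : FiniteDimensional ℝ (LinearMap.ker g) := FiniteDimensional.of_injective ι
      fun y y' h => by
        have h' : (ι y : X) = ι y' := congrArg Subtype.val h
        exact Subtype.ext (Subtype.ext h')
    have h2 : FiniteDimensional ℝ (Y ⧸ LinearMap.ker g) :=
      FiniteDimensional.of_injective g.quotKerEquivRange.toLinearMap g.quotKerEquivRange.injective
    exact Module.Finite.of_submodule_quotient (LinearMap.ker g)
  obtain ⟨z', hz', hAz⟩ := hA _ inf_le_left hZ ε hε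
  have hz0 : 0 < ‖z'‖ := by
    by_contra h
    have h1 : ‖z'‖ = 0 := le_antisymm (not_lt.1 h) (norm_nonneg _)
    rw [h1, mul_zero] at hAz
    exact absurd hAz (not_lt.2 (norm_nonneg _))
  set z := (3 / 4 / ‖z'‖) • z' with hz_def
  have hzn : ‖z‖ = 3 / 4 := by
    rw [hz_def, norm_smul, Real.norm_of_nonneg (by positivity)]
    field_simp
  have hpz : M.proj p z = 0 := by
    have : M.proj p z' = 0 := hz'.2
    rw [hz_def, map_smul, this, smul_zero]
  obtain ⟨q, hq, hpq⟩ := ((Metric.tendsto_nhds.1 (M.tendsto_proj z) ε hε).and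
    (eventually_ge_atTop p)).exists
  rw [dist_eq_norm] at hq
  have hb := M.blk_proj_sub hpq z
  rw [hpz, sub_zero] at hb
  have h1 := abs_le.1 ((abs_norm_sub_norm_le (M.proj q z) z).trans hq.le)
  refine ⟨z, Y.smul_mem _ hz'.1, q, M.proj q z, hpq, hb, hq.le, by linarith, by linarith, ?_⟩
  rw [hz_def, map_smul, norm_smul, Real.norm_of_nonneg (by positivity), div_mul_eq_mul_div,
    div_le_iff₀ hz0]
  nlinarith

theorem exists_block_sequence [FiniteDimensional ℝ E] {Y : Submodule ℝ X}
    (hY : ¬FiniteDimensional ℝ Y) {A : X →L[ℝ] X}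
    (hA : ∀ Z ≤ Y, ¬FiniteDimensional ℝ Z → ∀ c > 0, ∃ z ∈ Z, ‖A z‖ < c * ‖z‖) :
    ∃ (w z : ℕ → X) (P Q : ℕ → ℕ), Tendsto P atTop atTop ∧ (∀ r, P r ≤ Q r) ∧
      (∀ r s, r < s → Q r ≤ P s) ∧ (∀ r, 𝒩.Blk (P r) (Q r) (M.vals (w r))) ∧
      (∀ r, ‖w r‖ ≤ 1) ∧ (∀ r, 1 / 2 ≤ ‖w r‖) ∧ (∀ r, z r ∈ Y) ∧
      (∀ r, ‖w r - z r‖ ≤ (1 / 2 : ℝ) ^ (r + 2)) ∧ ∀ r, ‖A (z r)‖ ≤ (1 / 2 : ℝ) ^ (r + 2) := by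
  choose z hz q w hq h1 h2 h3 h4 h5 using fun (r p : ℕ) => M.exists_mem_blk hY hA p
    (ε := (1 / 2 : ℝ) ^ (r + 2)) (by positivity) (by
      rw [pow_add]
      have : (1 / 2 : ℝ) ^ r ≤ 1 := pow_le_one₀ (by norm_num) (by norm_num)
      linarith)
  let P : ℕ → ℕ := fun r => Nat.rec 0 (fun r p => q r p + 1) r
  have hP : ∀ r, P (r + 1) = q r (P r) + 1 := fun r => rfl
  have hmono : StrictMono P := strictMono_nat_of_lt_succ fun r => by
    rw [hP]
    exact Nat.lt_succ_of_le (hq r _)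
  refine ⟨fun r => w r (P r), fun r => z r (P r), P, fun r => q r (P r), hmono.tendsto_atTop,
    fun r => hq r _, fun r s hrs => ?_, fun r => h1 r _, fun r => h4 r _, fun r => h3 r _,
    fun r => hz r _, fun r => h2 r _, fun r => h5 r _⟩
  refine le_trans ?_ (hmono.monotone (Nat.succ_le_of_lt hrs))
  rw [hP]
  exact Nat.le_succ _

theorem not_bounded_below [FiniteDimensional ℝ E] {Y : Submodule ℝ X}
    (hY : ¬FiniteDimensional ℝ Y) {i : ℕ} {c : ℝ} (hc : 0 < c)
    (hYc : ∀ y ∈ Y, c * ‖y‖ ≤ ‖(M.shift ^ (i + 1)) y‖)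
    (hA : ∀ Z ≤ Y, ¬FiniteDimensional ℝ Z → ∀ c > 0, ∃ z ∈ Z,
      ‖(M.shift ^ (i + 2)) z‖ < c * ‖z‖) : False := by
  obtain ⟨w, z, P, Q, hP, hPQ, hQP, hw, h1, h2, hz, hwz, hAz⟩ := M.exists_block_sequence hY hA
  have hgeom : ∀ (F : Finset ℕ) (L : ℕ), (∀ s ∈ F, L ≤ s) →
      ∑ s ∈ F, (1 / 2 : ℝ) ^ (s + 2) ≤ (1 / 2) ^ (L + 1) := by
    intro F L hF
    have hinj : Set.InjOn (fun s => s - L) (F : Set ℕ) := fun s hs s' hs' h => by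
      have := hF s hs
      have := hF s' hs'
      dsimp only at h
      omega
    have h3 : ∀ s ∈ F, (1 / 2 : ℝ) ^ (s + 2) = (1 / 2) ^ (L + 2) * (1 / 2) ^ (s - L) :=
      fun s hs => by
        rw [← pow_add]
        congr 1
        have := hF s hs
        omega
    rw [Finset.sum_congr rfl h3, ← Finset.mul_sum,
      ← Finset.sum_image (f := fun l => (1 / 2 : ℝ) ^ l) hinj]
    refine (mul_le_mul_of_nonneg_left (summable_geometric_two.sum_le_tsum _ fun _ _ => by positivity)
      (by positivity)).trans (le_of_eq ?_)
    rw [tsum_geometric_two, pow_succ _ (L + 1)]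
    ring
  set G : Submodule ℝ (X × X) := Y.map
    (((M.shift ^ (i + 1) : X →L[ℝ] X) : X →ₗ[ℝ] X).prod ((M.shift ^ i : X →L[ℝ] X) : X →ₗ[ℝ] X))
    with hG
  refine M.not_separated (C := 8) (δ := c / 32) (K := c⁻¹) (by norm_num)
    (by positivity) G ?_ fun n => ?_
  · rintro _ ⟨y, hy, rfl⟩
    have h3 := hYc y hy
    have h4 := M.norm_shift_pow_le i y
    change ‖(M.shift ^ i) y‖ ≤ c⁻¹ * ‖(M.shift ^ (i + 1)) y‖
    rw [← div_eq_inv_mul, le_div_iff₀ hc]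
    nlinarith
  · obtain ⟨n', hn', hεn⟩ : ∃ n' ≥ n, (1 / 2 : ℝ) ^ n' ≤
        min (c ^ 2 / 1000) (min (c / 64) (1 / 16)) := by
      obtain ⟨m, hm⟩ := exists_pow_lt_of_lt_one
        (by positivity : 0 < min (c ^ 2 / 1000) (min (c / 64) (1 / 16)))
        (by norm_num : (1 / 2 : ℝ) < 1)
      exact ⟨max n m, le_max_left _ _, (pow_le_pow_of_le_one (by norm_num) (by norm_num)
        (le_max_right _ _)).trans hm.le⟩
    rw [le_min_iff, le_min_iff] at hεn
    have hεn' : (1 / 2 : ℝ) ^ n' ≤ (1 / 2) ^ n :=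
      pow_le_pow_of_le_one (by norm_num) (by norm_num) hn'
    obtain ⟨L, hL⟩ := (tendsto_atTop_atTop.1 hP) n
    have hev : Even (2 * n + 1 + 1) := ⟨n + 1, by ring⟩
    obtain ⟨F, κ, r, q, hr, hF, hκ0, hκ1, hv, hR⟩ := M.exists_rapid_combination hP hPQ hQP hw h1 h2
      hev (max L n')
    have hFn : ∀ s ∈ F, n' ≤ s := fun s hs => ((le_max_right _ _).trans hr).trans (hF s hs)
    set v := κ • ∑ s ∈ F, w s with hv_def
    set u := κ • ∑ s ∈ F, z s with hu_def
    set ε : ℝ := (1 / 2) ^ (n' + 1) with hε_def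
    have hε : ε = (1 / 2) ^ n' / 2 := by rw [hε_def, pow_succ]; ring
    have hε0 : 0 < ε := by positivity
    have hu : u ∈ Y := Y.smul_mem _ (Y.sum_mem fun s _ => hz s)
    have huv : ‖u - v‖ ≤ ε := by
      rw [hu_def, hv_def, ← smul_sub, ← Finset.sum_sub_distrib, norm_smul,
        Real.norm_of_nonneg hκ0]
      refine (mul_le_of_le_one_left (norm_nonneg _) hκ1).trans ((norm_sum_le_of_le _ fun s _ => ?_).trans
        (hgeom F n' hFn))
      rw [norm_sub_rev]
      exact hwz s
    have hAu : ‖(M.shift ^ (i + 2)) u‖ ≤ ε := by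
      rw [hu_def, map_smul, map_sum, norm_smul, Real.norm_of_nonneg hκ0]
      exact (mul_le_of_le_one_left (norm_nonneg _) hκ1).trans
        ((norm_sum_le_of_le _ fun s _ => hAz s).trans (hgeom F n' hFn))
    have hpowsub : ∀ m, ‖(M.shift ^ m) u - (M.shift ^ m) v‖ ≤ ε := fun m => by
      rw [← map_sub]
      exact (M.norm_shift_pow_le m _).trans huv
    have hAv : ‖(M.shift ^ (i + 2)) v‖ ≤ 2 * ε := by
      have h3 := norm_sub_norm_le ((M.shift ^ (i + 2)) v) ((M.shift ^ (i + 2)) u)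
      have h4 := hpowsub (i + 2)
      rw [norm_sub_rev] at h4
      linarith
    have hxlow : c / 4 ≤ ‖(M.shift ^ (i + 1)) v‖ := by
      have h3 := hYc u hu
      have h4 := norm_sub_norm_le v u
      rw [norm_sub_rev] at h4
      have h5 := norm_sub_norm_le ((M.shift ^ (i + 1)) u) ((M.shift ^ (i + 1)) v)
      have h6 := hpowsub (i + 1)
      have h7 : c * (3 / 8) ≤ c * ‖u‖ := mul_le_mul_of_nonneg_left (by linarith) hc.le
      linarith
    have hblk : ∀ m, 𝒩.Blk (P r) q (M.vals ((M.shift ^ m) v)) := fun m => by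
      rw [vals_shift_pow_eq]
      exact hR.blk.pow m
    obtain ⟨b, hb1, hb2, hb3, hb4⟩ := exists_fn_top (x := M.vals ((M.shift ^ (i + 1)) v))
      (t := M.vals ((M.shift ^ i) v)) (q := q) (δ := c / 16) (ε := 2 * ε) (by positivity)
      (by positivity) fun a => by
        by_contra! hlt
        set t := (M.shift ^ i) v with ht_def
        have hx : (M.shift ^ (i + 1)) v = M.shift t := by rw [pow_succ']; rfl
        have hSx : (M.shift ^ (i + 2)) v = M.shift (M.shift t) := by
          rw [pow_succ', pow_succ']; rfl
        rw [hx] at hlt hxlow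
        rw [hSx] at hAv
        have hbx := hblk (i + 1)
        rw [hx] at hbx
        have h3 : ‖t - a • M.shift t‖ ≤ 2 * (c / 16) := by
          refine M.norm_le_of_lt (p := P r) (q := q) ?_ (by positivity) fun γ hγ => ?_
          · rw [sub_eq_add_neg, ← neg_smul, map_add, map_smul]
            exact (hblk i).add (hbx.smul _)
          · rw [map_sub, map_smul]
            exact (hlt γ hγ).le
        have h4 : ‖M.shift t - a • M.shift (M.shift t)‖ ≤ 2 * (c / 16) := by
          rw [← map_smul, ← map_sub, ← pow_one M.shift]
          exact (M.norm_shift_pow_le 1 _).trans (by rwa [pow_one])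
        have h5 := norm_sub_norm_le (M.shift t) (a • M.shift (M.shift t))
        have h6 := norm_sub_norm_le (a • M.shift t) t
        rw [norm_sub_rev] at h6
        rw [norm_smul, Real.norm_eq_abs] at h5 h6
        have h7 : ‖t‖ ≤ 8 := (M.norm_shift_pow_le i v).trans (M.norm_le_of_rapid hR)
        have h8 : |a| * ‖M.shift (M.shift t)‖ ≤ |a| * (2 * ε) :=
          mul_le_mul_of_nonneg_left hAv (abs_nonneg a)
        have h9 : |a| * (c / 4) ≤ |a| * ‖M.shift t‖ :=
          mul_le_mul_of_nonneg_left hxlow (abs_nonneg a)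
        have h10 : |a| * c ≤ 32 + c / 2 := by linarith
        have h11 : c / 16 ≤ |a| * ε := by linarith
        have hc1 : c ≤ 32 := by
          have h12 := M.norm_shift_pow_le (i + 1) v
          rw [hx] at h12
          have h13 := M.norm_le_of_rapid hR
          linarith
        have h12 : c * (c / 16) ≤ (32 + c / 2) * ε := by
          calc c * (c / 16) ≤ c * (|a| * ε) := mul_le_mul_of_nonneg_left h11 hc.le
            _ = |a| * c * ε := by ring
            _ ≤ _ := mul_le_mul_of_nonneg_right h10 hε0.le
        have h13 : (32 + c / 2) * ε ≤ 48 * ε := mul_le_mul_of_nonneg_right (by linarith) hε0.le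
        have h14 : 0 < c ^ 2 := by positivity
        linarith
    refine ⟨P r, q, 2 * n + 1, (M.shift ^ (i + 1)) v, hL _ ((le_max_left _ _).trans hr), by omega,
      ?_, b, (M.shift ^ i) v, (M.shift ^ (i + 1)) u, (M.shift ^ i) u, hblk i, hb1, hb2, ?_,
      by linarith, ⟨u, hu, rfl⟩, (hpowsub _).trans (by linarith), (hpowsub _).trans (by linarith)⟩
    · rw [vals_shift_pow_eq]
      exact (hR.mono le_rfl le_rfl le_rfl (by omega)).pow (i + 1)
    · refine (Fn.norm_ev_le_max hb1 (by positivity) (fun γ => ?_) hb3).trans (by linarith)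
      rw [← M.vals_shift]
      refine (M.norm_vals_le _ γ).trans ?_
      rwa [← mul_apply_eq_comp, ← pow_succ']

theorem strictlySingular_shift [FiniteDimensional ℝ E] {Y : Submodule ℝ X}
    (hY : ¬FiniteDimensional ℝ Y) {c : ℝ} (hc : 0 < c) : ∃ y ∈ Y, ‖M.shift y‖ < c * ‖y‖ := by
  by_contra! h
  have key : ∀ i, ∃ Y : Submodule ℝ X, ¬FiniteDimensional ℝ Y ∧ ∃ c > 0, ∀ y ∈ Y,
      c * ‖y‖ ≤ ‖(M.shift ^ (i + 1)) y‖ := by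
    intro i
    induction i with
    | zero => exact ⟨Y, hY, c, hc, by simpa using h⟩
    | succ i ih =>
      by_contra! hcon
      obtain ⟨Y', hY', c', hc', hYc⟩ := ih
      exact M.not_bounded_below hY' hc' hYc fun Z _ hZ d hd => hcon Z hZ d hd
  obtain ⟨Y', hY', c', hc', h'⟩ := key (ord E)
  refine hY' ?_
  have h0 : Y' = ⊥ := by
    rw [eq_bot_iff]
    intro y hy
    have h1 : (M.shift ^ (ord E + 1)) y = 0 := by
      refine M.vals_injective ?_
      rw [vals_shift_pow_eq, pow_succ', pow_ord, mul_zero, map_zero]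
      rfl
    have h2 := h' y hy
    rw [h1, norm_zero] at h2
    rw [Submodule.mem_bot, ← norm_eq_zero]
    nlinarith [norm_nonneg y]
  rw [h0]
  infer_instance

end Model

end NodeSystem

end

section

open NilShift BoundedContinuousFunction

variable {E : Type} [NormedAddCommGroup E] [NormedSpace ℝ E] [NilShift E]

namespace NodeSystem

variable {𝒩 : NodeSystem}

namespace Model

variable {X : Type} [NormedAddCommGroup X] [NormedSpace ℝ X] (M : 𝒩.Model E X)

theorem separableSpace (M : 𝒩.Model E X) [FiniteDimensional ℝ E] :
    TopologicalSpace.SeparableSpace X := by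
  rw [← TopologicalSpace.isSeparable_univ_iff]
  have h1 : TopologicalSpace.IsSeparable
      (⋃ p, (LinearMap.range (M.proj p : X →ₗ[ℝ] X) : Set X)) := by
    refine TopologicalSpace.IsSeparable.iUnion fun p => ?_
    have := M.finiteDimensional_range_proj p
    have h2 : ProperSpace (LinearMap.range (M.proj p : X →ₗ[ℝ] X)) :=
      FiniteDimensional.proper ℝ _
    have h3 := TopologicalSpace.isSeparable_range
      (continuous_subtype_val (p := fun x => x ∈ LinearMap.range (M.proj p : X →ₗ[ℝ] X)))
    rwa [Subtype.range_coe] at h3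
  refine h1.closure.mono fun x _ => mem_closure_of_tendsto (M.tendsto_proj x)
    (Eventually.of_forall fun p => Set.mem_iUnion.2 ⟨p, x, rfl⟩)

theorem poly_single {i : ℕ} (hi : i < ord E) : M.poly (Pi.single i 1) = M.shift ^ i := by
  rw [poly, Finset.sum_eq_single i]
  · simp
  · intro j _ hj
    simp [Pi.single_eq_of_ne hj]
  · intro h
    exact absurd (Finset.mem_range.2 hi) h

theorem not_isCompactOperator_shift_pow {e : E} (he : Generates e) {i : ℕ} (hi : i < ord E) :
    ¬IsCompactOperator (M.shift ^ i) := by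
  intro h
  rw [← M.poly_single hi] at h
  have := M.eq_zero_of_isCompactOperator_poly he h i hi
  simp at this

theorem not_finiteDimensional (M : 𝒩.Model E X) {e : E} (he : Generates e)
    (h0 : 0 < ord E) : ¬FiniteDimensional ℝ X := by
  intro h
  refine M.not_isCompactOperator_shift_pow he h0 ?_
  rw [pow_zero]
  exact isCompactOperator_id_iff_finiteDimensional (𝕜 := ℝ) |>.2 h

theorem shift_pow_ord : M.shift ^ ord E = 0 := by
  ext x
  refine M.vals_injective ?_
  rw [vals_shift_pow_eq, pow_ord, zero_apply, map_zero]
  rfl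

theorem existsUnique_coeff [FiniteDimensional ℝ E] [CompleteSpace X] {e : E} (he : Generates e)
    (T : X →L[ℝ] X) : ∃! lam : Fin (ord E) → ℝ,
      IsCompactOperator (T - ∑ i : Fin (ord E), lam i • M.shift ^ (i : ℕ)) := by
  have hpoly : ∀ c : ℕ → ℝ, ∑ i : Fin (ord E), c i • M.shift ^ (i : ℕ) = M.poly c := fun c =>
    (Finset.sum_range fun i => c i • M.shift ^ i).symm
  obtain ⟨c, hc⟩ := M.exists_poly_compact he T
  refine ⟨fun i => c i, ?_, fun d hd => ?_⟩
  · change IsCompactOperator (T - ∑ i : Fin (ord E), c i • M.shift ^ (i : ℕ))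
    rwa [hpoly]
  · let d' : ℕ → ℝ := fun i => if h : i < ord E then d ⟨i, h⟩ else 0
    have hdd : ∀ i : Fin (ord E), d i = d' i := fun i => by simp [d']
    have h1 : IsCompactOperator (T - M.poly d') := by
      rw [← hpoly]
      simp only [← hdd]
      exact hd
    have h2 : IsCompactOperator (M.poly (d' - c)) := by
      have h3 : M.poly (d' - c) = (T - M.poly c) - (T - M.poly d') := by
        rw [poly_sub]
        abel
      rw [h3]
      exact hc.sub h1
    funext i
    have h3 := M.eq_zero_of_isCompactOperator_poly he h2 i i.2
    rw [hdd]
    exact sub_eq_zero.1 h3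

end Model

/-! ### The sequence space realization -/

variable (𝒩)

/-- The extension operator on bounded sequences. -/
noncomputable def extBdd (p : ℕ) : (ℕ →ᵇ E) →L[ℝ] (ℕ →ᵇ E) :=
  LinearMap.mkContinuous
    { toFun := fun f => ofNormedAddCommGroupDiscrete (𝒩.ext p f) (2 * ‖f‖) fun γ =>
        𝒩.norm_ext_le (norm_nonneg f) γ p fun η _ => f.norm_coe_le_norm η
      map_add' := fun f g => by
        ext1 γ
        exact congrFun ((𝒩.ext p).map_add (f : ℕ → E) (g : ℕ → E)) γ
      map_smul' := fun c f => by
        ext1 γ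
        exact congrFun ((𝒩.ext p).map_smul c (f : ℕ → E)) γ } 2 fun f =>
    (BoundedContinuousFunction.norm_le (by positivity)).2 fun γ =>
      𝒩.norm_ext_le (norm_nonneg f) γ p fun η _ => f.norm_coe_le_norm η

theorem norm_extBdd_le (p : ℕ) (f : ℕ →ᵇ E) : ‖𝒩.extBdd p f‖ ≤ 2 * ‖f‖ :=
  (BoundedContinuousFunction.norm_le (by positivity)).2 fun γ =>
    𝒩.norm_ext_le (norm_nonneg f) γ p fun η _ => f.norm_coe_le_norm η

variable (E) in
/-- The pointwise nilpotent operator on bounded sequences. -/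
noncomputable def shiftBdd : (ℕ →ᵇ E) →L[ℝ] (ℕ →ᵇ E) :=
  LinearMap.mkContinuous
    { toFun := fun f => ofNormedAddCommGroupDiscrete (fun γ => (N (f γ) : E)) ‖f‖ fun γ =>
        (norm_N_le _).trans (f.norm_coe_le_norm γ)
      map_add' := fun f g => by
        ext1 γ
        exact map_add N (f γ) (g γ)
      map_smul' := fun c f => by
        ext1 γ
        exact map_smul N c (f γ) } 1 fun f =>
    (BoundedContinuousFunction.norm_le (by positivity)).2 fun γ => by
      rw [one_mul]
      exact (norm_N_le _).trans (f.norm_coe_le_norm γ)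

theorem extBdd_shiftBdd (p : ℕ) (f : ℕ →ᵇ E) :
    𝒩.extBdd p (shiftBdd E f) = shiftBdd E (𝒩.extBdd p f) := by
  ext1 γ
  have h := congrFun (𝒩.ext_pow 1 p f) γ
  simp only [pow_one] at h
  exact h

variable (E) in
/-- The space attached to a node system: the bounded sequences which are the limits of the
extensions of their restrictions. -/
noncomputable def space : Submodule ℝ (ℕ →ᵇ E) where
  carrier := {f | Tendsto (fun p => 𝒩.extBdd p f) atTop (𝓝 f)}
  add_mem' hf hg := by
    simp only [Set.mem_ofPred_eq, map_add]
    exact Tendsto.add hf hg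
  zero_mem' := by simp
  smul_mem' c f hf := by
    simp only [Set.mem_ofPred_eq, map_smul]
    exact Tendsto.const_smul hf c

theorem mem_space {f : ℕ →ᵇ E} :
    f ∈ 𝒩.space E ↔ Tendsto (fun p => 𝒩.extBdd p f) atTop (𝓝 f) := Iff.rfl

theorem isClosed_space : IsClosed (𝒩.space E : Set (ℕ →ᵇ E)) := by
  refine isClosed_of_closure_subset fun f hf => ?_
  rw [SetLike.mem_coe, mem_space, Metric.tendsto_atTop]
  intro ε hε
  obtain ⟨g, hg, hfg⟩ := Metric.mem_closure_iff.1 hf (ε / 4) (by positivity)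
  obtain ⟨q, hq⟩ := Metric.tendsto_atTop.1 (𝒩.mem_space.1 hg) (ε / 4) (by positivity)
  refine ⟨q, fun p hp => ?_⟩
  have h1 := hq p hp
  rw [dist_eq_norm] at hfg h1 ⊢
  have h2 : 𝒩.extBdd p f - f = 𝒩.extBdd p (f - g) + (𝒩.extBdd p g - g) - (f - g) := by
    rw [map_sub]
    abel
  have h3 := 𝒩.norm_extBdd_le p (f - g)
  rw [h2]
  refine (norm_sub_le _ _).trans_lt ?_
  have h4 := norm_add_le (𝒩.extBdd p (f - g)) (𝒩.extBdd p g - g)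
  linarith

theorem extBdd_mem_space (p : ℕ) (f : ℕ →ᵇ E) : 𝒩.extBdd p f ∈ 𝒩.space E := by
  rw [mem_space]
  refine tendsto_const_nhds.congr' ((eventually_ge_atTop p).mono fun q hq => ?_)
  ext1 γ
  exact (congrFun (𝒩.ext_ext_of_ge f hq) γ).symm

theorem shiftBdd_mem_space {f : ℕ →ᵇ E} (hf : f ∈ 𝒩.space E) : shiftBdd E f ∈ 𝒩.space E := by
  rw [mem_space]
  simp only [extBdd_shiftBdd]
  exact ((shiftBdd E).continuous.tendsto f).comp hf

/-- The sequence space as a model of its node system. -/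
noncomputable def spaceModel : 𝒩.Model E (𝒩.space E) where
  vals :=
    { toFun := fun f => (f : ℕ →ᵇ E)
      map_add' := fun _ _ => rfl
      map_smul' := fun _ _ => rfl }
  norm_vals_le f γ := (f : ℕ →ᵇ E).norm_coe_le_norm γ
  norm_le f _ hC h := (BoundedContinuousFunction.norm_le hC).2 h
  exists_vals q f hf := by
    have hb : ∃ C, 0 ≤ C ∧ ∀ η < q, ‖f η‖ ≤ C :=
      ⟨∑ η ∈ Finset.range q, ‖f η‖, Finset.sum_nonneg fun _ _ => norm_nonneg _, fun η hη =>
        Finset.single_le_sum (f := fun η => ‖f η‖) (fun _ _ => norm_nonneg _)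
          (Finset.mem_range.2 hη)⟩
    obtain ⟨C, hC, h⟩ := hb
    let g : ℕ →ᵇ E := ofNormedAddCommGroupDiscrete f (2 * C) fun γ => by
      rw [← hf]
      exact 𝒩.norm_ext_le hC γ q h
    exact ⟨⟨𝒩.extBdd q g, 𝒩.extBdd_mem_space q g⟩, hf⟩
  proj p := ((𝒩.extBdd p).comp (𝒩.space E).subtypeL).codRestrict _ fun f =>
    𝒩.extBdd_mem_space p (f : ℕ →ᵇ E)
  vals_proj _ _ := rfl
  tendsto_proj f := tendsto_subtype_rng.2 f.2
  shift := ((shiftBdd E).comp (𝒩.space E).subtypeL).codRestrict _ fun f =>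
    𝒩.shiftBdd_mem_space f.2
  vals_shift _ _ := rfl

end NodeSystem

/-! ### The coefficient space -/

section Coefficients

variable (k : ℕ)

/-- The coordinate shift on `Fin k → ℝ`. -/
def coordShift : (Fin k → ℝ) →ₗ[ℝ] (Fin k → ℝ) where
  toFun v a := if 0 < (a : ℕ) then v ⟨a - 1, by omega⟩ else 0
  map_add' v w := by
    ext a
    by_cases h : 0 < (a : ℕ) <;> simp [h]
  map_smul' c v := by
    ext a
    by_cases h : 0 < (a : ℕ) <;> simp [h]

theorem coordShift_pow_apply (i : ℕ) (v : Fin k → ℝ) (a : Fin k) :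
    (coordShift k ^ i) v a = if i ≤ (a : ℕ) then v ⟨a - i, by omega⟩ else 0 := by
  induction i generalizing a with
  | zero => simp
  | succ i ih =>
    rw [pow_succ', Module.End.mul_apply]
    change (if 0 < (a : ℕ) then (coordShift k ^ i) v ⟨a - 1, by omega⟩ else 0) = _
    rw [ih]
    by_cases h : i + 1 ≤ (a : ℕ)
    · rw [if_pos (by omega), if_pos (by simp only; omega), if_pos h]
      congr 2
      simp only
      omega
    · rw [if_neg h]
      by_cases h0 : 0 < (a : ℕ)
      · rw [if_pos h0, if_neg (by simp only; omega)]
      · rw [if_neg h0]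

variable [NeZero k]

theorem coordShift_pow_last {i : ℕ} (hi : i < k) (v : Fin k → ℝ) :
    (coordShift k ^ i) v ⟨k - 1, by omega⟩ = v ⟨k - 1 - i, by omega⟩ := by
  rw [coordShift_pow_apply, if_pos (by simp only; omega)]

noncomputable instance : NilShift (Fin k → ℝ) where
  N := coordShift k
  norm_N_le v := by
    refine (pi_norm_le_iff_of_nonneg (norm_nonneg _)).2 fun a => ?_
    change ‖if 0 < (a : ℕ) then v ⟨a - 1, by omega⟩ else 0‖ ≤ ‖v‖
    split_ifs
    · exact norm_le_pi_norm v _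
    · simp
  top := LinearMap.proj ⟨k - 1, Nat.sub_lt (NeZero.pos k) one_pos⟩
  abs_top_le v := norm_le_pi_norm v _
  ord := k
  exists_top v := by
    by_contra! h
    have hk := NeZero.pos k
    refine lt_irrefl ‖v‖ ((pi_norm_lt_iff ((abs_nonneg _).trans_lt (h 0))).2 fun a => ?_)
    have h1 := h (k - 1 - a)
    rw [LinearMap.proj_apply, coordShift_pow_last k (by omega)] at h1
    have h2 : (⟨k - 1 - (k - 1 - a), by omega⟩ : Fin k) = a := Fin.ext (by simp only; omega)
    rwa [h2] at h1
  exists_repr φ := by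
    have hk := NeZero.pos k
    refine ⟨fun i => if h : i < k then φ (Pi.single ⟨k - 1 - i, by omega⟩ 1) else 0, fun v => ?_⟩
    rw [Finset.sum_range]
    have h1 : φ v = ∑ a : Fin k, v a * φ (Pi.single a 1) := by
      conv_lhs => rw [pi_eq_sum_univ' v]
      simp [map_sum]
    rw [h1, ← Equiv.sum_comp Fin.revPerm]
    refine Finset.sum_congr rfl fun i _ => ?_
    beta_reduce
    rw [dif_pos i.2, LinearMap.proj_apply, coordShift_pow_last k i.2, mul_comm]
    have h2 : Fin.revPerm i = ⟨k - 1 - i, by omega⟩ := Fin.ext (by simp [Fin.val_rev]; omega)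
    rw [h2]
  pow_ord := by
    ext v a
    rw [LinearMap.comp_apply, coordShift_pow_apply, if_neg (by omega)]
    simp

theorem generates_single : Generates (Pi.single 0 1 : Fin k → ℝ) where
  norm_le := by simp [Pi.norm_single]
  le_norm c i hi := by
    change i < k at hi
    refine le_trans (le_of_eq ?_) (norm_le_pi_norm _ (⟨i, hi⟩ : Fin k))
    rw [Real.norm_eq_abs]
    congr 1
    change c i = (∑ j ∈ Finset.range k, c j • (coordShift k ^ j) (Pi.single 0 1)) ⟨i, hi⟩
    rw [Finset.sum_apply, Finset.sum_eq_single i]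
    · rw [Pi.smul_apply, coordShift_pow_apply, if_pos (by simp only; omega)]
      have h : (⟨i - i, by omega⟩ : Fin k) = 0 := Fin.ext (by simp)
      simp only [h, Pi.single_eq_same, smul_eq_mul, mul_one]
    · intro j _ hj
      rw [Pi.smul_apply, coordShift_pow_apply]
      split_ifs with hji
      · have h : (⟨i - j, by omega⟩ : Fin k) ≠ 0 := fun h => hj (by
          have h' := congrArg Fin.val h
          simp only [Fin.val_zero] at h'
          simp only at hji
          omega)
        simp only [Pi.single_eq_of_ne h, smul_zero]
      · exact smul_zero _
    · intro h
      exact absurd (Finset.mem_range.2 hi) h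

end Coefficients

end

end FewOperators

theorem stmt3 (k : ℕ) (hk : 2 ≤ k) :
    ∃ (X : Type) (_ : NormedAddCommGroup X) (_ : NormedSpace ℝ X),
      CompleteSpace X ∧ TopologicalSpace.SeparableSpace X ∧ ¬FiniteDimensional ℝ X ∧
      ∃ S : X →L[ℝ] X, S ^ k = 0 ∧ S ^ (k - 1) ≠ 0 ∧
        StrictlySingular S ∧ ¬IsCompactOperator S ∧
        ∀ T : X →L[ℝ] X, ∃! lam : Fin k → ℝ,
          IsCompactOperator (T - ∑ i : Fin k, lam i • S ^ (i : ℕ)) := by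
  have : NeZero k := ⟨by omega⟩
  let M := FewOperators.theNodes.spaceModel (E := Fin k → ℝ)
  have he := FewOperators.generates_single k
  have hcomp : CompleteSpace (FewOperators.theNodes.space (Fin k → ℝ)) :=
    FewOperators.theNodes.isClosed_space.completeSpace_coe
  refine ⟨FewOperators.theNodes.space (Fin k → ℝ), inferInstance, inferInstance, hcomp,
    M.separableSpace, M.not_finiteDimensional he (NeZero.pos k), M.shift, M.shift_pow_ord, ?_,
    fun Y hY c hc => M.strictlySingular_shift hY hc, ?_, fun T => M.existsUnique_coeff he T⟩
  · intro h
    refine M.not_isCompactOperator_shift_pow he (i := k - 1) (Nat.sub_lt (NeZero.pos k) one_pos) ?_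
    rw [h]
    exact isCompactOperator_zero
  · have h := M.not_isCompactOperator_shift_pow he (i := 1) hk
    rwa [pow_one] at h
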